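/- There exists an absolute constant c > 0 such that for every finite set S of N points in the plane in general position, the number of crossing-free straight-edge spanning cycles of S satisfies sc(S) ≤ c · 12^{N/4} · tr(S), where tr(S) is the number of triangulations of S. -/

import Mathlib

open scoped Classical

noncomputable section

/-- Points of the plane. -/
abbrev Pt : Type := ℝ × ℝ

/-- A finite point set is in general position if no three of its points are collinear. -/
def GenPos (S : Finset Pt) : Prop :=
  ∀ p ∈ S, ∀ q ∈ S, ∀ r ∈ S, p ≠ q → p ≠ r → q ≠ r →
    ¬ Collinear ℝ ({p, q, r} : Set Pt)

/-- The closed straight segment spanned by an unordered pair of points. -/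
def seg2 (e : Sym2 Pt) : Set Pt :=
  Sym2.lift ⟨fun p q => segment ℝ p q, fun p q => segment_symm ℝ p q⟩ e

/-- A crossing-free straight-edge graph (plane graph) on the point set `S`:
its edges are straight segments between points of `S`, any two of which
meet only at shared endpoints. -/
structure PlaneGraph (S : Finset Pt) where
  edges : Finset (Sym2 Pt)
  endpoint_mem : ∀ e ∈ edges, ∀ p, p ∈ e → p ∈ S
  not_isDiag : ∀ e ∈ edges, ¬ e.IsDiag
  noncrossing : ∀ e₁ ∈ edges, ∀ e₂ ∈ edges, e₁ ≠ e₂ →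
    ∀ x ∈ seg2 e₁ ∩ seg2 e₂, x ∈ e₁ ∧ x ∈ e₂

/-- A triangulation of `S` is a maximal plane graph on `S`. -/
def IsTriangulation {S : Finset Pt} (T : PlaneGraph S) : Prop :=
  ∀ G : PlaneGraph S, T.edges ⊆ G.edges → G.edges = T.edges

/-- `tr S`: the number of triangulations of `S`. -/
def triCount (S : Finset Pt) : ℕ :=
  Nat.card {T : PlaneGraph S // IsTriangulation T}

/-- A plane graph is a spanning cycle of `S` if its edges form a Hamiltonian
cycle on `S`. -/
def IsSpanningCycle {S : Finset Pt} (G : PlaneGraph S) : Prop :=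
  3 ≤ S.card ∧ ∃ f : Fin S.card ≃ {p : Pt // p ∈ S},
    G.edges =
      Finset.image (fun i : Fin S.card => s(((f i : Pt)), ((f (finRotate S.card i) : Pt)))) Finset.univ

/-- `sc S`: the number of crossing-free straight-edge spanning cycles of `S`. -/
def scCount (S : Finset Pt) : ℕ :=
  Nat.card {G : PlaneGraph S // IsSpanningCycle G}

/-- A plane graph is a perfect matching of `S` if every point of `S` is incident
to exactly one edge. -/
def IsPerfectMatching {S : Finset Pt} (G : PlaneGraph S) : Prop :=
  ∀ p ∈ S, ∃! e, e ∈ G.edges ∧ p ∈ e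

/-- `pm S`: the number of crossing-free straight-edge perfect matchings of `S`. -/
def pmCount (S : Finset Pt) : ℕ :=
  Nat.card {G : PlaneGraph S // IsPerfectMatching G}

/-- The support of a plane graph `G` on `S`: the number of triangulations of `S`
containing all edges of `G`. -/
def supp {S : Finset Pt} (G : PlaneGraph S) : ℕ :=
  Nat.card {T : PlaneGraph S // IsTriangulation T ∧ G.edges ⊆ T.edges}

/-- A finite set of points is in (strictly) convex position. -/
def InConvexPosition (Q : Finset Pt) : Prop :=
  ∀ p ∈ Q, p ∉ convexHull ℝ (↑(Q.erase p) : Set Pt)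

/-- `p q` is an edge of the convex hull boundary of `Q`. -/
def IsHullEdgeOf (Q : Finset Pt) (p q : Pt) : Prop :=
  p ∈ Q ∧ q ∈ Q ∧ p ≠ q ∧
    segment ℝ p q ⊆ frontier (convexHull ℝ (Q : Set Pt))

/-- `e` is a diagonal of the convex polygon with vertex set `Q`. -/
def IsDiagonalOf (Q : Finset Pt) (e : Sym2 Pt) : Prop :=
  ∃ p ∈ Q, ∃ q ∈ Q, e = s(p, q) ∧
    openSegment ℝ p q ⊆ interior (convexHull ℝ (Q : Set Pt))

/-- `F` is a set of ps-flippable (pseudo-simultaneously flippable) edges of the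
triangulation `T`: the edges of `F` are diagonals of pairwise interior-disjoint
(empty) convex polygons whose boundary edges all belong to `T`. -/
def IsPsFlippable {S : Finset Pt} (T : PlaneGraph S) (F : Finset (Sym2 Pt)) : Prop :=
  F ⊆ T.edges ∧
  ∃ 𝒬 : Finset (Finset Pt),
    (∀ Q ∈ 𝒬, ↑Q ⊆ (S : Set Pt) ∧ 3 ≤ Q.card ∧ InConvexPosition Q ∧
      (∀ p q, IsHullEdgeOf Q p q → s(p, q) ∈ T.edges) ∧
      (∀ p ∈ S, p ∉ interior (convexHull ℝ (Q : Set Pt)))) ∧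
    (∀ Q ∈ 𝒬, ∀ Q' ∈ 𝒬, Q ≠ Q' →
      interior (convexHull ℝ (Q : Set Pt)) ∩ interior (convexHull ℝ (Q' : Set Pt)) = ∅) ∧
    (∀ e ∈ F, ∃ Q ∈ 𝒬, IsDiagonalOf Q e)

/-- The drawing of a plane graph: the union of its (closed) edge segments and
its vertex set. -/
def drawing {S : Finset Pt} (G : PlaneGraph S) : Set Pt :=
  (⋃ e ∈ G.edges, seg2 e) ∪ (S : Set Pt)

/-- A convex decomposition of `S`: a plane graph containing all convex hull
boundary edges, whose bounded faces are all convex, and with no isolated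
vertices. -/
def IsConvexDecomposition {S : Finset Pt} (D : PlaneGraph S) : Prop :=
  (∀ p q, IsHullEdgeOf S p q → s(p, q) ∈ D.edges) ∧
  (∀ x ∉ drawing D, Bornology.IsBounded (connectedComponentIn (drawing D)ᶜ x) →
    Convex ℝ (connectedComponentIn (drawing D)ᶜ x)) ∧
  (∀ p ∈ S, ∃ e ∈ D.edges, p ∈ e)

/-- `p` is an interior vertex of `S` (not on the convex hull boundary). -/
def InteriorVtx (S : Finset Pt) (p : Pt) : Prop :=
  p ∈ S ∧ p ∉ frontier (convexHull ℝ (S : Set Pt))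

/-- `p` has a valid triple of edges in `G`. -/
def IsValidAt {S : Finset Pt} (G : PlaneGraph S) (p : Pt) : Prop :=
  ∃ a ∈ S, ∃ b ∈ S, ∃ c ∈ S,
    p ∈ convexHull ℝ ({a, b, c} : Set Pt) ∧
    s(p, a) ∈ G.edges ∧ s(p, b) ∈ G.edges ∧ s(p, c) ∈ G.edges

/-- The degree of a point in a plane graph. -/
def degree {S : Finset Pt} (G : PlaneGraph S) (p : Pt) : ℕ :=
  (G.edges.filter (fun e => p ∈ e)).card

/-- `a b c` span a triangular face of the triangulation `T`. -/
def IsTriFace {S : Finset Pt} (T : PlaneGraph S) (a b c : Pt) : Prop :=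
  a ∈ S ∧ b ∈ S ∧ c ∈ S ∧
  s(a, b) ∈ T.edges ∧ s(b, c) ∈ T.edges ∧ s(a, c) ∈ T.edges ∧
  ∀ p ∈ S, p ∉ interior (convexHull ℝ ({a, b, c} : Set Pt))

/-- An edge of a triangulation is flippable if its two incident triangles form
a convex quadrilateral. -/
def IsFlippable {S : Finset Pt} (T : PlaneGraph S) (e : Sym2 Pt) : Prop :=
  e ∈ T.edges ∧ ∃ a b c d : Pt, e = s(a, b) ∧ c ≠ d ∧
    IsTriFace T a b c ∧ IsTriFace T a b d ∧
    (openSegment ℝ a b ∩ openSegment ℝ c d).Nonempty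

/-- `flip T`: the number of flippable edges of `T`. -/
def flipCount {S : Finset Pt} (T : PlaneGraph S) : ℕ :=
  (T.edges.filter (fun e => IsFlippable T e)).card

/-- `v3 T`: the number of interior vertices of degree 3 in `T`. -/
def v3 {S : Finset Pt} (T : PlaneGraph S) : ℕ :=
  (S.filter (fun p => p ∉ frontier (convexHull ℝ (S : Set Pt)) ∧ degree T p = 3)).card

/-- The number of vertices of `S` on its convex hull boundary. -/
def hullVtxCount (S : Finset Pt) : ℕ :=
  (S.filter (fun p => p ∈ frontier (convexHull ℝ (S : Set Pt)))).card

namespace PfA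

abbrev II (n : ℕ) := Fin n × Fin 2

def PP {n : ℕ} (A : Matrix (II n) (II n) ℝ) : ℝ :=
  ∑ σ : Equiv.Perm (II n), ((Equiv.Perm.sign σ : ℤ) : ℝ) * ∏ i : Fin n, A (σ (i, 0)) (σ (i, 1))

lemma prod_II {n : ℕ} (f : II n → ℝ) : ∏ x, f x = ∏ i : Fin n, f (i, 0) * f (i, 1) := by
  rw [Fintype.prod_prod_type]
  exact Finset.prod_congr rfl fun i _ => by rw [Fin.prod_univ_two]

lemma PP_congr {n : ℕ} (A B : Matrix (II n) (II n) ℝ) :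
    PP (B * A * B.transpose) = B.det * PP A := by
  have h1 : PP (B * A * B.transpose) = ∑ σ : Equiv.Perm (II n), ((Equiv.Perm.sign σ : ℤ) : ℝ) *
      ∑ g : Fin n → II n × II n, ∏ i : Fin n, (B (σ (i,0)) (g i).1 * A (g i).1 (g i).2 * B (σ (i,1)) (g i).2) := by
    unfold PP
    refine Finset.sum_congr rfl fun σ _ => ?_
    congr 1
    have := Finset.prod_univ_sum (fun _ : Fin n => (Finset.univ : Finset (II n × II n)))
      (fun i p => (B (σ (i,0)) p.1 * A p.1 p.2 * B (σ (i,1)) p.2))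
    rw [Fintype.piFinset_univ] at this
    rw [← this]
    · refine Finset.prod_congr rfl fun i _ => ?_
      rw [Fintype.sum_prod_type, Matrix.mul_apply, Finset.sum_comm]
      refine Finset.sum_congr rfl fun k _ => ?_
      rw [Matrix.mul_apply, Finset.sum_mul]
      rfl
  let e : (II n → II n) ≃ (Fin n → II n × II n) :=
    { toFun := fun g i => (g (i,0), g (i,1))
      invFun := fun h x => if x.2 = 0 then (h x.1).1 else (h x.1).2
      left_inv := by
        intro g; funext ⟨i, s⟩
        fin_cases s <;> simp
      right_inv := by
        intro h; funext i; simp }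
  have h2 : PP (B * A * B.transpose) = ∑ g : II n → II n, (∏ i : Fin n, A (g (i,0)) (g (i,1))) *
      (B.submatrix id g).det := by
    rw [h1]
    simp_rw [Finset.mul_sum]
    rw [Finset.sum_comm, ← e.sum_comp]
    refine Finset.sum_congr rfl fun g _ => ?_
    rw [Matrix.det_apply', Finset.mul_sum]
    refine Finset.sum_congr rfl fun σ _ => ?_
    rw [prod_II]
    simp only [e, Equiv.coe_fn_mk, Matrix.submatrix_apply, id]
    rw [mul_left_comm, ← Finset.prod_mul_distrib]
    congr 1
    exact Finset.prod_congr rfl fun i _ => by ring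
  rw [h2]
  unfold PP
  rw [Finset.mul_sum]
  symm
  refine Finset.sum_of_injOn (fun σ : Equiv.Perm (II n) => (σ : II n → II n)) ?_ ?_ ?_ ?_
  · intro a _ b _ h; exact DFunLike.coe_injective h
  · intro a _; simp
  · intro g _ hg
    have : ¬ Function.Injective g := by
      intro hi
      apply hg
      refine ⟨Equiv.ofBijective g (Finite.injective_iff_bijective.mp hi), by simp, rfl⟩
    rw [Function.Injective] at this
    push Not at this
    obtain ⟨a, b, hab, hne⟩ := this
    rw [Matrix.det_zero_of_column_eq hne (by intro k; simp [hab]), mul_zero]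
  · intro σ _
    rw [Matrix.det_permute']
    ring

def JJ (n : ℕ) : Matrix (II n) (II n) ℝ := fun x y =>
  if x.1 = y.1 then (if x.2 = 0 ∧ y.2 = 1 then 1 else if x.2 = 1 ∧ y.2 = 0 then -1 else 0) else 0

lemma JJ_row (n : ℕ) (x : II n) : ∑ y, (JJ n x y)^2 = 1 := by
  rw [Fintype.sum_prod_type]
  simp only [Fin.sum_univ_two]
  rw [Finset.sum_eq_single x.1]
  · obtain ⟨i, s⟩ := x
    fin_cases s <;> simp [JJ]
  · intro b _ hb
    simp [JJ, hb.symm]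
  · simp

lemma hadamard_fin (m : ℕ) (A : Matrix (Fin m) (Fin m) ℝ) :
    A.det ^ 2 ≤ ∏ x, ∑ y, (A x y)^2 := by
  rcases m with - | m
  · simp
  have : Fact (Module.finrank ℝ (EuclideanSpace ℝ (Fin (m+1))) = m+1) := ⟨by simp⟩
  let b := EuclideanSpace.basisFun (Fin (m+1)) ℝ
  let o : Orientation ℝ (EuclideanSpace ℝ (Fin (m+1))) (Fin (m+1)) := b.toBasis.orientation
  let v : Fin (m+1) → EuclideanSpace ℝ (Fin (m+1)) := fun i => WithLp.toLp 2 (A i)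
  have h := o.abs_volumeForm_apply_le v
  rw [o.volumeForm_robust' b] at h
  have h2 : b.toBasis.det v = A.det := by
    rw [Module.Basis.det_apply, ← Matrix.det_transpose]
    congr 1
  rw [h2] at h
  have h3 : ∏ x, ∑ y, (A x y)^2 = (∏ i, ‖v i‖)^2 := by
    rw [← Finset.prod_pow]
    refine Finset.prod_congr rfl fun i _ => ?_
    rw [EuclideanSpace.norm_sq_eq]
    simp [v]
  rw [h3, ← sq_abs]
  exact pow_le_pow_left₀ (abs_nonneg _) h 2

lemma hadamard_gen {ι : Type} [Fintype ι] [DecidableEq ι] (A : Matrix ι ι ℝ) :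
    A.det ^ 2 ≤ ∏ x, ∑ y, (A x y)^2 := by
  let e := Fintype.equivFin ι
  have h := hadamard_fin _ (Matrix.reindex e e A)
  rw [Matrix.det_reindex_self] at h
  refine h.trans (le_of_eq ?_)
  rw [← e.prod_comp]
  refine Finset.prod_congr rfl fun i _ => ?_
  rw [← e.sum_comp]
  simp

lemma abs_PP_JJ (n : ℕ) : |PP (JJ n)| ≤ 2^n * (n.factorial : ℝ) := by
  let good : Finset (Equiv.Perm (II n)) := Finset.univ.filter fun σ => ∀ i, (σ (i,0)).1 = (σ (i,1)).1
  have h1 : |PP (JJ n)| ≤ (good.card : ℝ) := by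
    unfold PP
    refine (Finset.abs_sum_le_sum_abs _ _).trans ?_
    rw [Finset.card_filter, Nat.cast_sum]
    refine Finset.sum_le_sum fun σ _ => ?_
    rw [abs_mul]
    have : |((Equiv.Perm.sign σ : ℤ) : ℝ)| = 1 := by
      rcases Int.units_eq_one_or (Equiv.Perm.sign σ) with h | h <;> simp [h]
    rw [this, one_mul, Finset.abs_prod]
    split_ifs with hs
    · rw [Nat.cast_one]
      apply Finset.prod_le_one
      · intros; positivity
      · intro i _
        unfold JJ
        split_ifs <;> norm_num
    · push Not at hs
      obtain ⟨i, hi⟩ := hs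
      rw [Finset.prod_eq_zero (Finset.mem_univ i)]
      · simp
      · simp [JJ, hi]
  have h2 : good.card ≤ Fintype.card ((Fin n → Fin 2) × Equiv.Perm (Fin n)) := by
    rw [← Finset.card_univ]
    have hinj : ∀ σ ∈ good, Function.Injective (fun i => (σ (i,0)).1) := by
      intro σ hσ i j hij
      simp only [good, Finset.mem_filter, Finset.mem_univ, true_and] at hσ
      by_contra hne
      have e0 : (σ (i,0)).2 ≠ (σ (j,0)).2 := by
        intro h; have := σ.injective (Prod.ext hij h); simp at this; exact hne this
      have e1 : (σ (i,1)).2 ≠ (σ (j,0)).2 := by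
        intro h
        have := σ.injective (Prod.ext ((hσ i).symm.trans hij) h); simp at this
      have e2 : (σ (i,0)).2 ≠ (σ (i,1)).2 := by
        intro h
        have := σ.injective (Prod.ext (hσ i) h); simp at this
      omega
    refine Finset.card_le_card_of_injOn (fun σ => (fun i => (σ (i,0)).2,
      if h : Function.Injective (fun i => (σ (i,0)).1) then
        Equiv.ofBijective _ (Finite.injective_iff_bijective.mp h) else 1)) (by simp) ?_
    intro σ hσ τ hτ h
    have iσ := hinj σ hσ
    have iτ := hinj τ hτ
    simp only [iσ, iτ, dif_pos, Prod.mk.injEq] at h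
    obtain ⟨ha, hb⟩ := h
    have hb' : ∀ i, (σ (i,0)).1 = (τ (i,0)).1 := fun i => congrArg (fun f : Equiv.Perm (Fin n) => f i) hb
    have ha' : ∀ i, (σ (i,0)).2 = (τ (i,0)).2 := fun i => congrFun ha i
    simp only [good, Finset.mem_coe, Finset.mem_filter, Finset.mem_univ, true_and] at hσ hτ
    ext1 ⟨i, s⟩
    fin_cases s
    · exact Prod.ext (hb' i) (ha' i)
    · refine Prod.ext ?_ ?_
      · show (σ (i,1)).1 = (τ (i,1)).1
        rw [← hσ, ← hτ, hb']
      · show (σ (i,1)).2 = (τ (i,1)).2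
        have e2 : (σ (i,0)).2 ≠ (σ (i,1)).2 := by
          intro h
          have := σ.injective (Prod.ext (hσ i) h); simp at this
        have e3 : (τ (i,0)).2 ≠ (τ (i,1)).2 := by
          intro h
          have := τ.injective (Prod.ext (hτ i) h); simp at this
        have := ha' i
        omega
  refine h1.trans ?_
  have h3 : Fintype.card ((Fin n → Fin 2) × Equiv.Perm (Fin n)) = 2^n * n.factorial := by
    simp [Fintype.card_perm]
  rw [h3] at h2
  exact_mod_cast h2

lemma alt_decomp {ι : Type} [Fintype ι] : ∀ (n : ℕ) (s : Finset ι) (A : ι → ι → ℝ), s.card ≤ 2*n →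
    (∀ x y, A x y = - A y x) → (∀ x y, A x y ≠ 0 → x ∈ s) →
    ∃ b c : Fin n → ι → ℝ, ∀ x y, A x y = ∑ i, (b i x * c i y - c i x * b i y) := by
  intro n
  induction n with
  | zero =>
    intro s A hs ha hsup
    refine ⟨fun _ _ => 0, fun _ _ => 0, fun x y => ?_⟩
    have : s = ∅ := by simpa using hs
    subst this
    by_contra h
    simp at h
    exact absurd (hsup x y h) (by simp)
  | succ n ih =>
    intro s A hs ha hsup
    by_cases h0 : ∀ x y, A x y = 0
    · exact ⟨fun _ _ => 0, fun _ _ => 0, fun x y => by simp [h0]⟩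
    push Not at h0
    obtain ⟨p, q, hpq⟩ := h0
    have hpp : A p p = 0 := by linarith [ha p p]
    have hqq : A q q = 0 := by linarith [ha q q]
    have hqp : A q p = - A p q := ha q p
    have hne : p ≠ q := by rintro rfl; exact hpq hpp
    have hps := hsup p q hpq
    have hqs := hsup q p (by rw [hqp]; exact neg_ne_zero.mpr hpq)
    obtain ⟨b, c, hbc⟩ := ih ((s.erase p).erase q)
      (fun x y => A x y - (A x q * A p y - A x p * A q y) / A p q) (by
        rw [Finset.card_erase_of_mem (by simp [hne.symm, hqs]), Finset.card_erase_of_mem hps]; omega)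
      (by
        intro x y
        rw [ha y x, ha y q, ha y p, ha p x, ha q x]
        ring)
      (by
        intro x y hxy
        rw [Finset.mem_erase, Finset.mem_erase]
        refine ⟨?_, ?_, ?_⟩
        · rintro rfl; apply hxy; rw [hqq, hqp]; field_simp; ring
        · rintro rfl; apply hxy; rw [hpp]; field_simp; ring
        · by_contra hx
          have h1 : ∀ y, A x y = 0 := fun y => by
            by_contra h; exact hx (hsup x y h)
          apply hxy; rw [h1, h1, h1]; simp)
    refine ⟨Fin.cons (fun x => A x q / A p q) b, Fin.cons (fun y => A p y) c, fun x y => ?_⟩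
    rw [Fin.sum_univ_succ]
    simp only [Fin.cons_zero, Fin.cons_succ]
    rw [← hbc, ha p x, ha q y]
    field_simp
    ring

theorem PP_bound {n : ℕ} (A : Matrix (II n) (II n) ℝ) (ha : ∀ x y, A x y = - A y x) :
    (PP A)^4 ≤ (2^n * (n.factorial : ℝ))^4 * ∏ x, ∑ y, (A x y)^2 := by
  obtain ⟨b, c, hbc⟩ := alt_decomp n Finset.univ A (by simp [mul_comm]) ha (by simp)
  let B : Matrix (II n) (II n) ℝ := fun x y => if y.2 = 0 then b y.1 x else c y.1 x
  have hA : A = B * JJ n * B.transpose := by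
    ext x y
    rw [hbc, Matrix.mul_apply, Fintype.sum_prod_type]
    refine Finset.sum_congr rfl fun i _ => ?_
    rw [Fin.sum_univ_two]
    simp only [Matrix.mul_apply, Fintype.sum_prod_type, Fin.sum_univ_two, Matrix.transpose_apply]
    have k0 : ∀ j, j ≠ i → B x (j,0) * JJ n (j,0) (i,0) + B x (j,1) * JJ n (j,1) (i,0) = 0 := by
      intro j hj; simp [JJ, hj]
    have k1 : ∀ j, j ≠ i → B x (j,0) * JJ n (j,0) (i,1) + B x (j,1) * JJ n (j,1) (i,1) = 0 := by
      intro j hj; simp [JJ, hj]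
    rw [Finset.sum_eq_single i (fun j _ h => k0 j h) (by simp),
      Finset.sum_eq_single i (fun j _ h => k1 j h) (by simp)]
    simp [JJ, B]
    ring
  have hP : PP A = B.det * PP (JJ n) := by rw [hA, PP_congr]
  have hD : A.det = B.det^2 * (JJ n).det := by
    rw [hA, Matrix.det_mul, Matrix.det_mul, Matrix.det_transpose]; ring
  have hJ : (JJ n).det^2 = 1 := by
    have : JJ n * JJ n = -1 := by
      ext ⟨i,s⟩ ⟨j,t⟩
      rw [Matrix.mul_apply, Fintype.sum_prod_type]
      simp only [Fin.sum_univ_two]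
      rw [Finset.sum_eq_single i]
      · by_cases hij : i = j
        · subst hij
          fin_cases s <;> fin_cases t <;> simp [JJ]
        · simp [JJ, hij]
      · intro k _ hk
        simp [JJ, hk.symm]
      · simp
    rw [sq, ← Matrix.det_mul, this, Matrix.det_neg]
    simp
  have hH := hadamard_gen A
  rw [hD, mul_pow, hJ, mul_one] at hH
  have hPJ := abs_PP_JJ n
  calc (PP A)^4 = |PP (JJ n)|^4 * (B.det^2)^2 := by
        rw [hP]
        have : |PP (JJ n)|^4 = PP (JJ n)^4 := by
          rw [show (4:ℕ) = 2*2 from rfl, pow_mul, sq_abs, ← pow_mul]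
        rw [this]; ring
    _ ≤ _ := by
        apply mul_le_mul _ hH (by positivity) (by positivity)
        exact pow_le_pow_left₀ (abs_nonneg _) hPJ 4

end PfA

namespace Geo

/-- signed area -/
def orient (p q r : Pt) : ℝ := (q.1-p.1)*(r.2-p.2) - (q.2-p.2)*(r.1-p.1)

/-- point on a line -/
def lp (c d : Pt) (t : ℝ) : Pt := (c.1 + t*(d.1-c.1), c.2 + t*(d.2-c.2))

lemma mem_seg {x c d : Pt} : x ∈ segment ℝ c d ↔ ∃ t, 0 ≤ t ∧ t ≤ 1 ∧ x = lp c d t := by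
  constructor
  · rintro ⟨a, b, ha, hb, hab, rfl⟩
    refine ⟨b, hb, by linarith, ?_⟩
    have : a = 1 - b := by linarith
    subst this
    ext <;> simp [lp] <;> ring
  · rintro ⟨t, h0, h1, rfl⟩
    refine ⟨1-t, t, by linarith, h0, by ring, ?_⟩
    ext <;> simp [lp] <;> ring

lemma orient_lp (p q c d : Pt) (t : ℝ) :
    orient p q (lp c d t) = (1-t) * orient p q c + t * orient p q d := by
  simp only [orient, lp]; ring

lemma orient_rot (p q r : Pt) : orient q r p = orient p q r := by
  simp only [orient]; ring
lemma orient_swap (p q r : Pt) : orient p r q = - orient p q r := by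
  simp only [orient]; ring
lemma orient_swap' (p q r : Pt) : orient q p r = - orient p q r := by
  simp only [orient]; ring
@[simp] lemma orient_self1 (p q : Pt) : orient p q p = 0 := by
  simp only [orient]; ring
@[simp] lemma orient_self2 (p q : Pt) : orient p q q = 0 := by
  simp only [orient]; ring
@[simp] lemma orient_self3 (p q : Pt) : orient p p q = 0 := by
  simp only [orient]; ring
@[simp] lemma lp_zero (c d : Pt) : lp c d 0 = c := by
  ext <;> simp [lp]
@[simp] lemma lp_one (c d : Pt) : lp c d 1 = d := by
  ext <;> simp [lp]
lemma orient_sum (p q r x : Pt) : orient p q x + orient q r x + orient r p x = orient p q r := by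
  simp only [orient]; ring

lemma on_line {p q x : Pt} (h : p ≠ q) (h0 : orient p q x = 0) : ∃ t, x = lp p q t := by
  simp only [orient] at h0
  by_cases h1 : q.1 - p.1 = 0
  · have h2 : q.2 - p.2 ≠ 0 := by
      intro h2
      apply h
      ext <;> linarith
    refine ⟨(x.2-p.2)/(q.2-p.2), ?_⟩
    have h3 : x.1 - p.1 = 0 := by
      rw [h1, zero_mul, zero_sub, neg_eq_zero] at h0
      exact (mul_eq_zero.mp h0).resolve_left h2
    ext
    · simp only [lp]; rw [h1]; linarith
    · simp only [lp]; rw [div_mul_cancel₀ _ h2]; ring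
  · refine ⟨(x.1-p.1)/(q.1-p.1), ?_⟩
    ext
    · simp only [lp]; rw [div_mul_cancel₀ _ h1]; ring
    · simp only [lp]; field_simp; linarith

lemma on_seg {p q r x : Pt} (h : 0 < orient p q r) (h0 : orient p q x = 0)
    (h1 : 0 ≤ orient q r x) (h2 : 0 ≤ orient r p x) : x ∈ segment ℝ p q := by
  have hpq : p ≠ q := by rintro rfl; simp at h
  obtain ⟨t, rfl⟩ := on_line hpq h0
  rw [orient_lp, orient_rot p q r] at h1
  rw [orient_lp, ← orient_rot r p q, orient_self2] at h2
  simp only [orient_self1, mul_zero, add_zero, zero_add] at h1 h2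
  refine mem_seg.mpr ⟨t, ?_, ?_, rfl⟩
  · exact nonneg_of_mul_nonneg_left h2 h
  · have := nonneg_of_mul_nonneg_left h1 h
    linarith

lemma seg_orient {p q x : Pt} (h : x ∈ segment ℝ p q) : orient p q x = 0 := by
  obtain ⟨t, _, _, rfl⟩ := mem_seg.mp h
  simp [orient_lp]

lemma collinear_of_orient {p q r : Pt} (hpq : p ≠ q) (h : orient p q r = 0) :
    Collinear ℝ ({p, q, r} : Set Pt) := by
  obtain ⟨t, rfl⟩ := on_line hpq h
  rw [collinear_iff_of_mem (p₀ := p) (by simp)]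
  refine ⟨q - p, ?_⟩
  intro x hx
  simp only [Set.mem_insert_iff, Set.mem_singleton_iff] at hx
  rcases hx with rfl | rfl | rfl
  · exact ⟨0, by simp⟩
  · exact ⟨1, by simp⟩
  · refine ⟨t, ?_⟩
    ext <;> simp [lp] <;> ring

lemma gp_eq {S : Finset Pt} (h : GenPos S) {p q r : Pt} (hp : p ∈ S) (hq : q ∈ S) (hr : r ∈ S)
    (hpq : p ≠ q) (h0 : orient p q r = 0) : r = p ∨ r = q := by
  by_contra hc
  push Not at hc
  exact h p hp q hq r hr hpq hc.1.symm hc.2.symm (collinear_of_orient hpq h0)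

lemma gp_seg {S : Finset Pt} (h : GenPos S) {p q r : Pt} (hp : p ∈ S) (hq : q ∈ S) (hr : r ∈ S)
    (hpq : p ≠ q) (h0 : r ∈ segment ℝ p q) : r = p ∨ r = q :=
  gp_eq h hp hq hr hpq (seg_orient h0)

lemma seg_back {c d x y : Pt} (hx : x ∈ segment ℝ c d) (hy : y ∈ segment ℝ x c) (hne : y ≠ x)
    (hcd : c ≠ d) : y ≠ d := by
  obtain ⟨t, ht0, ht1, rfl⟩ := mem_seg.mp hx
  obtain ⟨u, hu0, hu1, rfl⟩ := mem_seg.mp hy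
  intro h
  have key : (1-u)*t = 1 := by
    have h1 : ((1-u)*t - 1)*(d.1-c.1) = 0 := by
      have := congrArg Prod.fst h; simp only [lp] at this; linarith
    have h2 : ((1-u)*t - 1)*(d.2-c.2) = 0 := by
      have := congrArg Prod.snd h; simp only [lp] at this; linarith
    by_contra hk
    have hk' : (1-u)*t - 1 ≠ 0 := fun h => hk (by linarith)
    apply hcd
    ext
    · have := (mul_eq_zero.mp h1).resolve_left hk'; linarith
    · have := (mul_eq_zero.mp h2).resolve_left hk'; linarith
  have hu : u = 0 := by nlinarith
  subst hu
  exact hne (by simp)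

/-- numeric exit lemma -/
lemma exit_num (α β : Fin 3 → ℝ) (hα : ∀ i, 0 ≤ α i) (hαβ : ∀ i, β i ≤ 0 → 0 < α i)
    (hex : ∃ i, β i ≤ 0) :
    ∃ t, 0 < t ∧ t ≤ 1 ∧ (∀ i, 0 ≤ (1-t)*α i + t * β i) ∧
      ∃ i, β i ≤ 0 ∧ (1-t)*α i + t * β i = 0 := by
  obtain ⟨i, hi, hmin⟩ := Finset.exists_min_image (Finset.univ.filter fun i => β i ≤ 0)
    (fun i => α i / (α i - β i)) (by obtain ⟨i, hi⟩ := hex; exact ⟨i, by simpa using hi⟩)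
  simp only [Finset.mem_filter, Finset.mem_univ, true_and] at hi hmin
  have hai := hαβ i hi
  have hd : 0 < α i - β i := by linarith
  set t := α i / (α i - β i) with ht
  have ht0 : 0 < t := div_pos hai hd
  have ht1 : t ≤ 1 := by rw [ht, div_le_one hd]; linarith
  refine ⟨t, ht0, ht1, ?_, i, hi, ?_⟩
  · intro j
    by_cases hj : β j ≤ 0
    · have hdj : 0 < α j - β j := by linarith [hαβ j hj]
      have := hmin j hj
      rw [le_div_iff₀ hdj] at this
      linarith
    · have := hα j
      have h1 : 0 ≤ (1-t)*α j := mul_nonneg (by linarith) this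
      have h2 : 0 ≤ t * β j := mul_nonneg ht0.le (by linarith)
      linarith
  · have : t * (α i - β i) = α i := div_mul_cancel₀ _ hd.ne'
    linarith

lemma lp_ne {x c : Pt} {t : ℝ} (ht : t ≠ 0) (h : x ≠ c) : lp x c t ≠ x := by
  intro he
  apply h
  have h1 := congrArg Prod.fst he
  have h2 := congrArg Prod.snd he
  simp only [lp] at h1 h2
  have h3 : t * (c.1 - x.1) = 0 := by linarith
  have h4 : t * (c.2 - x.2) = 0 := by linarith
  ext
  · have := (mul_eq_zero.mp h3).resolve_left ht; linarith
  · have := (mul_eq_zero.mp h4).resolve_left ht; linarith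

lemma tri_exit {p q r x c : Pt} (h : 0 < orient p q r)
    (x1 : 0 ≤ orient p q x) (x2 : 0 ≤ orient q r x) (x3 : 0 ≤ orient r p x)
    (c1 : orient p q c ≤ 0 → 0 < orient p q x) (c2 : orient q r c ≤ 0 → 0 < orient q r x)
    (c3 : orient r p c ≤ 0 → 0 < orient r p x)
    (hc : orient p q c ≤ 0 ∨ orient q r c ≤ 0 ∨ orient r p c ≤ 0) :
    ∃ y, y ∈ segment ℝ x c ∧ y ≠ x ∧ ((y ∈ segment ℝ p q ∧ orient p q c ≤ 0) ∨
      (y ∈ segment ℝ q r ∧ orient q r c ≤ 0) ∨ (y ∈ segment ℝ r p ∧ orient r p c ≤ 0)) := by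
  obtain ⟨t, ht0, ht1, hall, i, hi, hi0⟩ := exit_num ![orient p q x, orient q r x, orient r p x]
    ![orient p q c, orient q r c, orient r p c] (by intro i; fin_cases i <;> simpa)
    (by intro i; fin_cases i <;> simpa) (by
      rcases hc with h | h | h
      · exact ⟨0, by simpa⟩
      · exact ⟨1, by simpa⟩
      · exact ⟨2, by simpa⟩)
  have a1 := hall 0
  have a2 := hall 1
  have a3 := hall 2
  simp only [Fin.isValue, Matrix.cons_val_zero, Matrix.cons_val_one, Matrix.cons_val] at a1 a2 a3
  rw [← orient_lp] at a1 a2 a3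
  have hxc : x ≠ c := by
    rintro rfl
    rcases hc with h | h | h
    · linarith [c1 h]
    · linarith [c2 h]
    · linarith [c3 h]
  refine ⟨lp x c t, mem_seg.mpr ⟨t, ht0.le, ht1, rfl⟩, lp_ne ht0.ne' hxc, ?_⟩
  fin_cases i
  · simp only [Fin.zero_eta, Fin.isValue, Matrix.cons_val_zero] at hi hi0
    rw [← orient_lp] at hi0
    exact Or.inl ⟨on_seg h hi0 a2 a3, hi⟩
  · simp only [Fin.mk_one, Fin.isValue, Matrix.cons_val_one, Matrix.cons_val_zero] at hi hi0
    rw [← orient_lp] at hi0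
    exact Or.inr (Or.inl ⟨on_seg (by rwa [orient_rot]) hi0 a3 a1, hi⟩)
  · simp only [Fin.reduceFinMk, Fin.isValue, Matrix.cons_val] at hi hi0
    rw [← orient_lp] at hi0
    exact Or.inr (Or.inr ⟨on_seg (by rwa [orient_rot, orient_rot]) hi0 a1 a2, hi⟩)

lemma max_angle (p q : Pt) (s : Finset Pt) (hs : s.Nonempty) (hl : ∀ c ∈ s, 0 < orient p q c) :
    ∃ r ∈ s, ∀ c ∈ s, orient p r c ≤ 0 := by
  obtain ⟨r, hr, hmin⟩ := Finset.exists_min_image s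
    (fun c => ((c.1-p.1)*(q.1-p.1) + (c.2-p.2)*(q.2-p.2)) / orient p q c) hs
  refine ⟨r, hr, fun c hc => ?_⟩
  have h := hmin c hc
  have hr' := hl r hr
  have hc' := hl c hc
  rw [div_le_div_iff₀ hr' hc'] at h
  have key : orient p r c * ((q.1-p.1)^2 + (q.2-p.2)^2) =
    ((r.1-p.1)*(q.1-p.1) + (r.2-p.2)*(q.2-p.2)) * orient p q c -
    ((c.1-p.1)*(q.1-p.1) + (c.2-p.2)*(q.2-p.2)) * orient p q r := by
    simp only [orient]; ring
  have hpos : 0 < (q.1-p.1)^2 + (q.2-p.2)^2 := by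
    by_contra hn
    have h1 : (q.1-p.1) = 0 := by nlinarith [sq_nonneg (q.1-p.1), sq_nonneg (q.2-p.2)]
    have h2 : (q.2-p.2) = 0 := by nlinarith [sq_nonneg (q.1-p.1), sq_nonneg (q.2-p.2)]
    simp only [orient, h1, h2] at hr'
    linarith
  by_contra hn
  push Not at hn
  have := mul_pos hn hpos
  linarith

lemma orient_refl (p q c : Pt) : orient p (lp p q (-1)) c = - orient p q c := by
  simp only [orient, lp]; ring

lemma min_angle (p q : Pt) (s : Finset Pt) (hs : s.Nonempty) (hl : ∀ c ∈ s, 0 < orient p q c) :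
    ∃ r ∈ s, ∀ c ∈ s, 0 ≤ orient p r c := by
  obtain ⟨r, hr, hmin⟩ := Finset.exists_max_image s
    (fun c => ((c.1-p.1)*(q.1-p.1) + (c.2-p.2)*(q.2-p.2)) / orient p q c) hs
  refine ⟨r, hr, fun c hc => ?_⟩
  have h := hmin c hc
  have hr' := hl r hr
  have hc' := hl c hc
  rw [div_le_div_iff₀ hc' hr'] at h
  have key : orient p r c * ((q.1-p.1)^2 + (q.2-p.2)^2) =
    ((r.1-p.1)*(q.1-p.1) + (r.2-p.2)*(q.2-p.2)) * orient p q c -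
    ((c.1-p.1)*(q.1-p.1) + (c.2-p.2)*(q.2-p.2)) * orient p q r := by
    simp only [orient]; ring
  have hpos : 0 < (q.1-p.1)^2 + (q.2-p.2)^2 := by
    by_contra hn
    have h1 : (q.1-p.1) = 0 := by nlinarith [sq_nonneg (q.1-p.1), sq_nonneg (q.2-p.2)]
    have h2 : (q.2-p.2) = 0 := by nlinarith [sq_nonneg (q.1-p.1), sq_nonneg (q.2-p.2)]
    simp only [orient, h1, h2] at hr'
    linarith
  by_contra hn
  push Not at hn
  have := mul_neg_of_neg_of_pos hn hpos
  linarith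

/-! plane graphs -/

def Ed {S : Finset Pt} (T : PlaneGraph S) (p q : Pt) : Prop := s(p, q) ∈ T.edges

variable {S : Finset Pt} {T : PlaneGraph S}

lemma Ed.symm {p q : Pt} (h : Ed T p q) : Ed T q p := by
  unfold Ed at *; rwa [Sym2.eq_swap]
lemma Ed.left {p q : Pt} (h : Ed T p q) : p ∈ S := T.endpoint_mem _ h p (by simp)
lemma Ed.right {p q : Pt} (h : Ed T p q) : q ∈ S := T.endpoint_mem _ h q (by simp)
lemma Ed.ne {p q : Pt} (h : Ed T p q) : p ≠ q := by
  have := T.not_isDiag _ h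
  simpa using this

lemma Ed.nc {a b c d x : Pt} (h : Ed T a b) (h' : Ed T c d) (hne : s(a,b) ≠ s(c,d))
    (hx : x ∈ segment ℝ a b) (hx' : x ∈ segment ℝ c d) : (x = a ∨ x = b) ∧ (x = c ∨ x = d) := by
  have := T.noncrossing _ h _ h' hne x ⟨hx, hx'⟩
  simpa using this

lemma insert_plane (D : PlaneGraph S) {p q : Pt} (hp : p ∈ S) (hq : q ∈ S) (hpq : p ≠ q)
    (h : ∀ c d x, Ed D c d → x ∈ segment ℝ p q → x ∈ segment ℝ c d → s(c,d) ≠ s(p,q) →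
      (x = p ∨ x = q) ∧ (x = c ∨ x = d)) :
    ∃ G : PlaneGraph S, G.edges = insert s(p,q) D.edges := by
  refine ⟨⟨insert s(p,q) D.edges, ?_, ?_, ?_⟩, rfl⟩
  · intro e he x hx
    rw [Finset.mem_insert] at he
    rcases he with rfl | he
    · simp at hx
      rcases hx with rfl | rfl <;> assumption
    · exact D.endpoint_mem e he x hx
  · intro e he
    rw [Finset.mem_insert] at he
    rcases he with rfl | he
    · simpa using hpq
    · exact D.not_isDiag e he
  · intro e₁ h₁ e₂ h₂ hne x hx
    rw [Finset.mem_insert] at h₁ h₂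
    rcases h₁ with rfl | h₁ <;> rcases h₂ with rfl | h₂
    · exact absurd rfl hne
    · induction e₂ using Sym2.ind with | _ c d =>
      have := h c d x h₂ hx.1 hx.2 (Ne.symm hne)
      simpa using this
    · induction e₁ using Sym2.ind with | _ c d =>
      have := h c d x h₁ hx.2 hx.1 hne
      simpa using this.symm
    · exact D.noncrossing _ h₁ _ h₂ hne x hx

lemma max_cross (hS : GenPos S) (hT : IsTriangulation T) {p q : Pt} (hp : p ∈ S) (hq : q ∈ S)
    (hpq : p ≠ q) (h : ¬ Ed T p q) : ∃ c d x, Ed T c d ∧ x ∈ segment ℝ p q ∧ x ∈ segment ℝ c d ∧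
      0 < orient p q c ∧ orient p q d < 0 ∧ x ∉ S := by
  by_contra hcon
  obtain ⟨G, hG⟩ := insert_plane T hp hq hpq (by
    intro c d x hcd hx hx' hne
    by_contra hn
    have hxS : x ∉ S := by
      intro hxS
      exact hn ⟨gp_seg hS hp hq hxS hpq hx, gp_seg hS hcd.left hcd.right hxS hcd.ne hx'⟩
    have hx0 := seg_orient hx
    obtain ⟨t, ht0, ht1, rfl⟩ := mem_seg.mp hx'
    have ht0' : 0 < t := lt_of_le_of_ne ht0 (by rintro rfl; simp at hxS; exact hxS hcd.left)
    have ht1' : t < 1 := lt_of_le_of_ne ht1 (by rintro rfl; simp at hxS; exact hxS hcd.right)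
    rw [orient_lp] at hx0
    have hc0 : orient p q c ≠ 0 := by
      intro h0
      rw [h0, mul_zero, zero_add] at hx0
      have hd0 := (mul_eq_zero.mp hx0).resolve_left ht0'.ne'
      have e1 := gp_eq hS hp hq hcd.left hpq h0
      have e2 := gp_eq hS hp hq hcd.right hpq hd0
      have := hcd.ne
      apply hne
      rcases e1 with rfl | rfl <;> rcases e2 with rfl | rfl
      · exact absurd rfl this
      · rfl
      · exact Sym2.eq_swap
      · exact absurd rfl this
    rcases lt_or_gt_of_ne hc0 with hc | hc
    · exact hcon ⟨d, c, _, hcd.symm, hx, by rwa [segment_symm], by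
        by_contra hd; push Not at hd; nlinarith, hc, hxS⟩
    · exact hcon ⟨c, d, _, hcd, hx, hx', hc, by
        by_contra hd; push Not at hd; nlinarith, hxS⟩)
  have := hT G (by rw [hG]; exact Finset.subset_insert _ _)
  apply h
  unfold Ed
  rw [← this, hG]
  exact Finset.mem_insert_self _ _

/-- empty triangle of T, counterclockwise -/
structure IsTr (T : PlaneGraph S) (p q r : Pt) : Prop where
  pos : 0 < orient p q r
  e1 : Ed T p q
  e2 : Ed T q r
  e3 : Ed T r p
  emp : ∀ s ∈ S, ¬ (0 < orient p q s ∧ 0 < orient q r s ∧ 0 < orient r p s)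

lemma IsTr.rot {p q r : Pt} (h : IsTr T p q r) : IsTr T q r p :=
  ⟨by rw [orient_rot]; exact h.pos, h.e2, h.e3, h.e1, fun s hs hh => h.emp s hs ⟨hh.2.2, hh.1, hh.2.1⟩⟩

lemma IsTr.exitS {p q r : Pt} (h : IsTr T p q r) {c : Pt} (hc : c ∈ S) :
    orient p q c ≤ 0 ∨ orient q r c ≤ 0 ∨ orient r p c ≤ 0 := by
  have := h.emp c hc
  by_contra hn
  push Not at hn
  exact this hn

lemma IsTr.cross_aux {p q r x c d : Pt} (h : IsTr T p q r) (hcd : Ed T c d)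
    (hx : x ∈ segment ℝ c d) (x1 : 0 < orient p q x) (x2 : 0 < orient q r x)
    (x3 : 0 < orient r p x) : c = p ∨ c = q ∨ c = r := by
  obtain ⟨y, hy, hyx, hcase⟩ := tri_exit h.pos x1.le x2.le x3.le (fun _ => x1) (fun _ => x2)
    (fun _ => x3) (h.exitS hcd.left)
  have hyd := seg_back hx hy hyx hcd.ne
  have hycd : y ∈ segment ℝ c d :=
    (convex_segment c d).segment_subset hx (left_mem_segment ℝ c d) hy
  have side : ∀ {u v}, Ed T u v → 0 < orient u v x → y ∈ segment ℝ u v → c = u ∨ c = v := by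
    intro u v huv hux hyuv
    have hne : s(c,d) ≠ s(u,v) := by
      intro he
      rw [Sym2.eq_iff] at he
      rcases he with ⟨rfl, rfl⟩ | ⟨rfl, rfl⟩
      · rw [seg_orient hx] at hux; exact lt_irrefl _ hux
      · rw [segment_symm] at hx; rw [seg_orient hx] at hux; exact lt_irrefl _ hux
    have := hcd.nc huv hne hycd hyuv
    rcases this.1 with rfl | h'
    · exact this.2
    · exact absurd h' hyd
  rcases hcase with ⟨hh, _⟩ | ⟨hh, _⟩ | ⟨hh, _⟩
  · have := side h.e1 x1 hh; tauto
  · have := side h.e2 x2 hh; tauto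
  · have := side h.e3 x3 hh; tauto

lemma IsTr.cross {p q r x c d : Pt} (h : IsTr T p q r) (hcd : Ed T c d)
    (hx : x ∈ segment ℝ c d) (x1 : 0 < orient p q x) (x2 : 0 < orient q r x)
    (x3 : 0 < orient r p x) : False := by
  have hc := h.cross_aux hcd hx x1 x2 x3
  have hd := h.cross_aux hcd.symm (by rwa [segment_symm]) x1 x2 x3
  have hx0 := seg_orient hx
  have hne := hcd.ne
  have o1 := orient_swap' p q x
  have o2 := orient_swap' q r x
  have o3 := orient_swap' r p x
  rcases hc with rfl | rfl | rfl <;> rcases hd with rfl | rfl | rfl <;>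
    first | exact hne rfl | linarith

lemma IsTr.wedge {p q r c : Pt} (h : IsTr T p q r) (hc : Ed T p c) (h1 : 0 < orient p q c)
    (h2 : 0 < orient p c r) : False := by
  have h3 : 0 < orient r p c := by rwa [← orient_rot]
  have hqr : 0 < orient q r p := by rw [orient_rot]; exact h.pos
  obtain ⟨y, hy, hyx, hcase⟩ := tri_exit (x := p) h.pos (by simp) hqr.le (by simp)
    (fun h => absurd h1 (not_lt.mpr h)) (fun _ => hqr) (fun h => absurd h3 (not_lt.mpr h))
    (h.exitS hc.right)
  rcases hcase with ⟨_, hh⟩ | ⟨hh, _⟩ | ⟨_, hh⟩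
  · linarith
  · have hne : s(p,c) ≠ s(q,r) := by
      intro he
      rw [Sym2.eq_iff] at he
      rcases he with ⟨rfl, rfl⟩ | ⟨rfl, rfl⟩
      · exact h.e1.ne rfl
      · exact h.e3.ne rfl
    have := hc.nc h.e2 hne hy hh
    rcases this.1 with rfl | rfl
    · exact hyx rfl
    · rcases this.2 with rfl | rfl
      · simp at h1
      · simp at h3
  · linarith

lemma IsTr.of_wedge (hS : GenPos S) (hT : IsTriangulation T) {p q r : Pt} (hq : Ed T p q)
    (hr : Ed T p r) (hpos : 0 < orient p q r)
    (hw : ∀ c, Ed T p c → ¬ (0 < orient p q c ∧ 0 < orient p c r)) : IsTr T p q r := by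
  have hemp : ∀ s ∈ S, ¬ (0 < orient p q s ∧ 0 < orient q r s ∧ 0 < orient r p s) := by
    by_contra hcon
    push Not at hcon
    obtain ⟨z0, hz0, hz0'⟩ := hcon
    obtain ⟨z, hz, hmax⟩ := Finset.exists_max_image
      (S.filter fun s => 0 < orient p q s ∧ 0 < orient q r s ∧ 0 < orient r p s)
      (fun s => orient q r s) ⟨z0, by simpa using ⟨hz0, hz0'⟩⟩
    simp only [Finset.mem_filter] at hz hmax
    obtain ⟨hzS, z1, z2, z3⟩ := hz
    have hpz : p ≠ z := by rintro rfl; simp at z1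
    have hnE : ¬ Ed T p z := fun hE => hw z hE ⟨z1, by rw [← orient_rot r p z] at z3; exact z3⟩
    obtain ⟨c, d, x, hcd, hxz, hxcd, hc, hd, hxS⟩ := max_cross hS hT hq.left hzS hpz hnE
    have hx' := hxz
    obtain ⟨t, ht0, ht1, rfl⟩ := mem_seg.mp hx'
    have ht0' : 0 < t := lt_of_le_of_ne ht0 (by rintro rfl; simp at hxS; exact hxS hq.left)
    have ht1' : t < 1 := lt_of_le_of_ne ht1 (by rintro rfl; simp at hxS; exact hxS hzS)
    have x1 : 0 < orient p q (lp p z t) := by rw [orient_lp]; simp; positivity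
    have x3 : 0 < orient r p (lp p z t) := by rw [orient_lp]; simp; positivity
    have x2' : orient q r z < orient q r (lp p z t) := by
      rw [orient_lp]
      have := orient_sum p q r z
      rw [orient_rot p q r]
      nlinarith
    have x2 : 0 < orient q r (lp p z t) := z2.trans x2'
    have key : ∀ c d, Ed T c d → lp p z t ∈ segment ℝ c d → orient p z c ≠ 0 →
        orient q r (lp p z t) ≤ orient q r c → False := by
      intro c d hcd hx hc0 hle
      have hcS := hcd.left
      have c2 : 0 < orient q r c := x2.trans_le hle
      have hout : orient p q c ≤ 0 ∨ orient q r c ≤ 0 ∨ orient r p c ≤ 0 := by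
        by_contra hn
        push Not at hn
        have := hmax c ⟨hcS, hn⟩
        linarith
      obtain ⟨y, hy, hyx, hcase⟩ := tri_exit hpos x1.le x2.le x3.le (fun _ => x1) (fun _ => x2)
        (fun _ => x3) hout
      have hyd := seg_back hx hy hyx hcd.ne
      have hycd : y ∈ segment ℝ c d :=
        (convex_segment c d).segment_subset hx (left_mem_segment ℝ c d) hy
      have side : ∀ {u v}, Ed T u v → 0 < orient u v (lp p z t) → y ∈ segment ℝ u v →
          c = u ∨ c = v := by
        intro u v huv hux hyuv
        have hne : s(c,d) ≠ s(u,v) := by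
          intro he
          rw [Sym2.eq_iff] at he
          rcases he with ⟨rfl, rfl⟩ | ⟨rfl, rfl⟩
          · rw [seg_orient hx] at hux; exact lt_irrefl _ hux
          · rw [segment_symm] at hx; rw [seg_orient hx] at hux; exact lt_irrefl _ hux
        have := hcd.nc huv hne hycd hyuv
        rcases this.1 with rfl | h'
        · exact this.2
        · exact absurd h' hyd
      rcases hcase with ⟨hh, _⟩ | ⟨hh, hh'⟩ | ⟨hh, _⟩
      · rcases side hq x1 hh with rfl | rfl
        · simp at hc0
        · simp at c2
      · linarith
      · rcases side hr.symm x3 hh with rfl | rfl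
        · simp at c2
        · simp at hc0
    have : orient q r (lp p z t) ≤ orient q r c ∨ orient q r (lp p z t) ≤ orient q r d := by
      obtain ⟨u, hu0, hu1, hu⟩ := mem_seg.mp hxcd
      rw [hu, orient_lp]
      rcases le_total (orient q r c) (orient q r d) with h | h
      · right; nlinarith
      · left; nlinarith
    rcases this with h | h
    · exact key c d hcd hxcd hc.ne' h
    · exact key d c hcd.symm (by rwa [segment_symm]) hd.ne h
  refine ⟨hpos, hq, ?_, hr.symm, hemp⟩
  by_contra hnE
  have hqr : q ≠ r := by rintro rfl; simp at hpos
  obtain ⟨c, d, x, hcd, hxz, hxcd, hc, hd, hxS⟩ := max_cross hS hT hq.right hr.right hqr hnE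
  have hx' := hxz
  obtain ⟨t, ht0, ht1, rfl⟩ := mem_seg.mp hx'
  have ht0' : 0 < t := lt_of_le_of_ne ht0 (by rintro rfl; simp at hxS; exact hxS hq.right)
  have ht1' : t < 1 := lt_of_le_of_ne ht1 (by rintro rfl; simp at hxS; exact hxS hr.right)
  have x1 : 0 < orient p q (lp q r t) := by rw [orient_lp]; simp; positivity
  have x3 : 0 < orient r p (lp q r t) := by
    rw [orient_lp, ← orient_rot r p q] at *; simp
    exact mul_pos (by linarith) hpos
  have x2 : 0 ≤ orient q r (lp q r t) := (seg_orient hxz).ge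
  have hout : orient p q c ≤ 0 ∨ orient q r c ≤ 0 ∨ orient r p c ≤ 0 := by
    by_contra hn
    push Not at hn
    exact hemp c hcd.left hn
  obtain ⟨y, hy, hyx, hcase⟩ := tri_exit hpos x1.le x2 x3.le (fun _ => x1)
    (fun h => absurd hc (not_lt.mpr h)) (fun _ => x3) hout
  have hyd := seg_back hxcd hy hyx hcd.ne
  have hycd : y ∈ segment ℝ c d :=
    (convex_segment c d).segment_subset hxcd (left_mem_segment ℝ c d) hy
  have side : ∀ {u v}, Ed T u v → 0 < orient u v (lp q r t) → y ∈ segment ℝ u v →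
      c = u ∨ c = v := by
    intro u v huv hux hyuv
    have hne : s(c,d) ≠ s(u,v) := by
      intro he
      rw [Sym2.eq_iff] at he
      rcases he with ⟨rfl, rfl⟩ | ⟨rfl, rfl⟩
      · rw [seg_orient hxcd] at hux; exact lt_irrefl _ hux
      · rw [segment_symm] at hxcd; rw [seg_orient hxcd] at hux; exact lt_irrefl _ hux
    have := hcd.nc huv hne hycd hyuv
    rcases this.1 with rfl | h'
    · exact this.2
    · exact absurd h' hyd
  have hcp : c = p := by
    rcases hcase with ⟨hh, _⟩ | ⟨hh, hh'⟩ | ⟨hh, _⟩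
    · rcases side hq x1 hh with rfl | rfl
      · rfl
      · simp at hc
    · linarith
    · rcases side hr.symm x3 hh with rfl | rfl
      · simp at hc
      · rfl
  subst hcp
  obtain ⟨u, hu0, hu1, hu⟩ := mem_seg.mp hxcd
  rw [hu, orient_lp] at x1 x3
  simp only [orient_self1, orient_self2, mul_zero, zero_add] at x1 x3
  refine hw d hcd ⟨pos_of_mul_pos_right x1 hu0, ?_⟩
  have := pos_of_mul_pos_right x3 hu0
  rwa [← orient_rot] at this

end Geo

namespace Geo
variable {S : Finset Pt} {T : PlaneGraph S}

lemma orient_lp1 (p s : Pt) (e : ℝ) (c : Pt) : orient p (lp p s e) c = e * orient p s c := by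
  simp only [orient, lp]; ring

lemma Ed.mem_of_ne {a b c d x : Pt} (h : Ed T a b) (h' : Ed T c d) (hne : s(a,b) ≠ s(c,d))
    (hx : x ∈ segment ℝ a b) (hx' : x ∈ segment ℝ c d) : x ∈ S := by
  rcases (h.nc h' hne hx hx').1 with rfl | rfl
  · exact h.left
  · exact h.right

lemma nbr_aux (hS : GenPos S) (hT : IsTriangulation T) {p q x0 c d : Pt} {e : ℝ}
    (he : 0 < e ∨ e < 0)
    (hp : p ∈ S) (hx0 : x0 ∉ S) (hcd : Ed T c d) (hxcd : x0 ∈ segment ℝ c d)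
    (hpos : 0 < e * orient p x0 c) (hq0 : 0 < orient p q x0) (hqc : 0 < orient p q c)
    (hmin : ∀ a b y, Ed T a b → y ∈ segment ℝ p x0 → y ∈ segment ℝ a b → y = p ∨ y = x0) :
    ∃ z, Ed T p z ∧ 0 < orient p q z := by
  set Z := S.filter fun w => 0 < e * orient p x0 w ∧ 0 ≤ e * orient x0 c w ∧ 0 ≤ e * orient c p w
    with hZ
  have hcZ : c ∈ Z := by simp [hZ, hcd.left, hpos]
  have hz : ∃ z ∈ Z, ∀ w ∈ Z, 0 ≤ e * orient p z w := by
    have hl : ∀ w ∈ Z, 0 < orient p (lp p x0 e) w := by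
      intro w hw
      rw [orient_lp1]
      exact (Finset.mem_filter.mp hw).2.1
    rcases he with he | he
    · obtain ⟨z, hz, h⟩ := min_angle p (lp p x0 e) Z ⟨c, hcZ⟩ hl
      exact ⟨z, hz, fun w hw => mul_nonneg he.le (h w hw)⟩
    · obtain ⟨z, hz, h⟩ := max_angle p (lp p x0 e) Z ⟨c, hcZ⟩ hl
      exact ⟨z, hz, fun w hw => mul_nonneg_of_nonpos_of_nonpos he.le (h w hw)⟩
  obtain ⟨z, hz, hzmin⟩ := hz
  have hz' := hz
  rw [hZ, Finset.mem_filter] at hz'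
  obtain ⟨hzS, z1, z2, z3⟩ := hz'
  have hpz : p ≠ z := by rintro rfl; simp at z1
  refine ⟨z, ?_, ?_⟩
  swap
  · have key : orient p q z * (e * orient p x0 c) =
        (e * orient p x0 z) * orient p q c + (e * orient c p z) * orient p q x0 := by
      simp only [orient]; ring
    have : 0 < orient p q z * (e * orient p x0 c) := by
      rw [key]
      have := mul_pos z1 hqc
      have := mul_nonneg z3 hq0.le
      linarith
    exact pos_of_mul_pos_left this hpos.le
  by_contra hnE
  obtain ⟨a0, b0, y, hab0, hypz, hyab0, ha0, hb0, hyS⟩ := max_cross hS hT hp hzS hpz hnE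
  obtain ⟨t, ht0, ht1, rfl⟩ := mem_seg.mp hypz
  have ht0' : 0 < t := lt_of_le_of_ne ht0 (by rintro rfl; simp at hyS; exact hyS hp)
  have ht1' : t < 1 := lt_of_le_of_ne ht1 (by rintro rfl; simp at hyS; exact hyS hzS)
  set y := lp p z t with hy
  have hab : ∃ a b, Ed T a b ∧ y ∈ segment ℝ a b ∧ e * orient p z a < 0 := by
    rcases he with he | he
    · exact ⟨b0, a0, hab0.symm, by rwa [segment_symm], mul_neg_of_pos_of_neg he hb0⟩
    · exact ⟨a0, b0, hab0, hyab0, mul_neg_of_neg_of_pos he ha0⟩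
  obtain ⟨a, b, hab, hyab, hza⟩ := hab
  have f1y : 0 < e * orient p x0 y := by
    rw [hy, orient_lp]; simp only [orient_self1, mul_zero, zero_add]
    have := mul_pos ht0' z1
    linarith
  have f2p : 0 < e * orient x0 c p := by rw [orient_rot]; exact hpos
  have f2y : 0 < e * orient x0 c y := by
    rw [hy, orient_lp]
    have h1 := mul_pos (sub_pos.mpr ht1') f2p
    have h2 := mul_nonneg ht0'.le z2
    linarith
  have g3y : e * orient z p y = 0 := by
    rw [hy, orient_lp]; simp
  have g3a : 0 < e * orient z p a := by rw [orient_swap']; linarith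
  have hout : e * orient p x0 a ≤ 0 ∨ e * orient x0 c a ≤ 0 := by
    by_contra hn
    push Not at hn
    have key : (e * orient p x0 z) * (e * orient c p a) = (e * orient p x0 a) * (e * orient c p z)
        + (e * orient p x0 c) * (e * orient z p a) := by
      simp only [orient]; ring
    have h3 : 0 ≤ e * orient c p a := by
      have : 0 ≤ (e * orient p x0 z) * (e * orient c p a) := by
        rw [key]
        have := mul_nonneg hn.1.le z3
        have := mul_pos hpos g3a
        linarith
      exact nonneg_of_mul_nonneg_right this z1
    have := hzmin a (by rw [hZ, Finset.mem_filter]; exact ⟨hab.left, hn.1, hn.2.le, h3⟩)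
    linarith
  have hx0cd := seg_orient hxcd
  have hne : s(a,b) ≠ s(c,d) := by
    intro h
    have hycd : y ∈ segment ℝ c d := by
      rw [Sym2.eq_iff] at h
      rcases h with ⟨rfl, rfl⟩ | ⟨rfl, rfl⟩
      · exact hyab
      · rwa [segment_symm]
    obtain ⟨u, _, _, hu⟩ := mem_seg.mp hycd
    rw [hu, orient_lp, orient_rot d x0 c, orient_rot c d x0, hx0cd] at f2y
    simp at f2y
  obtain ⟨τ, hτ0, hτ1, hall, i, hi, hi0⟩ := exit_num
    ![e * orient p x0 y, e * orient x0 c y, e * orient z p y]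
    ![e * orient p x0 a, e * orient x0 c a, e * orient z p a]
    (by intro i; fin_cases i; exacts [f1y.le, f2y.le, g3y.ge])
    (by intro i; fin_cases i; exacts [fun _ => f1y, fun _ => f2y, fun h => absurd g3a (not_lt.mpr h)])
    (by
      rcases hout with h | h
      · exact ⟨0, h⟩
      · exact ⟨1, h⟩)
  have r1 := hall 0
  have r2 := hall 1
  simp only [Fin.isValue, Matrix.cons_val_zero, Matrix.cons_val_one] at r1 r2
  have lin : ∀ u v : Pt, (1-τ)*(e * orient u v y) + τ * (e * orient u v a)
      = e * orient u v (lp y a τ) := by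
    intro u v; rw [orient_lp _ _ y a]; ring
  rw [lin] at r1 r2
  have r3 : 0 < e * orient z p (lp y a τ) := by
    rw [← lin, g3y]
    have := mul_pos hτ0 g3a
    linarith
  set y' := lp y a τ with hy'
  have hy'ab : y' ∈ segment ℝ a b :=
    (convex_segment a b).segment_subset hyab (left_mem_segment ℝ a b) (mem_seg.mpr ⟨τ, hτ0.le, hτ1, rfl⟩)
  have g3x0 : 0 < e * orient z p x0 := by rw [← orient_rot z p x0]; exact z1
  have hx0p : p ≠ x0 := by rintro rfl; exact hx0 hp
  have hx0c : x0 ≠ c := by rintro rfl; exact hx0 hcd.left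
  have e0 : e ≠ 0 := by rcases he with h | h; exacts [h.ne', h.ne]
  have C1 : e * orient p x0 y' = 0 → False := by
    intro h0
    obtain ⟨u, hu⟩ := on_line hx0p ((mul_eq_zero.mp h0).resolve_left e0)
    rw [hu, orient_lp] at r2 r3
    simp only [orient_self1, orient_self2, mul_zero, zero_add, add_zero] at r2 r3
    have hu0 : 0 < u := by
      by_contra hn
      push Not at hn
      nlinarith
    have hu1 : u ≤ 1 := by
      by_contra hn
      push Not at hn
      nlinarith
    rcases hmin a b y' hab (hu ▸ mem_seg.mpr ⟨u, hu0.le, hu1, rfl⟩) hy'ab with h | h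
    · rw [hu] at h
      exact lp_ne hu0.ne' hx0p h
    · rw [h] at hy'ab
      exact hx0 (hab.mem_of_ne hcd hne hy'ab hxcd)
  have C2 : e * orient x0 c y' = 0 → False := by
    intro h0
    obtain ⟨u, hu⟩ := on_line hx0c ((mul_eq_zero.mp h0).resolve_left e0)
    have r3' := r3
    rw [hu, orient_lp] at r1 r3
    simp only [orient_self1, orient_self2, mul_zero, zero_add, add_zero] at r1 r3
    have hc3 : e * orient z p c ≤ 0 := by
      have := hzmin c hcZ
      rw [orient_swap']; linarith
    have hu0 : 0 ≤ u := by
      by_contra hn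
      push Not at hn
      nlinarith
    have hu1 : u ≤ 1 := by
      by_contra hn
      push Not at hn
      nlinarith
    have hs : y' ∈ segment ℝ x0 c := hu ▸ mem_seg.mpr ⟨u, hu0, hu1, rfl⟩
    have hycd : y' ∈ segment ℝ c d :=
      (convex_segment c d).segment_subset hxcd (left_mem_segment ℝ c d) hs
    have hyne : y' ≠ x0 := by
      intro h
      rw [h] at hy'ab
      exact hx0 (hab.mem_of_ne hcd hne hy'ab hxcd)
    rcases (hab.nc hcd hne hy'ab hycd).2 with h | h
    · rw [h] at r3'; linarith
    · exact seg_back hxcd hs hyne hcd.ne h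
  fin_cases i
  · exact C1 (by rw [← lin]; exact hi0)
  · exact C2 (by rw [← lin]; exact hi0)
  · exact absurd g3a (not_lt.mpr hi)

lemma side_of_cross (hS : GenPos S) {p s a b y : Pt} (hp : p ∈ S) (hs : s ∈ S) (hps : p ≠ s)
    (hE : ¬ Ed T p s) (hab : Ed T a b) (hy : y ∈ segment ℝ p s) (hy' : y ∈ segment ℝ a b)
    (hyS : y ∉ S) : orient p s a ≠ 0 := by
  intro h0
  obtain ⟨u, hu0, hu1, rfl⟩ := mem_seg.mp hy'
  have := seg_orient hy
  rw [orient_lp, h0, mul_zero, zero_add] at this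
  have hun : u ≠ 0 := by rintro rfl; simp at hyS; exact hyS hab.left
  have hb := (mul_eq_zero.mp this).resolve_left hun
  have e1 := gp_eq hS hp hs hab.left hps h0
  have e2 := gp_eq hS hp hs hab.right hps hb
  have hn := hab.ne
  rcases e1 with rfl | rfl <;> rcases e2 with rfl | rfl
  · exact hn rfl
  · exact hE hab
  · exact hE hab.symm
  · exact hn rfl

/-- neighbor lemma -/
lemma nbr (hS : GenPos S) (hT : IsTriangulation T) {p q s : Pt} (hp : p ∈ S) (hs : s ∈ S)
    (h : 0 < orient p q s) : ∃ z, Ed T p z ∧ 0 < orient p q z := by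
  by_cases hE : Ed T p s
  · exact ⟨s, hE, h⟩
  have hps : p ≠ s := by rintro rfl; simp at h
  set cr : Pt × Pt → Pt := fun g => lp g.1 g.2 (orient p s g.1 / (orient p s g.1 - orient p s g.2))
    with hcr
  have crs : ∀ a b y, y ∈ segment ℝ p s → y ∈ segment ℝ a b → 0 < orient p s a → orient p s b < 0 →
      cr (a, b) = y := by
    intro a b y hy hy' ha hb
    obtain ⟨u, hu0, hu1, rfl⟩ := mem_seg.mp hy'
    have := seg_orient hy
    rw [orient_lp] at this
    simp only [hcr]
    congr 1
    rw [div_eq_iff (by linarith)]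
    linarith
  set K := (S ×ˢ S).filter fun g => Ed T g.1 g.2 ∧ 0 < orient p s g.1 ∧ orient p s g.2 < 0 ∧
    cr g ∈ segment ℝ p s ∧ cr g ∈ segment ℝ g.1 g.2 ∧ cr g ∉ S with hK
  obtain ⟨c0, d0, y0, hcd0, hy0, hy0', hc0, hd0, hyS0⟩ := max_cross hS hT hp hs hps hE
  have mk : ∀ a b y, Ed T a b → y ∈ segment ℝ p s → y ∈ segment ℝ a b → 0 < orient p s a →
      orient p s b < 0 → y ∉ S → (a, b) ∈ K := by
    intro a b y hab hy hy' ha hb hyS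
    rw [hK, Finset.mem_filter, crs a b y hy hy' ha hb]
    exact ⟨Finset.mem_product.mpr ⟨hab.left, hab.right⟩, hab, ha, hb, hy, hy', hyS⟩
  obtain ⟨⟨c, d⟩, hcdK, hmin⟩ := Finset.exists_min_image K (fun g => orient p q (cr g))
    ⟨_, mk c0 d0 y0 hcd0 hy0 hy0' hc0 hd0 hyS0⟩
  rw [hK, Finset.mem_filter] at hcdK
  obtain ⟨-, hcd, hc, hd, hxs, hxcd, hxS⟩ := hcdK
  simp only at hcd hc hd hxcd
  have hmin' := fun a b h => hmin (a, b) h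
  clear hmin
  set x0 := cr (c, d)
  obtain ⟨t, ht0, ht1, ht⟩ := mem_seg.mp hxs
  have ht0' : 0 < t := lt_of_le_of_ne ht0 (by rintro rfl; simp at ht; exact hxS (ht ▸ hp))
  have ht1' : t < 1 := lt_of_le_of_ne ht1 (by rintro rfl; simp at ht; exact hxS (ht ▸ hs))
  have hq0 : 0 < orient p q x0 := by
    rw [ht, orient_lp]; simp; positivity
  have hmm : ∀ a b y, Ed T a b → y ∈ segment ℝ p x0 → y ∈ segment ℝ a b → y = p ∨ y = x0 := by
    intro a b y hab hy hy'
    have hyps : y ∈ segment ℝ p s :=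
      (convex_segment p s).segment_subset (left_mem_segment ℝ p s) hxs hy
    obtain ⟨v, hv0, hv1, hv⟩ := mem_seg.mp hy
    have hyq : orient p q y = v * orient p q x0 := by rw [hv, orient_lp]; simp
    by_cases hyS : y ∈ S
    · rcases gp_seg hS hp hs hyS hps hyps with h' | h'
      · exact Or.inl h'
      · exfalso
        rw [h', ht, orient_lp] at hyq
        simp at hyq
        have a1 : v * (t * orient p q s) ≤ 1 * (t * orient p q s) :=
          mul_le_mul_of_nonneg_right hv1 (by positivity)
        nlinarith
    · right
      have hge : orient p q x0 ≤ orient p q y := by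
        have ha := side_of_cross hS hp hs hps hE hab hyps hy' hyS
        have h0 := seg_orient hyps
        obtain ⟨u, hu0, hu1, hu⟩ := mem_seg.mp hy'
        have hu0' : 0 < u := lt_of_le_of_ne hu0 (by rintro rfl; simp at hu; exact hyS (hu ▸ hab.left))
        have hu1' : u < 1 := lt_of_le_of_ne hu1 (by rintro rfl; simp at hu; exact hyS (hu ▸ hab.right))
        rw [hu, orient_lp] at h0
        rcases lt_or_gt_of_ne ha with ha | ha
        · have hb : 0 < orient p s b := by by_contra hb; push Not at hb; nlinarith
          rw [segment_symm] at hy'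
          have := hmin' b a (mk b a y hab.symm hyps hy' hb ha hyS)
          rwa [crs b a y hyps hy' hb ha] at this
        · have hb : orient p s b < 0 := by by_contra hb; push Not at hb; nlinarith
          have := hmin' a b (mk a b y hab hyps hy' ha hb hyS)
          rwa [crs a b y hyps hy' ha hb] at this
      have : v = 1 := by
        rw [hyq] at hge
        have : 1 ≤ v := by by_contra hn; push Not at hn; nlinarith
        linarith
      rw [hv, this, lp_one]
  have hpx : ∀ w, orient p x0 w = t * orient p s w := by
    intro w; rw [ht, orient_lp1]
  have hor : orient p q x0 ≤ orient p q c ∨ orient p q x0 ≤ orient p q d := by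
    obtain ⟨u, hu0, hu1, hu⟩ := mem_seg.mp hxcd
    rw [hu, orient_lp]
    rcases le_total (orient p q c) (orient p q d) with h | h
    · right; nlinarith
    · left; nlinarith
  rcases hor with h' | h'
  · exact nbr_aux hS hT (e := 1) (Or.inl one_pos) hp hxS hcd hxcd
      (by rw [hpx]; positivity) hq0 (by linarith) hmm
  · exact nbr_aux hS hT (e := -1) (Or.inr (by norm_num)) hp hxS hcd.symm (by rwa [segment_symm])
      (by rw [hpx]; nlinarith) hq0 (by linarith) hmm

/-- left triangle -/
lemma left_tri (hS : GenPos S) (hT : IsTriangulation T) {p q s : Pt} (hpq : Ed T p q) (hs : s ∈ S)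
    (h : 0 < orient p q s) : ∃ r, IsTr T p q r := by
  obtain ⟨z, hz, hz0⟩ := nbr hS hT hpq.left hs h
  obtain ⟨r, hr, hmin⟩ := min_angle p q (S.filter fun w => Ed T p w ∧ 0 < orient p q w)
    ⟨z, by simp [hz.right, hz, hz0]⟩ (by intro c hc; simp at hc; exact hc.2.2)
  simp only [Finset.mem_filter] at hr hmin
  refine ⟨r, IsTr.of_wedge hS hT hpq hr.2.1 hr.2.2 ?_⟩
  rintro c hc ⟨h1, h2⟩
  have := hmin c ⟨hc.right, hc, h1⟩
  rw [orient_swap] at this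
  linarith

lemma IsTr.unique (hS : GenPos S) {p q r r' : Pt} (h : IsTr T p q r) (h' : IsTr T p q r') :
    r = r' := by
  by_contra hne
  have h1 := h.wedge h'.e3.symm h'.pos
  have h2 := h'.wedge h.e3.symm h.pos
  have : orient p r r' = 0 := by
    have := orient_swap p r r'
    rcases lt_trichotomy (orient p r r') 0 with h | h | h
    · exact (h1 (by linarith)).elim
    · exact h
    · exact (h2 h).elim
  rcases gp_eq hS h.e1.left h.e2.right h'.e2.right h.e3.ne.symm this with e | e
  · exact h'.e3.ne e
  · exact hne e.symm

end Geo

namespace Geo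
variable {S : Finset Pt} {T : PlaneGraph S}

/-- directed hull edge: everything is to the right -/
def HE (S : Finset Pt) (p a : Pt) : Prop :=
  p ∈ S ∧ a ∈ S ∧ p ≠ a ∧ ∀ s ∈ S, orient p a s ≤ 0

lemma HE.unique (hS : GenPos S) {p a b : Pt} (ha : HE S p a) (hb : HE S p b) : a = b := by
  have h1 := ha.2.2.2 b hb.2.1
  have h2 := hb.2.2.2 a ha.2.1
  rw [orient_swap] at h2
  rcases gp_eq hS ha.1 ha.2.1 hb.2.1 ha.2.2.1 (by linarith) with h | h
  · exact absurd h.symm hb.2.2.1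
  · exact h.symm

lemma HE.ed (hS : GenPos S) (hT : IsTriangulation T) {p a : Pt} (ha : HE S p a) : Ed T p a := by
  by_contra h
  obtain ⟨c, d, x, hcd, _, _, hc, _⟩ := max_cross hS hT ha.1 ha.2.1 ha.2.2.1 h
  have := ha.2.2.2 c hcd.left
  linarith

/-- linear functional -/
def XX (w s : Pt) : ℝ := w.1 * s.2 - w.2 * s.1

lemma orient_XX (w a s : Pt) : orient a (a + w) s = XX w s - XX w a := by
  simp only [orient, XX, Prod.fst_add, Prod.snd_add]; ring

lemma XX_neg (w s : Pt) : XX (-w) s = - XX w s := by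
  simp only [XX, Prod.fst_neg, Prod.snd_neg]; ring

lemma exists_generic (S : Finset Pt) : ∃ w : Pt, ∀ s ∈ S, ∀ t ∈ S, XX w s = XX w t → s = t := by
  obtain ⟨ε, hε⟩ := Infinite.exists_notMem_finset
    ((S ×ˢ S).image fun g => (g.1.2 - g.2.2) / (g.1.1 - g.2.1))
  refine ⟨(1, ε), fun s hs t ht h => ?_⟩
  by_contra hne
  simp only [XX] at h
  by_cases h1 : s.1 - t.1 = 0
  · apply hne
    have h2 : s.1 = t.1 := by linarith
    ext
    · exact h2
    · rw [h2] at h; linarith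
  · apply hε
    rw [Finset.mem_image]
    refine ⟨(s, t), Finset.mem_product.mpr ⟨hs, ht⟩, ?_⟩
    rw [div_eq_iff h1]
    simp only
    linarith

lemma plucker (a b c v : Pt) (w : Pt) :
    (XX w b - XX w a) * orient a c v + (XX w c - XX w a) * orient a v b +
      (XX w v - XX w a) * orient a b c = 0 := by
  simp only [orient, XX]; ring

lemma top_nbr (hS : GenPos S) (hT : IsTriangulation T) {w a s : Pt}
    (hw : ∀ s ∈ S, ∀ t ∈ S, XX w s = XX w t → s = t) (ha : a ∈ S) (hs : s ∈ S)
    (has : XX w a < XX w s) :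
    ∃ b, (∀ b' v', IsTr T a b' v' → XX w v' < XX w a → XX w a < XX w b' → b' = b) ∧
      (∀ b', HE S a b' → XX w a < XX w b' → b' = b) ∧ XX w a < XX w b ∧ Ed T a b ∧
      (HE S a b ∨ ∃ v, IsTr T a b v ∧ XX w v < XX w a) := by
  obtain ⟨z, hz, hz0⟩ := nbr hS hT (q := a + w) ha hs (by rw [orient_XX]; linarith)
  obtain ⟨b, hb, hmax⟩ := max_angle a (a + w) (S.filter fun c => Ed T a c ∧ 0 < orient a (a+w) c)
    ⟨z, by simp [hz.right, hz, hz0]⟩ (by intro c hc; exact (Finset.mem_filter.mp hc).2.2)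
  simp only [Finset.mem_filter, orient_XX, sub_pos] at hb hmax
  obtain ⟨hbS, hab, hXb⟩ := hb
  have eqb : ∀ b', Ed T a b' → XX w a < XX w b' → ¬ (0 < orient a b' b) → b' = b := by
    intro b' hb' hX hn
    have := hmax b' ⟨hb'.right, hb', hX⟩
    rw [orient_swap] at this
    rcases gp_eq hS ha hbS hb'.right hab.ne (by rw [orient_swap]; linarith) with h | h
    · exact absurd h.symm hb'.ne
    · exact h
  refine ⟨b, ?_, ?_, hXb, hab, ?_⟩
  · intro b' v' htr hv hb'
    refine eqb b' htr.e1 hb' (fun hpos => htr.wedge hab hpos ?_)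
    have := plucker a b' b v' w
    by_contra hn
    push Not at hn
    have h1 : (XX w b' - XX w a) * orient a b v' ≤ 0 :=
      mul_nonpos_of_nonneg_of_nonpos (by linarith) hn
    have h2 : (XX w b - XX w a) * orient a v' b' < 0 := by
      apply mul_neg_of_pos_of_neg (by linarith)
      rw [orient_swap]; linarith [htr.pos]
    have h3 : (XX w v' - XX w a) * orient a b' b < 0 :=
      mul_neg_of_neg_of_pos (by linarith) hpos
    linarith
  · intro b' hb' hX
    exact eqb b' (hb'.ed hS hT) hX (not_lt.mpr (hb'.2.2.2 b hbS))
  · by_cases h : ∀ s ∈ S, orient a b s ≤ 0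
    · exact Or.inl ⟨ha, hbS, hab.ne, h⟩
    · push Not at h
      obtain ⟨s', hs', hpos⟩ := h
      obtain ⟨v, hv⟩ := left_tri hS hT hab hs' hpos
      refine Or.inr ⟨v, hv, ?_⟩
      by_contra hn
      push Not at hn
      rcases hn.lt_or_eq with h' | h'
      · have := hmax v ⟨hv.e2.right, hv.e3.symm, h'⟩
        linarith [hv.pos]
      · exact hv.e3.ne (hw _ ha _ hv.e2.right h').symm

/-- ordered triangles -/
def TT (T : PlaneGraph S) : Finset (Pt × Pt × Pt) :=
  (S ×ˢ S ×ˢ S).filter fun g => IsTr T g.1 g.2.1 g.2.2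

lemma mem_TT {g : Pt × Pt × Pt} : g ∈ TT T ↔ IsTr T g.1 g.2.1 g.2.2 := by
  simp only [TT, Finset.mem_filter, Finset.mem_product, and_iff_right_iff_imp]
  intro h
  exact ⟨h.e1.left, h.e2.left, h.e3.left⟩

/-- directed hull edges -/
def HH (S : Finset Pt) : Finset (Pt × Pt) := (S ×ˢ S).filter fun g => HE S g.1 g.2

lemma mem_HH {g : Pt × Pt} : g ∈ HH S ↔ HE S g.1 g.2 := by
  simp only [HH, Finset.mem_filter, Finset.mem_product, and_iff_right_iff_imp]
  intro h
  exact ⟨h.1, h.2.1⟩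

lemma count_half (hS : GenPos S) (hT : IsTriangulation T) (hne : S.Nonempty) {w : Pt}
    (hw : ∀ s ∈ S, ∀ t ∈ S, XX w s = XX w t → s = t) :
    ((TT T).filter fun g => XX w g.2.2 < XX w g.1 ∧ XX w g.1 < XX w g.2.1).card +
      ((HH S).filter fun g => XX w g.1 < XX w g.2).card + 1 = S.card := by
  set Q1 := (TT T).filter fun g => XX w g.2.2 < XX w g.1 ∧ XX w g.1 < XX w g.2.1 with hQ1
  set Q2 := (HH S).filter fun g => XX w g.1 < XX w g.2 with hQ2
  obtain ⟨m, hm, hmax⟩ := Finset.exists_max_image S (XX w) hne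
  have i1 : Set.InjOn (fun g : Pt × Pt × Pt => g.1) (Q1 : Set (Pt × Pt × Pt)) := by
    rintro ⟨a, b, v⟩ h ⟨a', b', v'⟩ h' heq
    simp only [hQ1, Finset.coe_filter, Set.mem_ofPred_eq, mem_TT] at h h' heq
    subst heq
    obtain ⟨c, hc, -⟩ := top_nbr hS hT hw h.1.e1.left h.1.e1.right h.2.2
    have e1 := hc b v h.1 h.2.1 h.2.2
    have e2 := hc b' v' h'.1 h'.2.1 h'.2.2
    subst e1; subst e2
    rw [h.1.unique hS h'.1]
  have i2 : Set.InjOn (fun g : Pt × Pt => g.1) (Q2 : Set (Pt × Pt)) := by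
    rintro ⟨a, b⟩ h ⟨a', b'⟩ h' heq
    simp only [hQ2, Finset.coe_filter, Set.mem_ofPred_eq, mem_HH] at h h' heq
    subst heq
    rw [h.1.unique hS h'.1]
  rw [← Finset.card_image_of_injOn i1, ← Finset.card_image_of_injOn i2]
  rw [← Finset.card_union_of_disjoint]
  · rw [← Finset.card_erase_add_one hm]
    congr 2
    ext a
    simp only [Finset.mem_union, Finset.mem_image, Finset.mem_erase, hQ1, hQ2, Finset.mem_filter,
      mem_TT, mem_HH]
    constructor
    · rintro (⟨⟨a', b, v⟩, h, rfl⟩ | ⟨⟨a', b⟩, h, rfl⟩)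
      · refine ⟨?_, h.1.e1.left⟩
        rintro rfl
        have := hmax b h.1.e1.right
        simp only at h
        linarith [h.2.2]
      · refine ⟨?_, h.1.1⟩
        rintro rfl
        have := hmax b h.1.2.1
        simp only at h
        linarith [h.2]
    · rintro ⟨ham, ha⟩
      have hlt : XX w a < XX w m := lt_of_le_of_ne (hmax a ha) (fun h => ham (hw _ ha _ hm h))
      obtain ⟨b, -, -, hXb, hab, h | ⟨v, hv, hXv⟩⟩ := top_nbr hS hT hw ha hm hlt
      · exact Or.inr ⟨(a, b), ⟨h, hXb⟩, rfl⟩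
      · exact Or.inl ⟨(a, b, v), ⟨hv, hXv, hXb⟩, rfl⟩
  · rw [Finset.disjoint_left]
    intro a h1 h2
    simp only [Finset.mem_image, hQ1, hQ2, Finset.mem_filter, mem_TT, mem_HH] at h1 h2
    obtain ⟨⟨a1, b, v⟩, h1, rfl⟩ := h1
    obtain ⟨⟨a2, b'⟩, h2, heq⟩ := h2
    simp only at heq h1 h2
    subst heq
    obtain ⟨c, hc, hc', -⟩ := top_nbr hS hT hw h1.1.e1.left h1.1.e1.right h1.2.2
    have e1 := hc b v h1.1 h1.2.1 h1.2.2
    have e2 := hc' b' h2.1 h2.2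
    subst e1; subst e2
    have := h2.1.2.2.2 v h1.1.e2.right
    linarith [h1.1.pos]

/-- directed edges -/
def DE (T : PlaneGraph S) : Finset (Pt × Pt) := (S ×ˢ S).filter fun g => Ed T g.1 g.2

lemma mem_DE {g : Pt × Pt} : g ∈ DE T ↔ Ed T g.1 g.2 := by
  simp only [DE, Finset.mem_filter, Finset.mem_product, and_iff_right_iff_imp]
  intro h
  exact ⟨h.left, h.right⟩

lemma card_DE : (DE T).card = 2 * T.edges.card := by
  rw [Finset.card_eq_sum_card_fiberwise (f := fun g : Pt × Pt => s(g.1, g.2)) (t := T.edges)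
    (by intro g hg; exact mem_DE.mp hg)]
  rw [Finset.sum_const_nat (m := 2), mul_comm]
  intro e he
  induction e using Sym2.ind with | _ p q =>
  have hE : Ed T p q := he
  have : (DE T).filter (fun g => s(g.1, g.2) = s(p, q)) = {(p, q), (q, p)} := by
    ext ⟨a, b⟩
    simp only [Finset.mem_filter, mem_DE, Finset.mem_insert, Finset.mem_singleton, Prod.mk.injEq,
      Sym2.eq_iff]
    constructor
    · exact fun h => h.2
    · rintro (⟨rfl, rfl⟩ | ⟨rfl, rfl⟩)
      · exact ⟨hE, Or.inl ⟨rfl, rfl⟩⟩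
      · exact ⟨hE.symm, Or.inr ⟨rfl, rfl⟩⟩
  rw [this, Finset.card_pair]
  simp only [ne_eq, Prod.mk.injEq, not_and]
  intro h; exact absurd h hE.ne

lemma card_DE' (hS : GenPos S) (hT : IsTriangulation T) :
    (DE T).card = (TT T).card + (HH S).card := by
  have i1 : Set.InjOn (fun g : Pt × Pt × Pt => (g.1, g.2.1)) (TT T : Set (Pt × Pt × Pt)) := by
    rintro ⟨a, b, v⟩ h ⟨a', b', v'⟩ h' heq
    simp only [Finset.mem_coe, mem_TT, Prod.mk.injEq] at h h' heq
    obtain ⟨rfl, rfl⟩ := heq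
    rw [h.unique hS h']
  rw [← Finset.card_image_of_injOn i1, ← Finset.card_union_of_disjoint]
  · congr 1
    ext ⟨p, q⟩
    simp only [mem_DE, Finset.mem_union, Finset.mem_image, mem_TT, mem_HH]
    constructor
    · intro h
      by_cases h' : ∀ s ∈ S, orient p q s ≤ 0
      · exact Or.inr ⟨h.left, h.right, h.ne, h'⟩
      · push Not at h'
        obtain ⟨s', hs', hpos⟩ := h'
        obtain ⟨v, hv⟩ := left_tri hS hT h hs' hpos
        exact Or.inl ⟨(p, q, v), hv, rfl⟩
    · rintro (⟨⟨a, b, v⟩, h, heq⟩ | h)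
      · simp only [Prod.mk.injEq] at heq h
        rw [← heq.1, ← heq.2]
        exact h.e1
      · exact h.ed hS hT
  · rw [Finset.disjoint_left]
    rintro ⟨p, q⟩ h1 h2
    simp only [Finset.mem_image, mem_TT, mem_HH, Prod.mk.injEq] at h1 h2
    obtain ⟨⟨a, b, v⟩, h1, rfl, rfl⟩ := h1
    have := h2.2.2.2 v h1.e2.right
    linarith [h1.pos]

lemma card_TT {w : Pt}
    (hw : ∀ s ∈ S, ∀ t ∈ S, XX w s = XX w t → s = t) :
    (TT T).card = 3 * (((TT T).filter fun g => XX w g.2.2 < XX w g.1 ∧ XX w g.1 < XX w g.2.1).card +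
      ((TT T).filter fun g => XX w g.2.1 < XX w g.1 ∧ XX w g.1 < XX w g.2.2).card) := by
  set M : Pt × Pt × Pt → Prop := fun g => (XX w g.2.2 < XX w g.1 ∧ XX w g.1 < XX w g.2.1) ∨
    (XX w g.2.1 < XX w g.1 ∧ XX w g.1 < XX w g.2.2) with hM
  set ρ : Pt × Pt × Pt → Pt × Pt × Pt := fun g => (g.2.1, g.2.2, g.1) with hρ
  have hρ3 : ∀ g, ρ (ρ (ρ g)) = g := fun g => rfl
  have hρT : ∀ g, ρ g ∈ TT T ↔ g ∈ TT T := by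
    intro g
    simp only [mem_TT, hρ]
    exact ⟨fun h => h.rot.rot, fun h => h.rot⟩
  have hρi : Function.Injective ρ := by
    intro g g' h
    have := congrArg (fun x => ρ (ρ x)) h
    simpa [hρ3] using this
  have e1 : ((TT T).filter fun g => M (ρ g)).card = ((TT T).filter M).card := by
    rw [← Finset.card_image_of_injective _ hρi]
    congr 1
    ext g
    simp only [Finset.mem_image, Finset.mem_filter]
    constructor
    · rintro ⟨g', ⟨h1, h2⟩, rfl⟩
      exact ⟨(hρT _).mpr h1, h2⟩
    · rintro ⟨h1, h2⟩
      exact ⟨ρ (ρ g), ⟨(hρT _).mpr ((hρT _).mpr h1), h2⟩, rfl⟩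
  have e2 : ((TT T).filter fun g => M (ρ (ρ g))).card = ((TT T).filter M).card := by
    rw [← Finset.card_image_of_injective _ (hρi.comp hρi)]
    congr 1
    ext g
    simp only [Finset.mem_image, Finset.mem_filter]
    constructor
    · rintro ⟨g', ⟨h1, h2⟩, rfl⟩
      exact ⟨(hρT _).mpr ((hρT _).mpr h1), h2⟩
    · rintro ⟨h1, h2⟩
      exact ⟨ρ g, ⟨(hρT _).mpr h1, h2⟩, rfl⟩
  have e3 : ((TT T).filter M).card =
      ((TT T).filter fun g => XX w g.2.2 < XX w g.1 ∧ XX w g.1 < XX w g.2.1).card +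
      ((TT T).filter fun g => XX w g.2.1 < XX w g.1 ∧ XX w g.1 < XX w g.2.2).card := by
    rw [← Finset.card_union_of_disjoint, ← Finset.filter_or]
    rw [Finset.disjoint_left]
    intro g h1 h2
    simp only [Finset.mem_filter] at h1 h2
    linarith [h1.2.1, h2.2.2]
  rw [← e3]
  have e4 : (TT T) = ((TT T).filter M ∪ (TT T).filter fun g => M (ρ g)) ∪
      (TT T).filter fun g => M (ρ (ρ g)) := by
    rw [← Finset.filter_or, ← Finset.filter_or]
    symm
    rw [Finset.filter_true_of_mem]
    rintro ⟨a, b, c⟩ h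
    rw [mem_TT] at h
    simp only at h
    have n1 : XX w a ≠ XX w b := fun h' => h.e1.ne (hw _ h.e1.left _ h.e1.right h')
    have n2 : XX w b ≠ XX w c := fun h' => h.e2.ne (hw _ h.e2.left _ h.e2.right h')
    have n3 : XX w c ≠ XX w a := fun h' => h.e3.ne (hw _ h.e3.left _ h.e3.right h')
    simp only [hM, hρ]
    rcases lt_or_gt_of_ne n1 with h1 | h1 <;> rcases lt_or_gt_of_ne n2 with h2 | h2 <;>
      rcases lt_or_gt_of_ne n3 with h3 | h3 <;> simp only [h1, h2, h3, and_self, true_or, or_true] 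
  conv_lhs => rw [e4]
  rw [Finset.card_union_of_disjoint, Finset.card_union_of_disjoint, e1, e2]
  · ring
  · rw [Finset.disjoint_left]
    intro g h1 h2
    simp only [Finset.mem_filter, hM, hρ] at h1 h2
    rcases h1.2 with h | h <;> rcases h2.2 with h' | h' <;> linarith [h.1, h.2, h'.1, h'.2]
  · rw [Finset.disjoint_left]
    intro g h1 h2
    simp only [Finset.mem_filter, Finset.mem_union, hM, hρ] at h1 h2
    rcases h1 with h1 | h1 <;> rcases h1.2 with h | h <;> rcases h2.2 with h' | h' <;>
      linarith [h.1, h.2, h'.1, h'.2]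

/-- Euler count -/
lemma card_edges (hS : GenPos S) (hT : IsTriangulation T) (hne : S.Nonempty) :
    T.edges.card + (HH S).card + 3 = 3 * S.card := by
  obtain ⟨w, hw⟩ := exists_generic S
  have hw' : ∀ s ∈ S, ∀ t ∈ S, XX (-w) s = XX (-w) t → s = t := by
    intro s hs t ht h
    rw [XX_neg, XX_neg, neg_inj] at h
    exact hw s hs t ht h
  have a1 := count_half hS hT hne hw
  have a2 := count_half hS hT hne hw'
  simp only [XX_neg, neg_lt_neg_iff] at a2
  have a3 := card_TT (T := T) hw
  have a4 := card_DE' hS hT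
  have a5 := card_DE (T := T)
  have a6 : (HH S).card = ((HH S).filter fun g => XX w g.1 < XX w g.2).card +
      ((HH S).filter fun g => XX w g.2 < XX w g.1).card := by
    rw [← Finset.card_union_of_disjoint, ← Finset.filter_or, Finset.filter_true_of_mem]
    · intro g hg
      rw [mem_HH] at hg
      exact lt_or_gt_of_ne fun h => hg.2.2.1 (hw _ hg.1 _ hg.2.1 h)
    · rw [Finset.disjoint_left]
      intro g h1 h2
      simp only [Finset.mem_filter] at h1 h2
      linarith [h1.2, h2.2]
  have a7 : ((TT T).filter fun g => XX w g.1 < XX w g.2.2 ∧ XX w g.2.1 < XX w g.1).card =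
    ((TT T).filter fun g => XX w g.2.1 < XX w g.1 ∧ XX w g.1 < XX w g.2.2).card := by
    congr 1
    ext g
    simp only [Finset.mem_filter]
    tauto
  omega

end Geo

namespace Geo
variable {S : Finset Pt} {T : PlaneGraph S}

lemma pg_ext {G H : PlaneGraph S} (h : G.edges = H.edges) : G = H := by
  cases G; cases H; simp at h; subst h; rfl

instance pgFinite : Finite (PlaneGraph S) := by
  apply Finite.of_injective (β := {E : Finset (Sym2 Pt) // E ∈ S.sym2.powerset})
    (fun G => ⟨G.edges, by
      rw [Finset.mem_powerset]
      intro e he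
      rw [Finset.mem_sym2_iff]
      exact fun p hp => G.endpoint_mem e he p hp⟩)
  intro G H h
  exact pg_ext (by simpa using h)

lemma extend (G : PlaneGraph S) : ∃ T : PlaneGraph S, IsTriangulation T ∧ G.edges ⊆ T.edges := by
  have : Nonempty {H : PlaneGraph S // G.edges ⊆ H.edges} := ⟨⟨G, subset_rfl⟩⟩
  obtain ⟨⟨T, hT⟩, hmax⟩ := Finite.exists_max
    (fun H : {H : PlaneGraph S // G.edges ⊆ H.edges} => H.1.edges.card)
  refine ⟨T, fun H hH => ?_, hT⟩
  have := hmax ⟨H, hT.trans hH⟩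
  exact (Finset.eq_of_subset_of_card_le hH this).symm

/-- convexity of an edge set -/
def Cvx (S : Finset Pt) (D : Finset (Sym2 Pt)) : Prop :=
  (∀ p a, HE S p a → s(p, a) ∈ D) ∧
  (∀ p ∈ S, (¬ ∃ a, HE S p a) → ∀ r ∈ S, r ≠ p → ∃ d, s(p, d) ∈ D ∧ orient p r d < 0)

lemma Cvx.mono {D D' : Finset (Sym2 Pt)} (h : Cvx S D) (hs : D ⊆ D') : Cvx S D' :=
  ⟨fun p a hh => hs (h.1 p a hh), fun p hp hi r hr hne => by
    obtain ⟨d, hd, ho⟩ := h.2 p hp hi r hr hne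
    exact ⟨d, hs hd, ho⟩⟩

lemma pl4 (p a b c d : Pt) : orient p a b * orient p c d + orient p a c * orient p d b +
    orient p a d * orient p b c = 0 := by
  simp only [orient]; ring

lemma corner (hS : GenPos S) {D : Finset (Sym2 Pt)} (hD : Cvx S D)
    (hDT : D ⊆ T.edges) {p q r s : Pt} (h1 : IsTr T p q r) (h2 : IsTr T q p s)
    (hn : s(p, q) ∉ D) : 0 < orient p s r := by
  have hp := h1.e1.left
  have psq : 0 < orient p s q := by rw [orient_rot]; exact h2.pos
  have pqr := h1.pos
  have hps := h2.e2
  have hpr := h1.e3.symm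
  by_cases hI : ∃ a, HE S p a
  · obtain ⟨a, ha⟩ := hI
    have hqa : q ≠ a := by rintro rfl; exact hn (hD.1 _ _ ha)
    have aq : orient p a q < 0 := lt_of_le_of_ne (ha.2.2.2 q h1.e1.right) (by
      intro h0
      rcases gp_eq hS ha.1 ha.2.1 h1.e1.right ha.2.2.1 h0 with h | h
      · exact h1.e1.ne h.symm
      · exact hqa h)
    have as := ha.2.2.2 s hps.right
    have ar := ha.2.2.2 r hpr.right
    have key := pl4 p a s q r
    have k1 : orient p a s * orient p q r ≤ 0 := mul_nonpos_of_nonpos_of_nonneg as pqr.le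
    have k2 : orient p a r * orient p s q ≤ 0 := mul_nonpos_of_nonpos_of_nonneg ar psq.le
    have k3 : orient p a q * orient p r s = -(orient p a q * orient p s r) := by
      rw [orient_swap p s r]; ring
    by_contra hneg
    push Not at hneg
    have k4 : 0 ≤ orient p a q * orient p s r := mul_nonneg_of_nonpos_of_nonpos aq.le hneg
    have k5 : orient p a s = 0 := by
      have : orient p a s * orient p q r = 0 := by linarith
      exact (mul_eq_zero.mp this).resolve_right pqr.ne'
    have k6 : orient p a r = 0 := by
      have : orient p a r * orient p s q = 0 := by linarith
      exact (mul_eq_zero.mp this).resolve_right psq.ne'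
    have e1 := (gp_eq hS ha.1 ha.2.1 hps.right ha.2.2.1 k5).resolve_left hps.ne.symm
    have e2 := (gp_eq hS ha.1 ha.2.1 hpr.right ha.2.2.1 k6).resolve_left hpr.ne.symm
    rw [e1] at psq; rw [e2, orient_swap] at pqr
    linarith
  · by_contra hneg
    push Not at hneg
    obtain ⟨d, hd, hrd⟩ := hD.2 p hp hI r hpr.right hpr.ne.symm
    have hpd : Ed T p d := hDT hd
    have hdr : 0 < orient p d r := by rw [orient_swap]; linarith
    rcases lt_trichotomy (orient p q d) 0 with hq | hq | hq
    · have hsd : ¬ 0 < orient p s d := fun h =>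
        h2.rot.wedge hpd h (by rw [orient_swap]; linarith)
      have key := pl4 p d s q r
      push Not at hsd
      have k1 : 0 ≤ orient p d s * orient p q r :=
        mul_nonneg (by rw [orient_swap]; linarith) pqr.le
      have k2 : 0 ≤ orient p d q * orient p r s :=
        mul_nonneg (by rw [orient_swap]; linarith) (by rw [orient_swap]; linarith)
      have k3 : 0 < orient p d r * orient p s q := mul_pos hdr psq
      linarith
    · rcases gp_eq hS hp h1.e1.right hpd.right h1.e1.ne hq with h | h
      · exact hpd.ne h.symm
      · rw [h] at hd; exact hn hd
    · exact h1.wedge hpd hq hdr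

lemma quad_cross {p q r s : Pt} (h1 : 0 < orient p q r) (h2 : 0 < orient q p s)
    (h3 : 0 < orient p s r) (h4 : 0 < orient q r s) :
    ∃ x, x ∈ segment ℝ p q ∧ x ∈ segment ℝ r s := by
  have h2' : orient p q s < 0 := by rw [orient_swap']; linarith
  have hd : 0 < orient p q r - orient p q s := by linarith
  set t := orient p q r / (orient p q r - orient p q s) with ht
  have ht0 : 0 < t := div_pos h1 hd
  have ht1 : t < 1 := by rw [ht, div_lt_one hd]; linarith
  refine ⟨lp r s t, on_seg h1 ?_ ?_ ?_, mem_seg.mpr ⟨t, ht0.le, ht1.le, rfl⟩⟩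
  · rw [orient_lp, ht]
    field_simp
    ring
  · rw [orient_lp]; simp; positivity
  · rw [orient_lp, ← orient_rot r p s]; simp; positivity

lemma flip (hS : GenPos S) {D : Finset (Sym2 Pt)} (hD : Cvx S D)
    (hT : IsTriangulation T) (hDT : D ⊆ T.edges) {e : Sym2 Pt} (he : e ∈ T.edges) (heD : e ∉ D) :
    ∃ f : Sym2 Pt, ∃ G : PlaneGraph S, D ⊆ G.edges ∧ f ∈ G.edges ∧
      ∀ H : PlaneGraph S, ¬ (e ∈ H.edges ∧ f ∈ H.edges) := by
  induction e using Sym2.ind with | _ p q =>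
  have hpq : Ed T p q := he
  have ex : ∀ p q, Ed T p q → s(p,q) ∉ D → ∃ r, IsTr T p q r := by
    intro p q hpq heD
    by_cases h : ∀ s ∈ S, orient p q s ≤ 0
    · exact absurd (hD.1 p q ⟨hpq.left, hpq.right, hpq.ne, h⟩) heD
    · push Not at h
      obtain ⟨s, hs, hpos⟩ := h
      exact left_tri hS hT hpq hs hpos
  obtain ⟨r, hr⟩ := ex p q hpq heD
  have heD' : s(q, p) ∉ D := by rwa [Sym2.eq_swap]
  obtain ⟨s, hs⟩ := ex q p hpq.symm heD'
  have c1 := corner hS hD hDT hr hs heD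
  have c2 := corner hS hD hDT hs hr heD'
  have hrS := hr.e2.right
  have hsS := hs.e2.right
  have hrs : r ≠ s := by rintro rfl; simp at c1
  have hpr := hr.e3.ne
  have hps := hs.e2.ne
  have hqr := hr.e2.ne
  have hqs := hs.e3.ne
  have noco : ∀ H : PlaneGraph S, ¬ (s(p,q) ∈ H.edges ∧ s(r,s) ∈ H.edges) := by
    rintro H ⟨h1, h2⟩
    obtain ⟨x, hx1, hx2⟩ := quad_cross hr.pos hs.pos c1 c2
    have := Ed.nc (T := H) h1 h2 (by
      intro h
      rw [Sym2.eq_iff] at h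
      rcases h with ⟨h, -⟩ | ⟨h, -⟩
      · exact hpr h.symm
      · exact hps h) hx1 hx2
    rcases this with ⟨rfl | rfl, rfl | rfl⟩
    · exact hpr rfl
    · exact hps rfl
    · exact hqr rfl
    · exact hqs rfl
  let T0 : PlaneGraph S := ⟨T.edges.erase s(p,q), fun e he => T.endpoint_mem e (Finset.mem_of_mem_erase he),
    fun e he => T.not_isDiag e (Finset.mem_of_mem_erase he),
    fun e₁ h₁ e₂ h₂ => T.noncrossing e₁ (Finset.mem_of_mem_erase h₁) e₂ (Finset.mem_of_mem_erase h₂)⟩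
  obtain ⟨G, hG⟩ := insert_plane T0 hrS hsS hrs (by
    intro c d x hcd0 hx hx' hne
    have hcd : Ed T c d := Finset.mem_of_mem_erase hcd0
    have hcdne : s(c,d) ≠ s(p,q) := Finset.ne_of_mem_erase hcd0
    by_cases hxS : x ∈ S
    · exact ⟨gp_seg hS hrS hsS hxS hrs hx, gp_seg hS hcd.left hcd.right hxS hcd.ne hx'⟩
    · exfalso
      obtain ⟨t, ht0, ht1, rfl⟩ := mem_seg.mp hx
      have ht0' : 0 < t := lt_of_le_of_ne ht0 (by rintro rfl; simp at hxS; exact hxS hrS)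
      have ht1' : 0 < 1 - t := by
        have : t ≠ 1 := by rintro rfl; simp at hxS; exact hxS hsS
        have := lt_of_le_of_ne ht1 this
        linarith
      have r1 : 0 < orient q r (lp r s t) := by rw [orient_lp]; simp; positivity
      have r2 : 0 < orient r p (lp r s t) := by
        rw [orient_lp, ← orient_rot r p s]; simp; positivity
      have s1 : 0 < orient p s (lp r s t) := by rw [orient_lp]; simp; positivity
      have s2 : 0 < orient s q (lp r s t) := by
        rw [orient_lp, ← orient_rot s q r]; simp; positivity
      rcases lt_trichotomy (orient p q (lp r s t)) 0 with h | h | h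
      · exact hs.cross hcd hx' (by rw [orient_swap']; linarith) s1 s2
      · exact hxS (hcd.mem_of_ne hpq hcdne hx' (on_seg hr.pos h r1.le r2.le))
      · exact hr.cross hcd hx' h r1 r2)
  refine ⟨s(r,s), G, ?_, ?_, noco⟩
  · rw [hG]
    intro e he
    refine Finset.mem_insert_of_mem (Finset.mem_erase.mpr ⟨?_, hDT he⟩)
    rintro rfl
    exact heD he
  · rw [hG]; exact Finset.mem_insert_self _ _

lemma card_eq_of_tri (hS : GenPos S) (hne : S.Nonempty) {T T' : PlaneGraph S}
    (h : IsTriangulation T) (h' : IsTriangulation T') : T.edges.card = T'.edges.card := by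
  have := card_edges hS h hne
  have := card_edges hS h' hne
  omega

lemma supp_aux (hS : GenPos S) (hne : S.Nonempty) (k : ℕ) : ∀ (D : Finset (Sym2 Pt)) (T : PlaneGraph S),
    Cvx S D → IsTriangulation T → D ⊆ T.edges → D.card + k ≤ T.edges.card →
    2 ^ k ≤ Nat.card {T' : PlaneGraph S // IsTriangulation T' ∧ D ⊆ T'.edges} := by
  induction k with
  | zero =>
    intro D T hD hT hDT _
    have : Nonempty {T' : PlaneGraph S // IsTriangulation T' ∧ D ⊆ T'.edges} := ⟨⟨T, hT, hDT⟩⟩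
    rw [pow_zero]
    exact Nat.card_pos
  | succ k ih =>
    intro D T hD hT hDT hk
    obtain ⟨e, he, heD⟩ : ∃ e ∈ T.edges, e ∉ D := by
      by_contra hcon
      push Not at hcon
      have := Finset.card_le_card (show T.edges ⊆ D from hcon)
      omega
    obtain ⟨f, G, hDG, hfG, hno⟩ := flip hS hD hT hDT he heD
    obtain ⟨T2, hT2, hGT2⟩ := extend G
    have hc := card_eq_of_tri hS hne hT hT2
    have hfD : f ∉ D := fun h => hno T ⟨he, hDT h⟩
    have b1 := ih (insert e D) T (hD.mono (Finset.subset_insert _ _)) hT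
      (Finset.insert_subset he hDT) (by rw [Finset.card_insert_of_notMem heD]; omega)
    have b2 := ih (insert f D) T2 (hD.mono (Finset.subset_insert _ _)) hT2
      (Finset.insert_subset (hGT2 hfG) (hDG.trans hGT2))
      (by rw [Finset.card_insert_of_notMem hfD]; omega)
    set A := {T' : PlaneGraph S // IsTriangulation T' ∧ insert e D ⊆ T'.edges}
    set B := {T' : PlaneGraph S // IsTriangulation T' ∧ insert f D ⊆ T'.edges}
    have : Nat.card (A ⊕ B) ≤ Nat.card {T' : PlaneGraph S // IsTriangulation T' ∧ D ⊆ T'.edges} := by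
      apply Nat.card_le_card_of_injective (Sum.elim
        (fun a : A => ⟨a.1, a.2.1, (Finset.subset_insert _ _).trans a.2.2⟩)
        (fun b : B => ⟨b.1, b.2.1, (Finset.subset_insert _ _).trans b.2.2⟩))
      have dis : ∀ (a : A) (b : B), a.1 ≠ b.1 := by
        rintro ⟨a, ha⟩ ⟨b, hb⟩ (rfl : a = b)
        exact hno a ⟨ha.2 (Finset.mem_insert_self _ _), hb.2 (Finset.mem_insert_self _ _)⟩
      rintro (a | a) (b | b) h
      · simp only [Sum.elim_inl, Subtype.mk.injEq] at h
        rw [Subtype.ext h]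
      · simp only [Sum.elim_inl, Sum.elim_inr, Subtype.mk.injEq] at h
        exact absurd h (dis a b)
      · simp only [Sum.elim_inl, Sum.elim_inr, Subtype.mk.injEq] at h
        exact absurd h.symm (dis b a)
      · simp only [Sum.elim_inr, Subtype.mk.injEq] at h
        rw [Subtype.ext h]
    rw [Nat.card_sum] at this
    rw [pow_succ]
    omega

lemma supp_bound (hS : GenPos S) (hne : S.Nonempty) (C : PlaneGraph S) {T : PlaneGraph S}
    (hT : IsTriangulation T) (hCT : C.edges ⊆ T.edges) {F : Finset (Sym2 Pt)} (hF : F ⊆ T.edges)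
    (hD : Cvx S (T.edges \ F)) : 2 ^ (F \ C.edges).card ≤ supp C := by
  have h1 : T.edges \ F ⊆ T.edges \ (F \ C.edges) := Finset.sdiff_subset_sdiff subset_rfl Finset.sdiff_subset
  have := supp_aux hS hne (F \ C.edges).card (T.edges \ (F \ C.edges)) T (hD.mono h1) hT
    Finset.sdiff_subset (by
      rw [Finset.card_sdiff_of_subset (Finset.sdiff_subset.trans hF)]
      have := Finset.card_le_card (Finset.sdiff_subset.trans hF : F \ C.edges ⊆ T.edges)
      omega)
  refine this.trans (Nat.card_le_card_of_injective (fun a => ⟨a.1, a.2.1, ?_⟩) ?_)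
  · refine Finset.Subset.trans ?_ a.2.2
    intro e he
    rw [Finset.mem_sdiff]
    exact ⟨hCT he, fun h => (Finset.mem_sdiff.mp h).2 he⟩
  · intro a b h
    simp only [Subtype.mk.injEq] at h
    exact Subtype.ext h

lemma three_nbrs (hS : GenPos S) (hT : IsTriangulation T) {p a : Pt} (hpa : Ed T p a)
    (hI : ¬ ∃ a, HE S p a) : ∃ b c, Ed T p b ∧ Ed T p c ∧
      ∀ r ∈ S, r ≠ p → orient p r a < 0 ∨ orient p r b < 0 ∨ orient p r c < 0 := by
  have ex : ∀ a, Ed T p a → ∃ z, Ed T p z ∧ 0 < orient p a z := by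
    intro a hpa
    by_cases h : ∀ s ∈ S, orient p a s ≤ 0
    · exact absurd ⟨a, hpa.left, hpa.right, hpa.ne, h⟩ hI
    · push Not at h
      obtain ⟨s, hs, hpos⟩ := h
      exact nbr hS hT hpa.left hs hpos
  obtain ⟨z, hz, hz0⟩ := ex a hpa
  obtain ⟨b, hb, hmax⟩ := max_angle p a (S.filter fun c => Ed T p c ∧ 0 < orient p a c)
    ⟨z, by simp [hz.right, hz, hz0]⟩ (by intro c hc; exact (Finset.mem_filter.mp hc).2.2)
  simp only [Finset.mem_filter] at hb hmax
  obtain ⟨hbS, hpb, hab⟩ := hb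
  obtain ⟨c, hpc, hbc⟩ := ex b hpb
  have hac : orient p a c < 0 := by
    rcases lt_trichotomy (orient p a c) 0 with h | h | h
    · exact h
    · rcases gp_eq hS hpa.left hpa.right hpc.right hpa.ne h with h' | h'
      · exact absurd h'.symm hpc.ne
      · rw [h', orient_swap] at hbc; linarith
    · have := hmax c ⟨hpc.right, hpc, h⟩
      linarith
  refine ⟨b, c, hpb, hpc, fun r hr hrp => ?_⟩
  by_contra hcon
  push Not at hcon
  obtain ⟨ra, rb, rc⟩ := hcon
  have key := pl4 p r a b c
  have hca : 0 < orient p c a := by rw [orient_swap]; linarith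
  have k1 := mul_nonneg ra hbc.le
  have k2 := mul_nonneg rb hca.le
  have k3 := mul_nonneg rc hab.le
  have e1 : orient p r a = 0 := by
    have : orient p r a * orient p b c = 0 := by linarith
    exact (mul_eq_zero.mp this).resolve_right hbc.ne'
  have e2 : orient p r b = 0 := by
    have : orient p r b * orient p c a = 0 := by linarith
    exact (mul_eq_zero.mp this).resolve_right hca.ne'
  rcases gp_eq hS hpa.left hr hpa.right hrp.symm e1 with h | h
  · exact hpa.ne h.symm
  · rcases gp_eq hS hpa.left hr hpb.right hrp.symm e2 with h' | h'
    · exact hpb.ne h'.symm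
    · rw [h, h'] at hab; simp at hab

lemma some_nbr (hS : GenPos S) (hT : IsTriangulation T) {p r : Pt} (hp : p ∈ S) (hr : r ∈ S)
    (hrp : r ≠ p) : ∃ a, Ed T p a := by
  obtain ⟨z, hz, -⟩ := nbr hS hT (q := (p.1 + (r.2 - p.2), p.2 - (r.1 - p.1))) hp hr (by
    have : orient p (p.1 + (r.2 - p.2), p.2 - (r.1 - p.1)) r = (r.2-p.2)^2 + (r.1-p.1)^2 := by
      simp only [orient]; ring
    rw [this]
    by_contra hn
    apply hrp
    ext <;> nlinarith [sq_nonneg (r.2-p.2), sq_nonneg (r.1-p.1)])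
  exact ⟨z, hz⟩

lemma card_int (hS : GenPos S) : (S.filter fun p => ¬ ∃ a, HE S p a).card + (HH S).card = S.card := by
  have : (HH S).card = (S.filter fun p => ∃ a, HE S p a).card := by
    rw [← Finset.card_image_of_injOn (s := HH S) (f := Prod.fst)]
    · congr 1
      ext p
      simp only [Finset.mem_image, mem_HH, Finset.mem_filter]
      constructor
      · rintro ⟨⟨p', a⟩, ha, rfl⟩
        exact ⟨ha.1, a, ha⟩
      · rintro ⟨-, a, ha⟩
        exact ⟨(p, a), ha, rfl⟩
    · rintro ⟨a, b⟩ h ⟨a', b'⟩ h' heq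
      simp only [Finset.mem_coe, mem_HH] at h h' heq
      subst heq
      rw [h.unique hS h']
  rw [this, add_comm, Finset.card_filter_add_card_filter_not]

lemma exists_F (hS : GenPos S) (hT : IsTriangulation T) (M : Finset (Sym2 Pt)) (hM : M ⊆ T.edges)
    (u : Pt) (hcov : ∀ p ∈ S, p ≠ u → ∃ a, s(p, a) ∈ M) (k : ℕ) (hk : k + M.card + 4 ≤ S.card) :
    ∃ F ⊆ T.edges, Disjoint F M ∧ Cvx S (T.edges \ F) ∧ F.card = k := by
  have hne : S.Nonempty := Finset.card_pos.mp (by omega)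
  have step : ∀ p, ∃ E : Finset (Sym2 Pt), E ⊆ T.edges ∧ E.card ≤ 2 + (if p = u then 1 else 0) ∧
      (p ∈ S → (¬ ∃ a, HE S p a) → ∀ r ∈ S, r ≠ p → ∃ d, s(p, d) ∈ M ∪ E ∧ orient p r d < 0) := by
    intro p
    by_cases hpS : p ∈ S
    swap
    · exact ⟨∅, by simp, by simp, fun h => absurd h hpS⟩
    by_cases hI : ∃ a, HE S p a
    · exact ⟨∅, by simp, by simp, fun _ h => absurd hI h⟩
    by_cases hr : ∃ r ∈ S, r ≠ p
    swap
    · push Not at hr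
      exact ⟨∅, by simp, by simp, fun _ _ r hr' h => absurd (hr r hr') h⟩
    obtain ⟨r, hr, hrp⟩ := hr
    by_cases hpu : p = u
    · obtain ⟨a, ha⟩ := some_nbr hS hT hpS hr hrp
      obtain ⟨b, c, hb, hc, hh⟩ := three_nbrs hS hT ha hI
      refine ⟨{s(p,a), s(p,b), s(p,c)}, ?_, ?_, ?_⟩
      · intro e he
        simp only [Finset.mem_insert, Finset.mem_singleton] at he
        rcases he with rfl | rfl | rfl <;> assumption
      · rw [if_pos hpu]; exact Finset.card_le_three
      · intro _ _ r hr hrp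
        rcases hh r hr hrp with h | h | h
        · exact ⟨a, by simp, h⟩
        · exact ⟨b, by simp, h⟩
        · exact ⟨c, by simp, h⟩
    · obtain ⟨a, ha⟩ := hcov p hpS hpu
      obtain ⟨b, c, hb, hc, hh⟩ := three_nbrs hS hT (hM ha) hI
      refine ⟨{s(p,b), s(p,c)}, ?_, ?_, ?_⟩
      · intro e he
        simp only [Finset.mem_insert, Finset.mem_singleton] at he
        rcases he with rfl | rfl <;> assumption
      · rw [if_neg hpu]; exact Finset.card_le_two
      · intro _ _ r hr hrp
        rcases hh r hr hrp with h | h | h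
        · exact ⟨a, by simp [ha], h⟩
        · exact ⟨b, by simp, h⟩
        · exact ⟨c, by simp, h⟩
  choose E hE1 hE2 hE3 using step
  set I := S.filter fun p => ¬ ∃ a, HE S p a with hI
  set D := M ∪ (HH S).image (fun g => s(g.1, g.2)) ∪ I.biUnion E with hDdef
  have hDT : D ⊆ T.edges := by
    intro e he
    simp only [hDdef, Finset.mem_union, Finset.mem_image, Finset.mem_biUnion] at he
    rcases he with (he | ⟨g, hg, rfl⟩) | ⟨p, -, he⟩
    · exact hM he
    · exact (mem_HH.mp hg).ed hS hT
    · exact hE1 p he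
  have hDc : Cvx S D := by
    refine ⟨fun p a h => ?_, fun p hp hi r hr hrp => ?_⟩
    · simp only [hDdef, Finset.mem_union, Finset.mem_image]
      exact Or.inl (Or.inr ⟨(p, a), mem_HH.mpr h, rfl⟩)
    · obtain ⟨d, hd, ho⟩ := hE3 p hp hi r hr hrp
      refine ⟨d, ?_, ho⟩
      rw [Finset.mem_union] at hd
      simp only [hDdef, Finset.mem_union, Finset.mem_biUnion]
      rcases hd with hd | hd
      · exact Or.inl (Or.inl hd)
      · exact Or.inr ⟨p, by rw [hI, Finset.mem_filter]; exact ⟨hp, hi⟩, hd⟩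
  have hDcard : D.card ≤ M.card + (HH S).card + (2 * I.card + 1) := by
    refine (Finset.card_union_le _ _).trans (Nat.add_le_add ((Finset.card_union_le _ _).trans
      (Nat.add_le_add_left Finset.card_image_le _)) ?_)
    refine Finset.card_biUnion_le.trans ((Finset.sum_le_sum fun p _ => hE2 p).trans ?_)
    rw [Finset.sum_add_distrib, Finset.sum_const, smul_eq_mul, mul_comm, Finset.sum_ite_eq']
    split_ifs <;> omega
  have h1 := card_edges hS hT hne
  have h2 : I.card + (HH S).card = S.card := card_int hS
  have h3 := Finset.card_sdiff_of_subset hDT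
  obtain ⟨F, hF, hFk⟩ := Finset.exists_subset_card_eq (s := T.edges \ D) (n := k) (by omega)
  refine ⟨F, hF.trans Finset.sdiff_subset, ?_, hDc.mono ?_, hFk⟩
  · rw [Finset.disjoint_left]
    intro e he hm
    have := (Finset.mem_sdiff.mp (hF he)).2
    apply this
    simp [hDdef, hm]
  · intro e he
    rw [Finset.mem_sdiff]
    exact ⟨hDT he, fun h => (Finset.mem_sdiff.mp (hF h)).2 he⟩

end Geo

namespace Geo

def sg (x : ℝ) : ℝ := if 0 < x then 1 else if x < 0 then -1 else 0

lemma sg_pos {x : ℝ} (h : 0 < x) : sg x = 1 := by simp [sg, h]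
lemma sg_neg' {x : ℝ} (h : x < 0) : sg x = -1 := by simp [sg, h, h.le, not_lt.mpr h.le]
lemma sg_sub (x y : ℝ) : sg (x - y) = - sg (y - x) := by
  rcases lt_trichotomy x y with h | h | h
  · rw [sg_neg' (by linarith), sg_pos (by linarith)]
  · subst h; simp [sg]
  · rw [sg_pos (by linarith), sg_neg' (by linarith)]; simp
lemma sg_sq {x : ℝ} (h : x ≠ 0) : sg x * sg x = 1 := by
  rcases lt_or_gt_of_ne h with h | h
  · rw [sg_neg' h]; norm_num
  · rw [sg_pos h]; norm_num

/-- The sign attached to a point with abscissa `z` and orientation `o` relative to a segment. -/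
def hh (xa xb z o : ℝ) : ℝ := if (z - xa) * (z - xb) < 0 ∧ (xb - xa) * o < 0 then -1 else 1

lemma hh_swap (xa xb z o : ℝ) : hh xb xa z (-o) = hh xa xb z o := by
  unfold hh
  have h1 : (z - xb) * (z - xa) = (z - xa) * (z - xb) := by ring
  have h2 : (xa - xb) * -o = (xb - xa) * o := by ring
  rw [h1, h2]

lemma hh_out {xa xb z o : ℝ} (h : 0 ≤ (z - xa) * (z - xb)) : hh xa xb z o = 1 := by
  unfold hh; rw [if_neg]; intro h'; linarith [h'.1]
lemma hh_in {xa xb z o : ℝ} (hab : xa < xb) (h1 : xa < z) (h2 : z < xb) (ho : o ≠ 0) :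
    hh xa xb z o = sg o := by
  have h3 : (z - xa) * (z - xb) < 0 := mul_neg_of_pos_of_neg (by linarith) (by linarith)
  rcases lt_or_gt_of_ne ho with h | h
  · rw [sg_neg' h]; unfold hh
    rw [if_pos]; exact ⟨h3, mul_neg_of_pos_of_neg (by linarith) h⟩
  · rw [sg_pos h]; unfold hh
    rw [if_neg]; rintro ⟨-, h4⟩
    nlinarith [mul_pos (sub_pos.mpr hab) h]

/-- The four point statement. -/
def FP (xa xb xc xd α β γ δ : ℝ) : Prop :=
  sg (xc - xa) * sg (xd - xa) * sg (xc - xb) * sg (xd - xb) =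
    hh xa xb xc α * hh xa xb xd β * (hh xc xd xa γ * hh xc xd xb δ)

def FH (xa xb xc xd α β γ δ : ℝ) : Prop :=
  α ≠ 0 ∧ β ≠ 0 ∧ γ ≠ 0 ∧ δ ≠ 0 ∧ δ * xa - γ * xb + β * xc - α * xd = 0 ∧ δ - γ + β - α = 0 ∧
    (0 < α * β ∨ 0 < γ * δ)

lemma fp0 {xa xb xc xd α β γ δ : ℝ} (h : FH xa xb xc xd α β γ δ) (hab : xa < xb) (hcd : xc < xd)
    (hac : xa < xc) (hbc : xb ≠ xc) (hbd : xb ≠ xd) : FP xa xb xc xd α β γ δ := by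
  obtain ⟨h1, h2, h3, h4, e1, e2, hn⟩ := h
  unfold FP
  rw [sg_pos (sub_pos.mpr hac), sg_pos (sub_pos.mpr (hac.trans hcd))]
  have o1 : hh xc xd xa γ = 1 := hh_out (mul_nonneg_of_nonpos_of_nonpos (by linarith) (by linarith))
  rw [o1]
  rcases lt_or_gt_of_ne hbc with h | h
  · rw [sg_pos (by linarith), sg_pos (by linarith), hh_out (mul_nonneg (by linarith) (by linarith)),
      hh_out (mul_nonneg (by linarith) (by linarith)),
      hh_out (mul_nonneg_of_nonpos_of_nonpos (by linarith) (by linarith))]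
    norm_num
  rcases lt_or_gt_of_ne hbd with h' | h'
  · rw [sg_neg' (by linarith), sg_pos (by linarith), hh_in hab hac h h1,
      hh_out (mul_nonneg (by linarith) (by linarith)), hh_in hcd h h' h4]
    have key : ∀ s : ℝ, (s = 1 ∨ s = -1) → 0 < s * α → 0 < s * δ → False := by
      intro s hs ha hd
      have f1 : (s*γ) * (xb - xc) = -((s*δ) * (xc - xa)) - (s*α) * (xd-xc) := by
        linear_combination s * (-e1 + xc * e2)
      have f2 : s*γ < 0 := by
        by_contra hc
        push Not at hc
        have a1 := mul_nonneg hc (sub_pos.mpr h).le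
        have a2 := mul_pos hd (sub_pos.mpr hac)
        have a3 := mul_pos ha (sub_pos.mpr hcd)
        linarith
      have f3 : (s*β) = s*α + s*γ - s*δ := by linear_combination s * e2
      have f4 : (s*γ) * (xd - xb) = (s*δ) * (xd - xa) + (s*β) * (xd-xc) := by
        linear_combination s * (e1 - xd * e2)
      have f5 : s*β < 0 := by
        by_contra hc
        push Not at hc
        have a1 := mul_nonneg hc (sub_pos.mpr hcd).le
        have a2 := mul_pos hd (sub_pos.mpr (hac.trans hcd))
        have a3 := mul_neg_of_neg_of_pos f2 (sub_pos.mpr h')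
        linarith
      have ss : s * s = 1 := by rcases hs with rfl | rfl <;> norm_num
      rcases hn with hn | hn
      · have := mul_neg_of_pos_of_neg ha f5
        have e : s * α * (s * β) = α * β := by linear_combination (α*β) * ss
        linarith
      · have := mul_neg_of_pos_of_neg hd f2
        have e : s * δ * (s * γ) = γ * δ := by linear_combination (γ*δ) * ss
        linarith
    rcases lt_or_gt_of_ne h1 with g1 | g1 <;> rcases lt_or_gt_of_ne h4 with g4 | g4
    · exact (key (-1) (Or.inr rfl) (by linarith) (by linarith)).elim
    · rw [sg_neg' g1, sg_pos g4]; norm_num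
    · rw [sg_neg' g4, sg_pos g1]; norm_num
    · exact (key 1 (Or.inl rfl) (by linarith) (by linarith)).elim
  · rw [sg_neg' (by linarith), sg_neg' (by linarith), hh_in hab hac h h1,
      hh_in hab (hac.trans hcd) h' h2, hh_out (mul_nonneg (by linarith) (by linarith))]
    have key : ∀ s : ℝ, (s = 1 ∨ s = -1) → 0 < s * α → s * β < 0 → False := by
      intro s hs ha hd
      have f1 : (s*δ) * (xb - xa) = -(s*β) * (xb - xc) + (s*α) * (xb-xd) := by
        linear_combination s * (-e1 + xb * e2)
      have f2 : (s*γ) * (xb - xa) = (s*β) * (xc - xa) - (s*α) * (xd-xa) := by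
        linear_combination s * (-e1 + xa * e2)
      have a1 := mul_pos ha (sub_pos.mpr h')
      have a2 := mul_pos_of_neg_of_neg hd (neg_neg_of_pos (sub_pos.mpr h))
      have a3 := mul_pos ha (sub_pos.mpr (hac.trans hcd))
      have a4 := mul_neg_of_neg_of_pos hd (sub_pos.mpr hac)
      have b1 : 0 < s * δ := pos_of_mul_pos_left (b := xb - xa) (by linarith) (by linarith)
      have b2 : s * γ < 0 := by
        by_contra hc
        push Not at hc
        have := mul_nonneg hc (sub_pos.mpr hab).le
        linarith
      have ss : s * s = 1 := by rcases hs with rfl | rfl <;> norm_num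
      rcases hn with hn | hn
      · have := mul_neg_of_pos_of_neg ha hd
        have e : s * α * (s * β) = α * β := by linear_combination (α*β) * ss
        linarith
      · have := mul_neg_of_pos_of_neg b1 b2
        have e : s * δ * (s * γ) = γ * δ := by linear_combination (γ*δ) * ss
        linarith
    rcases lt_or_gt_of_ne h1 with g1 | g1 <;> rcases lt_or_gt_of_ne h2 with g4 | g4
    · rw [sg_neg' g1, sg_neg' g4]; norm_num
    · exact (key (-1) (Or.inr rfl) (by linarith) (by linarith)).elim
    · exact (key 1 (Or.inl rfl) (by linarith) (by linarith)).elim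
    · rw [sg_pos g1, sg_pos g4]; norm_num

lemma fp1 {xa xb xc xd α β γ δ : ℝ} (h : FH xa xb xc xd α β γ δ) (hab : xa < xb) (hcd : xc < xd)
    (hac : xa ≠ xc) (had : xa ≠ xd) (hbc : xb ≠ xc) (hbd : xb ≠ xd) : FP xa xb xc xd α β γ δ := by
  rcases lt_or_gt_of_ne hac with g | g
  · exact fp0 h hab hcd g hbc hbd
  · obtain ⟨h1, h2, h3, h4, e1, e2, hn⟩ := h
    have := fp0 (xa := xc) (xb := xd) (xc := xa) (xd := xb) (α := γ) (β := δ) (γ := α) (δ := β)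
      ⟨h3, h4, h1, h2, by linarith, by linarith, hn.symm⟩ hcd hab g had.symm hbd.symm
    unfold FP at *
    rw [sg_sub xc xa, sg_sub xd xa, sg_sub xc xb, sg_sub xd xb]
    linear_combination this

lemma fp2 {xa xb xc xd α β γ δ : ℝ} (h : FH xa xb xc xd α β γ δ) (hab : xa < xb) (hcd : xc ≠ xd)
    (hac : xa ≠ xc) (had : xa ≠ xd) (hbc : xb ≠ xc) (hbd : xb ≠ xd) : FP xa xb xc xd α β γ δ := by
  rcases lt_or_gt_of_ne hcd with g | g
  · exact fp1 h hab g hac had hbc hbd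
  · obtain ⟨h1, h2, h3, h4, e1, e2, hn⟩ := h
    have := fp1 (xa := xa) (xb := xb) (xc := xd) (xd := xc) (α := β) (β := α) (γ := -γ) (δ := -δ)
      ⟨h2, h1, neg_ne_zero.mpr h3, neg_ne_zero.mpr h4, by linarith, by linarith,
        by rw [neg_mul_neg, mul_comm β]; exact hn⟩ hab g had hac hbd hbc
    unfold FP at *
    rw [hh_swap, hh_swap] at this
    linear_combination this

lemma fp3 {xa xb xc xd α β γ δ : ℝ} (h : FH xa xb xc xd α β γ δ) (hab : xa ≠ xb) (hcd : xc ≠ xd)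
    (hac : xa ≠ xc) (had : xa ≠ xd) (hbc : xb ≠ xc) (hbd : xb ≠ xd) : FP xa xb xc xd α β γ δ := by
  rcases lt_or_gt_of_ne hab with g | g
  · exact fp2 h g hcd hac had hbc hbd
  · obtain ⟨h1, h2, h3, h4, e1, e2, hn⟩ := h
    have := fp2 (xa := xb) (xb := xa) (xc := xc) (xd := xd) (α := -α) (β := -β) (γ := δ) (δ := γ)
      ⟨neg_ne_zero.mpr h1, neg_ne_zero.mpr h2, h4, h3, by linarith, by linarith,
        by rw [neg_mul_neg, mul_comm δ]; exact hn⟩ g hcd hbc hbd hac had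
    unfold FP at *
    rw [hh_swap, hh_swap] at this
    linear_combination this

lemma cross_of_signs {a b c d : Pt} (h1 : orient a b c * orient a b d < 0)
    (h2 : orient c d a * orient c d b < 0) : ∃ x, x ∈ segment ℝ a b ∧ x ∈ segment ℝ c d := by
  have e2 : orient c d b - orient c d a + orient a b d - orient a b c = 0 := by
    simp only [orient]; ring
  set α := orient a b c with hα
  set β := orient a b d with hβ
  set γ := orient c d a with hγ
  set δ := orient c d b with hδ
  have hne : α - β ≠ 0 := by
    intro h
    have : α = β := by linarith
    rw [this] at h1
    nlinarith [mul_self_nonneg β]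
  have hden : γ - δ = -(α - β) := by linarith
  have ratio : ∀ x y : ℝ, x * y < 0 → 0 ≤ x / (x - y) ∧ x / (x - y) ≤ 1 := by
    intro x y hxy
    rcases mul_neg_iff.mp hxy with ⟨p, q⟩ | ⟨p, q⟩
    · exact ⟨div_nonneg p.le (by linarith), (div_le_one (by linarith)).mpr (by linarith)⟩
    · exact ⟨div_nonneg_of_nonpos p.le (by linarith), (div_le_one_of_neg (by linarith)).mpr (by linarith)⟩
  have r1 := ratio α β h1
  have r2 := ratio γ δ h2
  refine ⟨lp c d (α / (α - β)), ?_, ?_⟩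
  · rw [mem_seg]
    refine ⟨γ / (γ - δ), r2.1, r2.2, ?_⟩
    rw [hden]
    simp only [lp, Prod.mk.injEq]
    constructor
    · field_simp
      rw [hα, hβ, hγ]
      simp only [orient]; ring
    · field_simp
      rw [hα, hβ, hγ]
      simp only [orient]; ring
  · rw [mem_seg]
    exact ⟨_, r1.1, r1.2, rfl⟩

end Geo

namespace Geo
open PfA

lemma prod_half {n : ℕ} (R : Fin n → Fin n → ℝ) (hR : ∀ i, R i i = 1) :
    ∏ i, ∏ j, R i j = ∏ i, ∏ j, (if i < j then R i j * R j i else 1) := by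
  have e1 : ∀ i j, R i j = (if i < j then R i j else 1) * (if j < i then R i j else 1) := by
    intro i j
    rcases lt_trichotomy i j with h | h | h
    · simp [h, not_lt.mpr h.le]
    · subst h; simp [hR]
    · simp [h, not_lt.mpr h.le]
  have e2 : ∀ i j, (if i < j then R i j * R j i else 1) =
      (if i < j then R i j else 1) * (if i < j then R j i else 1) := by
    intro i j; split_ifs <;> simp
  rw [Finset.prod_congr rfl fun i _ => Finset.prod_congr rfl fun j _ => e1 i j,
    Finset.prod_congr rfl fun i _ => Finset.prod_congr rfl fun j _ => e2 i j]
  simp only [Finset.prod_mul_distrib]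
  congr 1
  rw [Finset.prod_comm]

/-- Lexicographic order. -/
def ltII {n : ℕ} (x y : II n) : Prop := x.1 < y.1 ∨ (x.1 = y.1 ∧ x.2 < y.2)

lemma ltII_iff {n : ℕ} (x y : II n) : finProdFinEquiv x < finProdFinEquiv y ↔ ltII x y := by
  obtain ⟨i, k⟩ := x
  obtain ⟨j, l⟩ := y
  unfold ltII
  rw [Fin.lt_def]
  simp only [finProdFinEquiv_apply_val, Fin.lt_def, Fin.ext_iff]
  omega

lemma sign_prod {n : ℕ} (σ : Equiv.Perm (II n)) (f : II n → II n → ℝ) (hf : ∀ x y, f x y = - f y x) :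
    ∏ x, ∏ y, (if ltII x y then f (σ x) (σ y) else 1) =
      ((Equiv.Perm.sign σ : ℤ) : ℝ) * ∏ x, ∏ y, (if ltII x y then f x y else 1) := by
  let e : II n ≃ Fin (n*2) := finProdFinEquiv
  have h := Equiv.Perm.prod_Ioi_comp_eq_sign_mul_prod (R := ℝ) (e.permCongr σ)
    (f := fun i j => f (e.symm i) (e.symm j)) (fun i j => hf _ _)
  rw [Equiv.Perm.sign_permCongr] at h
  have tr : ∀ g : II n → II n → ℝ, ∏ i : Fin (n*2), ∏ j ∈ Finset.Ioi i, g (e.symm i) (e.symm j) =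
      ∏ x, ∏ y, (if ltII x y then g x y else 1) := by
    intro g
    rw [← e.prod_comp]
    refine Finset.prod_congr rfl fun x _ => ?_
    have : Finset.Ioi (e x) = Finset.univ.filter (fun j => e x < j) := by ext; simp
    rw [this, Finset.prod_filter, ← e.prod_comp]
    refine Finset.prod_congr rfl fun y _ => ?_
    simp only [Equiv.symm_apply_apply]
    exact if_congr (ltII_iff x y) rfl rfl
  rw [← tr, ← tr]
  simpa [Equiv.permCongr_apply] using h

section
variable {n : ℕ} (pt : II n → Pt) (w : Pt)

def et (x y z : II n) : ℝ :=
  hh (XX w (pt x)) (XX w (pt y)) (XX w (pt z)) (orient (pt x) (pt y) (pt z))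

lemma et_symm (x y z : II n) : et pt w y x z = et pt w x y z := by
  unfold et; rw [orient_swap', hh_swap]
lemma et_left (x y : II n) : et pt w x y x = 1 := by
  unfold et; apply hh_out; simp
lemma et_right (x y : II n) : et pt w x y y = 1 := by
  unfold et; apply hh_out; simp

def ep (x y : II n) : ℝ := sg (XX w (pt y) - XX w (pt x)) * ∏ z, et pt w x y z

lemma ep_anti (x y : II n) : ep pt w x y = - ep pt w y x := by
  unfold ep
  rw [sg_sub, Finset.prod_congr rfl fun z _ => et_symm pt w y x z]
  ring

lemma hh_sq (a b c d : ℝ) : hh a b c d * hh a b c d = 1 := by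
  unfold hh; split_ifs <;> norm_num

lemma ep_sq (x y : II n) : (ep pt w x y)^2 ≤ 1 := by
  unfold ep
  have h1 : ((∏ z, et pt w x y z))^2 = 1 := by
    rw [sq, ← Finset.prod_mul_distrib]
    exact Finset.prod_eq_one fun z _ => hh_sq _ _ _ _
  rw [mul_pow, h1, mul_one]
  unfold sg; split_ifs <;> norm_num

lemma four_pt {a b c d : Pt} (hab : XX w a ≠ XX w b) (hcd : XX w c ≠ XX w d)
    (hac : XX w a ≠ XX w c) (had : XX w a ≠ XX w d) (hbc : XX w b ≠ XX w c) (hbd : XX w b ≠ XX w d)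
    (h1 : orient a b c ≠ 0) (h2 : orient a b d ≠ 0) (h3 : orient c d a ≠ 0) (h4 : orient c d b ≠ 0)
    (hn : ∀ x, x ∈ segment ℝ a b → x ∈ segment ℝ c d → False) :
    FP (XX w a) (XX w b) (XX w c) (XX w d) (orient a b c) (orient a b d) (orient c d a) (orient c d b) := by
  apply fp3 _ hab hcd hac had hbc hbd
  refine ⟨h1, h2, h3, h4, ?_, ?_, ?_⟩
  · simp only [orient, XX]; ring
  · simp only [orient]; ring
  · by_contra hc
    push Not at hc
    obtain ⟨x, hx, hx'⟩ := cross_of_signs (lt_of_le_of_ne hc.1 (mul_ne_zero h1 h2))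
      (lt_of_le_of_ne hc.2 (mul_ne_zero h3 h4))
    exact hn x hx hx'

/-- The reference sign. -/
def D1 : ℝ := ∏ x, ∏ y, (if ltII x y then sg (XX w (pt y) - XX w (pt x)) else 1)

lemma D1_sq (hX : ∀ x y, XX w (pt x) = XX w (pt y) → x = y) : (D1 pt w)^2 = 1 := by
  unfold D1
  rw [sq, ← Finset.prod_mul_distrib]
  refine Finset.prod_eq_one fun x _ => ?_
  rw [← Finset.prod_mul_distrib]
  refine Finset.prod_eq_one fun y _ => ?_
  split_ifs with h
  · apply sg_sq
    intro h0
    have : y = x := hX _ _ (by linarith)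
    subst this
    simp [ltII] at h
  · norm_num

lemma sign_const (hX : ∀ x y, XX w (pt x) = XX w (pt y) → x = y)
    (hO : ∀ x y z, x ≠ y → x ≠ z → y ≠ z → orient (pt x) (pt y) (pt z) ≠ 0)
    (σ : Equiv.Perm (II n))
    (hσ : ∀ i j, i ≠ j → ∀ p, p ∈ segment ℝ (pt (σ (i,0))) (pt (σ (i,1))) →
      p ∈ segment ℝ (pt (σ (j,0))) (pt (σ (j,1))) → False) :
    ((Equiv.Perm.sign σ : ℤ) : ℝ) * ∏ i : Fin n, ep pt w (σ (i,0)) (σ (i,1)) = D1 pt w := by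
  have h1 := sign_prod σ (fun x y => sg (XX w (pt y) - XX w (pt x))) (fun x y => sg_sub _ _)
  have key : ∏ i : Fin n, ep pt w (σ (i,0)) (σ (i,1)) =
      ∏ x, ∏ y, (if ltII x y then sg (XX w (pt (σ y)) - XX w (pt (σ x))) else 1) := by
    have a1 : ∀ i : Fin n, ep pt w (σ (i,0)) (σ (i,1)) =
        sg (XX w (pt (σ (i,1))) - XX w (pt (σ (i,0)))) *
        ∏ j : Fin n, (et pt w (σ (i,0)) (σ (i,1)) (σ (j,0)) * et pt w (σ (i,0)) (σ (i,1)) (σ (j,1))) := by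
      intro i
      unfold ep
      rw [← prod_II (fun z => et pt w (σ (i,0)) (σ (i,1)) (σ z))]
      congr 1
      exact (Equiv.prod_comp σ (fun z => et pt w (σ (i,0)) (σ (i,1)) z)).symm
    rw [Finset.prod_congr rfl fun i _ => a1 i, Finset.prod_mul_distrib,
      prod_half _ (fun i => by rw [et_left, et_right, one_mul]), ← Finset.prod_mul_distrib, prod_II]
    refine Finset.prod_congr rfl fun i _ => ?_
    rw [← Finset.prod_mul_distrib, prod_II]
    have a2 : sg (XX w (pt (σ (i,1))) - XX w (pt (σ (i,0)))) =
        ∏ j : Fin n, if j = i then sg (XX w (pt (σ (i,1))) - XX w (pt (σ (i,0)))) else 1 := by simp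
    rw [a2, ← Finset.prod_mul_distrib]
    refine Finset.prod_congr rfl fun j _ => ?_
    rcases lt_trichotomy i j with h | h | h
    · have hij : i ≠ j := h.ne
      have inj : ∀ x y : II n, x ≠ y → XX w (pt (σ x)) ≠ XX w (pt (σ y)) :=
        fun x y hxy he => hxy (σ.injective (hX _ _ he))
      have on : ∀ x y z : II n, x ≠ y → x ≠ z → y ≠ z → orient (pt (σ x)) (pt (σ y)) (pt (σ z)) ≠ 0 :=
        fun x y z h1 h2 h3 => hO _ _ _ (fun h => h1 (σ.injective h)) (fun h => h2 (σ.injective h))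
          (fun h => h3 (σ.injective h))
      have := four_pt w (inj (i,0) (i,1) (by simp)) (inj (j,0) (j,1) (by simp))
        (inj (i,0) (j,0) (by simp [hij])) (inj (i,0) (j,1) (by simp))
        (inj (i,1) (j,0) (by simp)) (inj (i,1) (j,1) (by simp [hij]))
        (on (i,0) (i,1) (j,0) (by simp) (by simp [hij]) (by simp))
        (on (i,0) (i,1) (j,1) (by simp) (by simp) (by simp [hij]))
        (on (j,0) (j,1) (i,0) (by simp) (by simp [hij.symm]) (by simp))
        (on (j,0) (j,1) (i,1) (by simp) (by simp) (by simp [hij.symm]))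
        (hσ i j hij)
      unfold FP at this
      simp only [ltII, h, true_or, if_true, hij.symm, if_false]
      unfold et
      rw [one_mul, ← this]
      ring
    · subst h
      simp [ltII]
    · have hij : i ≠ j := h.ne'
      simp [ltII, h.ne, hij, not_lt.mpr h.le]
  rw [key, h1, ← mul_assoc, ← Int.cast_mul]
  have : ((Equiv.Perm.sign σ : ℤ)) * (Equiv.Perm.sign σ : ℤ) = 1 := by
    rw [← Units.val_mul, Int.units_mul_self]; rfl
  rw [this]
  simp [D1]

/-- The weighted count of perfect matchings, fourth power. -/
lemma pm_pow (hX : ∀ x y, XX w (pt x) = XX w (pt y) → x = y)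
    (hO : ∀ x y z, x ≠ y → x ≠ z → y ≠ z → orient (pt x) (pt y) (pt z) ≠ 0)
    (W : II n → II n → ℝ) (hW : ∀ x y, W x y = W y x)
    (hc : ∀ x y z t, x ≠ z → x ≠ t → y ≠ z → y ≠ t → W x y ≠ 0 → W z t ≠ 0 →
      ∀ p, p ∈ segment ℝ (pt x) (pt y) → p ∈ segment ℝ (pt z) (pt t) → False) :
    (∑ σ : Equiv.Perm (II n), ∏ i : Fin n, W (σ (i,0)) (σ (i,1)))^4 ≤
      (2^n * (n.factorial : ℝ))^4 * ∏ x, ∑ y, (W x y)^2 := by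
  let A : Matrix (II n) (II n) ℝ := fun x y => ep pt w x y * W x y
  have hA : ∀ x y, A x y = - A y x := by
    intro x y
    change ep pt w x y * W x y = - (ep pt w y x * W y x)
    rw [ep_anti, hW]; ring
  have hPP : PP A = D1 pt w * ∑ σ : Equiv.Perm (II n), ∏ i : Fin n, W (σ (i,0)) (σ (i,1)) := by
    unfold PP
    rw [Finset.mul_sum]
    refine Finset.sum_congr rfl fun σ _ => ?_
    change _ * ∏ i : Fin n, (ep pt w (σ (i,0)) (σ (i,1)) * W (σ (i,0)) (σ (i,1))) = _
    rw [Finset.prod_mul_distrib, ← mul_assoc]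
    by_cases h0 : ∏ i : Fin n, W (σ (i,0)) (σ (i,1)) = 0
    · rw [h0]; ring
    · replace h0 := Finset.prod_ne_zero_iff.mp h0
      rw [sign_const pt w hX hO σ]
      intro i j hij
      apply hc _ _ _ _ _ _ _ _ (h0 i (Finset.mem_univ _)) (h0 j (Finset.mem_univ _)) <;>
        · intro h
          have := σ.injective h
          simp [hij] at this
  have hb := PP_bound A hA
  rw [hPP, mul_pow] at hb
  have : (D1 pt w)^4 = 1 := by
    have := D1_sq pt w hX
    calc (D1 pt w)^4 = ((D1 pt w)^2)^2 := by ring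
      _ = 1 := by rw [this]; norm_num
  rw [this, one_mul] at hb
  refine hb.trans ?_
  apply mul_le_mul_of_nonneg_left _ (by positivity)
  apply Finset.prod_le_prod
  · intro x _; exact Finset.sum_nonneg fun y _ => sq_nonneg _
  · intro x _
    apply Finset.sum_le_sum
    intro y _
    change (ep pt w x y * W x y)^2 ≤ _
    rw [mul_pow]
    have := ep_sq pt w x y
    nlinarith [sq_nonneg (W x y)]

end
end Geo

namespace Geo
open PfA

/-- `M` is a perfect matching of `V`. -/
def IsPM (V : Finset Pt) (M : Finset (Sym2 Pt)) : Prop :=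
  ∃ n, ∃ φ : II n → Pt, Function.Injective φ ∧ Finset.univ.image φ = V ∧
    M = Finset.univ.image (fun i : Fin n => s(φ (i,0), φ (i,1)))

lemma IsPM.inj {n : ℕ} {φ : II n → Pt} (h : Function.Injective φ) :
    Function.Injective (fun i : Fin n => s(φ (i,0), φ (i,1))) := by
  intro i j hij
  simp only [Sym2.eq_iff] at hij
  rcases hij with ⟨h1, _⟩ | ⟨h1, _⟩
  · have := h h1; simpa using this
  · have := h h1; simp at this

lemma IsPM.card {V : Finset Pt} {M : Finset (Sym2 Pt)} (h : IsPM V M) : 2 * M.card = V.card := by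
  obtain ⟨n, φ, h1, rfl, rfl⟩ := h
  rw [Finset.card_image_of_injective _ h1, Finset.card_image_of_injective _ (IsPM.inj h1)]
  simp [mul_comm]

lemma prod_exp_bound {ι : Type*} (s : Finset ι) (a : ι → ℝ) (ha : ∀ i, 0 ≤ a i) {c : ℝ} (hc : 0 < c) :
    ∏ i ∈ s, a i ≤ c ^ s.card * Real.exp ((∑ i ∈ s, a i) / c - s.card) := by
  have h : ∀ i ∈ s, a i ≤ c * Real.exp (a i / c - 1) := by
    intro i _
    have := Real.add_one_le_exp (a i / c - 1)
    have h2 : a i / c ≤ Real.exp (a i / c - 1) := by linarith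
    rw [div_le_iff₀ hc] at h2
    linarith
  calc ∏ i ∈ s, a i ≤ ∏ i ∈ s, (c * Real.exp (a i / c - 1)) :=
        Finset.prod_le_prod (fun i _ => ha i) h
    _ = c ^ s.card * Real.exp ((∑ i ∈ s, a i) / c - s.card) := by
        rw [Finset.prod_mul_distrib, Finset.prod_const, ← Real.exp_sum, Finset.sum_sub_distrib,
          Finset.sum_div]
        simp

variable {S : Finset Pt}

lemma sum_DE (T : PlaneGraph S) (ω : Sym2 Pt → ℝ) :
    ∑ g ∈ DE T, ω s(g.1, g.2) = 2 * ∑ e ∈ T.edges, ω e := by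
  rw [Finset.mul_sum, ← Finset.sum_fiberwise_of_maps_to (g := fun g : Pt × Pt => s(g.1, g.2)) (t := T.edges)
    (by intro g hg; exact mem_DE.mp hg)]
  refine Finset.sum_congr rfl fun e he => ?_
  induction e using Sym2.ind with | _ p q =>
  have hE : Ed T p q := he
  have : (DE T).filter (fun g => s(g.1, g.2) = s(p, q)) = {(p, q), (q, p)} := by
    ext ⟨a, b⟩
    simp only [Finset.mem_filter, mem_DE, Finset.mem_insert, Finset.mem_singleton, Prod.mk.injEq,
      Sym2.eq_iff]
    constructor
    · exact fun h => h.2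
    · rintro (⟨rfl, rfl⟩ | ⟨rfl, rfl⟩)
      · exact ⟨hE, Or.inl ⟨rfl, rfl⟩⟩
      · exact ⟨hE.symm, Or.inr ⟨rfl, rfl⟩⟩
  rw [this, Finset.sum_pair]
  · rw [Sym2.eq_swap (a := q)]; ring
  · simp only [ne_eq, Prod.mk.injEq, not_and]
    intro h; exact absurd h hE.ne

lemma fiber_card {n : ℕ} {pt : II n → Pt} {V : Finset Pt} (hpt : Function.Injective pt)
    (hV : Finset.univ.image pt = V) {M : Finset (Sym2 Pt)} (hM : IsPM V M) :
    2^n * n.factorial ≤ (Finset.univ.filter (fun σ : Equiv.Perm (II n) =>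
      Finset.univ.image (fun i : Fin n => s(pt (σ (i,0)), pt (σ (i,1)))) = M)).card := by
  have hMc := hM.card
  obtain ⟨m, φ, h1, h2, h3⟩ := hM
  have hmn : m = n := by
    have a1 : V.card = m * 2 := by rw [← h2, Finset.card_image_of_injective _ h1]; simp
    have a2 : V.card = n * 2 := by rw [← hV, Finset.card_image_of_injective _ hpt]; simp
    omega
  subst hmn
  have hex : ∀ x, ∃ y, pt y = φ x := by
    intro x
    have : φ x ∈ Finset.univ.image pt := by rw [hV, ← h2]; simp
    simpa using this
  choose τ hτ using hex
  have hτi : Function.Injective τ := by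
    intro x y hxy
    apply h1
    rw [← hτ, ← hτ, hxy]
  let t : Equiv.Perm (II m) := Equiv.ofBijective τ (Finite.injective_iff_bijective.mp hτi)
  have ht : ∀ x, pt (t x) = φ x := hτ
  let act : Equiv.Perm (Fin m) × (Fin m → Equiv.Perm (Fin 2)) → Equiv.Perm (II m) :=
    fun g => (Equiv.prodShear g.1 g.2).trans t
  have hact : ∀ g x, act g x = t (g.1 x.1, g.2 x.1 x.2) := fun g x => rfl
  have hinj : Function.Injective act := by
    rintro ⟨g1, g2⟩ ⟨k1, k2⟩ h
    have h' : ∀ i k, g1 i = k1 i ∧ g2 i k = k2 i k := by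
      intro i k
      have := congrArg (fun e : Equiv.Perm (II m) => e (i, k)) h
      simp only [hact] at this
      have := t.injective this
      simpa using this
    rw [Prod.mk.injEq]
    constructor
    · ext i; rw [(h' i 0).1]
    · funext i; ext k; rw [(h' i k).2]
  have hc : 2^m * m.factorial =
      (Finset.univ : Finset (Equiv.Perm (Fin m) × (Fin m → Equiv.Perm (Fin 2)))).card := by
    rw [Finset.card_univ, Fintype.card_prod, Fintype.card_perm, Fintype.card_fun, Fintype.card_perm]
    simp [mul_comm]
  rw [hc, ← Finset.card_image_of_injective _ hinj]
  apply Finset.card_le_card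
  intro σ hσ
  rw [Finset.mem_image] at hσ
  obtain ⟨⟨g1, g2⟩, -, rfl⟩ := hσ
  rw [Finset.mem_filter]
  refine ⟨Finset.mem_univ _, ?_⟩
  rw [h3]
  simp only [hact, ht]
  have e : ∀ i, s(φ (g1 i, g2 i 0), φ (g1 i, g2 i 1)) = s(φ (g1 i, 0), φ (g1 i, 1)) := by
    intro i
    have hne : g2 i 0 ≠ g2 i 1 := fun h => by simpa using (g2 i).injective h
    generalize g2 i 0 = a at *
    generalize g2 i 1 = b at *
    fin_cases a <;> fin_cases b <;> first | rfl | exact absurd rfl hne | exact Sym2.eq_swap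
  simp only [e]
  ext x
  simp only [Finset.mem_image, Finset.mem_univ, true_and]
  constructor
  · rintro ⟨i, hi⟩; exact ⟨g1 i, hi⟩
  · rintro ⟨i, hi⟩; exact ⟨g1.symm i, by simpa using hi⟩

theorem match_bound (hS : GenPos S) (T : PlaneGraph S) {V : Finset Pt} (hV : V ⊆ S)
    (ω : Sym2 Pt → ℝ) (hω : ∀ e, 0 ≤ ω e) {c : ℝ} (hc : 0 < c) :
    (∑ M ∈ T.edges.powerset.filter (IsPM V), ∏ e ∈ M, ω e)^4 ≤
      c ^ V.card * Real.exp (2 * (∑ e ∈ T.edges, (ω e)^2) / c - V.card) := by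
  rcases Finset.eq_empty_or_nonempty (T.edges.powerset.filter (IsPM V)) with hemp | ⟨M0, hM0⟩
  · rw [hemp]; simp; positivity
  rw [Finset.mem_filter] at hM0
  obtain ⟨n, pt, hpt, hVpt, -⟩ := hM0.2
  obtain ⟨w, hw⟩ := exists_generic S
  have hmem : ∀ x, pt x ∈ S := fun x => hV (by rw [← hVpt]; simp)
  let W : II n → II n → ℝ := fun x y => if s(pt x, pt y) ∈ T.edges then ω s(pt x, pt y) else 0
  have hWn : ∀ x y, 0 ≤ W x y := by
    intro x y; simp only [W]; split_ifs; exacts [hω _, le_rfl]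
  have hpow := pm_pow pt w (fun x y h => hpt (hw _ (hmem x) _ (hmem y) h))
    (fun x y z h1 h2 h3 h0 => by
      rcases gp_eq hS (hmem x) (hmem y) (hmem z) (fun h => h1 (hpt h)) h0 with h | h
      · exact h2 (hpt h.symm)
      · exact h3 (hpt h.symm)) W
    (fun x y => by simp only [W]; rw [Sym2.eq_swap])
    (fun x y z t h1 h2 h3 h4 hxy hzt p hp hp' => by
      have e1 : Ed T (pt x) (pt y) := by
        by_contra h; exact hxy (if_neg h)
      have e2 : Ed T (pt z) (pt t) := by
        by_contra h; exact hzt (if_neg h)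
      have hne : s(pt x, pt y) ≠ s(pt z, pt t) := by
        intro h
        rw [Sym2.eq_iff] at h
        rcases h with h | h
        · exact h1 (hpt h.1)
        · exact h2 (hpt h.1)
      obtain ⟨r1, r2⟩ := e1.nc e2 hne hp hp'
      rcases r1 with rfl | rfl <;> rcases r2 with r2 | r2
      · exact h1 (hpt r2)
      · exact h2 (hpt r2)
      · exact h3 (hpt r2)
      · exact h4 (hpt r2))
  have hVc : V.card = (Finset.univ : Finset (II n)).card := by
    rw [← hVpt, Finset.card_image_of_injective _ hpt]
  -- lower bound of the sum over permutations
  have hlow : (2^n * (n.factorial : ℝ)) * ∑ M ∈ T.edges.powerset.filter (IsPM V), ∏ e ∈ M, ω e ≤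
      ∑ σ : Equiv.Perm (II n), ∏ i : Fin n, W (σ (i,0)) (σ (i,1)) := by
    let Φ : Equiv.Perm (II n) → Finset (Sym2 Pt) := fun σ =>
      Finset.univ.image (fun i : Fin n => s(pt (σ (i,0)), pt (σ (i,1))))
    calc (2^n * (n.factorial : ℝ)) * ∑ M ∈ T.edges.powerset.filter (IsPM V), ∏ e ∈ M, ω e
        ≤ ∑ M ∈ T.edges.powerset.filter (IsPM V),
          ∑ σ ∈ Finset.univ.filter (fun σ => Φ σ = M), ∏ i : Fin n, W (σ (i,0)) (σ (i,1)) := by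
          rw [Finset.mul_sum]
          apply Finset.sum_le_sum
          intro M hM
          rw [Finset.mem_filter, Finset.mem_powerset] at hM
          have hval : ∀ σ ∈ Finset.univ.filter (fun σ => Φ σ = M),
              ∏ i : Fin n, W (σ (i,0)) (σ (i,1)) = ∏ e ∈ M, ω e := by
            intro σ hσ
            rw [Finset.mem_filter] at hσ
            have hσM := hσ.2
            have hi : Function.Injective (fun i : Fin n => s(pt (σ (i,0)), pt (σ (i,1)))) :=
              IsPM.inj (φ := fun x => pt (σ x)) (hpt.comp σ.injective)
            rw [← hσM, Finset.prod_image (fun i _ j _ h => hi h)]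
            refine Finset.prod_congr rfl fun i _ => ?_
            have : s(pt (σ (i,0)), pt (σ (i,1))) ∈ T.edges := by
              apply hM.1; rw [← hσM]; exact Finset.mem_image_of_mem _ (Finset.mem_univ i)
            exact if_pos this
          rw [Finset.sum_congr rfl hval, Finset.sum_const, nsmul_eq_mul]
          apply mul_le_mul_of_nonneg_right _ (Finset.prod_nonneg fun e _ => hω e)
          have := fiber_card hpt hVpt hM.2
          exact_mod_cast this
      _ ≤ _ := by
          rw [Finset.sum_fiberwise_eq_sum_filter]
          apply Finset.sum_le_sum_of_subset_of_nonneg (Finset.filter_subset _ _)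
          intro σ _ _
          exact Finset.prod_nonneg fun i _ => hWn _ _
  have hpos : (0:ℝ) < 2^n * (n.factorial : ℝ) := by positivity
  have hsn : 0 ≤ ∑ M ∈ T.edges.powerset.filter (IsPM V), ∏ e ∈ M, ω e :=
    Finset.sum_nonneg fun M _ => Finset.prod_nonneg fun e _ => hω e
  have h4 := (pow_le_pow_left₀ (mul_nonneg hpos.le hsn) hlow 4).trans hpow
  rw [mul_pow] at h4
  have h5 := le_of_mul_le_mul_left h4 (pow_pos hpos 4)
  refine h5.trans ((prod_exp_bound _ _ (fun x => Finset.sum_nonneg fun y _ => sq_nonneg _) hc).trans ?_)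
  rw [← hVc]
  apply mul_le_mul_of_nonneg_left _ (by positivity)
  apply Real.exp_le_exp.mpr
  have h6 : ∑ x, ∑ y, (W x y)^2 ≤ 2 * ∑ e ∈ T.edges, (ω e)^2 := by
    rw [← sum_DE T (fun e => (ω e)^2), ← Finset.sum_product', Finset.univ_product_univ]
    have : ∀ g : II n × II n, (W g.1 g.2)^2 =
        if (pt g.1, pt g.2) ∈ DE T then (ω s(pt g.1, pt g.2))^2 else 0 := by
      intro g
      have : (pt g.1, pt g.2) ∈ DE T ↔ s(pt g.1, pt g.2) ∈ T.edges := mem_DE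
      simp only [W, this]
      split_ifs <;> simp
    rw [Finset.sum_congr rfl fun g _ => this g, ← Finset.sum_filter]
    have hi : Set.InjOn (fun g : II n × II n => (pt g.1, pt g.2))
        (Finset.univ.filter fun g : II n × II n => (pt g.1, pt g.2) ∈ DE T : Finset (II n × II n)) := by
      intro g _ h _ e
      simp only [Prod.mk.injEq] at e
      exact Prod.ext (hpt e.1) (hpt e.2)
    rw [← Finset.sum_image (f := fun g : Pt × Pt => (ω s(g.1, g.2))^2) hi]
    apply Finset.sum_le_sum_of_subset_of_nonneg
    · intro g hg
      rw [Finset.mem_image] at hg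
      obtain ⟨k, hk, rfl⟩ := hg
      exact (Finset.mem_filter.mp hk).2
    · intro g _ _; positivity
  have := div_le_div_of_nonneg_right h6 hc.le
  linarith

end Geo

namespace Geo
open PfA
variable {S : Finset Pt}

lemma cyc {C : PlaneGraph S} (hC : IsSpanningCycle C) {u : Pt} (hu : u ∈ S) :
    ∃ g : ℕ → Pt, g 0 = u ∧ g S.card = u ∧ (∀ i < S.card, ∀ j < S.card, g i = g j → i = j) ∧
      (Finset.range S.card).image g = S ∧
      C.edges = (Finset.range S.card).image (fun k => s(g k, g (k+1))) := by
  obtain ⟨h3, f, hf⟩ := hC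
  have hpos : 0 < S.card := by omega
  set i0 := f.symm ⟨u, hu⟩ with hi0
  let ι : ℕ → Fin S.card := fun k => ⟨(i0.val + k) % S.card, Nat.mod_lt _ hpos⟩
  have hι0 : ι 0 = i0 := by
    ext; simp [ι, Nat.mod_eq_of_lt i0.isLt]
  have hιN : ι S.card = i0 := by
    ext; simp [ι, Nat.mod_eq_of_lt i0.isLt]
  have hrot : ∀ k, finRotate S.card (ι k) = ι (k+1) := by
    intro k
    obtain ⟨m, hm⟩ : ∃ m, S.card = m + 1 := ⟨S.card - 1, by omega⟩
    have : ∀ (N : ℕ) (h : 0 < N) (a : ℕ), finRotate N ⟨a % N, Nat.mod_lt _ h⟩ = ⟨(a+1) % N, Nat.mod_lt _ h⟩ := by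
      intro N h a
      obtain ⟨m, rfl⟩ : ∃ m, N = m + 1 := ⟨N - 1, by omega⟩
      rw [finRotate_apply]
      ext
      rw [Fin.val_add]
      simp [Nat.add_mod]
    exact this S.card hpos (i0.val + k)
  have hinj : ∀ i < S.card, ∀ j < S.card, ι i = ι j → i = j := by
    intro i hi j hj h
    have h' : i0.val + i ≡ i0.val + j [MOD S.card] := congrArg Fin.val h
    have h'' := Nat.ModEq.add_left_cancel' _ h'
    exact Nat.ModEq.eq_of_lt_of_lt h'' hi hj
  have hsurj : ∀ x, ∃ k < S.card, ι k = x := by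
    have : Function.Bijective (fun k : Fin S.card => ι k) := by
      apply Finite.injective_iff_bijective.mp
      intro a b h
      exact Fin.ext (hinj a a.isLt b b.isLt h)
    intro x
    obtain ⟨k, hk⟩ := this.2 x
    exact ⟨k, k.isLt, hk⟩
  refine ⟨fun k => (f (ι k) : Pt), ?_, ?_, ?_, ?_, ?_⟩
  · simp [hι0, hi0]
  · simp [hιN, hi0]
  · intro i hi j hj h
    exact hinj i hi j hj (f.injective (Subtype.ext h))
  · ext p
    simp only [Finset.mem_image, Finset.mem_range]
    constructor
    · rintro ⟨k, _, rfl⟩; exact (f (ι k)).2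
    · intro hp
      obtain ⟨k, hk, hk'⟩ := hsurj (f.symm ⟨p, hp⟩)
      exact ⟨k, hk, by simp [hk']⟩
  · rw [hf]
    ext e
    simp only [Finset.mem_image, Finset.mem_range, Finset.mem_univ, true_and]
    constructor
    · rintro ⟨i, rfl⟩
      obtain ⟨k, hk, rfl⟩ := hsurj i
      exact ⟨k, hk, by rw [hrot]⟩
    · rintro ⟨k, hk, rfl⟩
      exact ⟨ι k, by rw [hrot]⟩

lemma pm_of (n : ℕ) (h : ℕ → Pt) (hinj : ∀ i < 2*n, ∀ j < 2*n, h i = h j → i = j) :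
    IsPM ((Finset.range (2*n)).image h) ((Finset.range n).image (fun i => s(h (2*i), h (2*i+1)))) := by
  refine ⟨n, fun x => h (2 * x.1.val + x.2.val), ?_, ?_, ?_⟩
  · rintro ⟨i, k⟩ ⟨j, l⟩ hh
    have := hinj _ (by have := i.isLt; have := k.isLt; simp only; omega) _
      (by have := j.isLt; have := l.isLt; simp only; omega) hh
    have := k.isLt
    have := l.isLt
    simp only [Prod.mk.injEq, Fin.ext_iff]
    simp only at *
    omega
  · ext p
    simp only [Finset.mem_image, Finset.mem_univ, true_and, Finset.mem_range]
    constructor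
    · rintro ⟨⟨i, k⟩, rfl⟩
      exact ⟨_, by have := i.isLt; have := k.isLt; simp only; omega, rfl⟩
    · rintro ⟨a, ha, rfl⟩
      refine ⟨(⟨a / 2, by omega⟩, ⟨a % 2, by omega⟩), ?_⟩
      simp only
      congr 1; omega
  · ext e
    simp only [Finset.mem_image, Finset.mem_univ, true_and, Finset.mem_range]
    constructor
    · rintro ⟨i, hi, rfl⟩
      exact ⟨⟨i, hi⟩, by simp⟩
    · rintro ⟨i, rfl⟩
      exact ⟨i, i.isLt, by simp⟩

lemma dec_disj {N n : ℕ} (g : ℕ → Pt) (h3 : 3 ≤ N) (hn : 2*n ≤ N) (h0 : g N = g 0)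
    (hinj : ∀ i < N, ∀ j < N, g i = g j → i = j) :
    Disjoint ((Finset.range n).image (fun i => s(g (2*i+1), g (2*i+1+1))))
      ((Finset.range n).image (fun i => s(g (2*i), g (2*i+1)))) := by
  rw [Finset.disjoint_left]
  intro e he he'
  simp only [Finset.mem_image, Finset.mem_range] at he he'
  obtain ⟨j, hj, rfl⟩ := he
  obtain ⟨i, hi, hij⟩ := he'
  rw [Sym2.eq_iff] at hij
  rcases hij with ⟨h1, _⟩ | ⟨h1, h2⟩
  · have := hinj _ (by omega) _ (by omega) h1; omega
  · have e1 := hinj _ (by omega) _ (by omega) h2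
    have : i = j := by omega
    subst this
    by_cases hlt : 2*i+1+1 < N
    · have := hinj _ (by omega) _ hlt h1; omega
    · have e2 : 2*i+1+1 = N := by omega
      rw [e2, h0] at h1
      have := hinj _ (by omega) _ (by omega) h1
      omega

lemma shift_inj {N m : ℕ} (g : ℕ → Pt) (hm : m ≤ N) (h0 : g N = g 0)
    (hinj : ∀ i < N, ∀ j < N, g i = g j → i = j) :
    ∀ i < m, ∀ j < m, g (i+1) = g (j+1) → i = j := by
  intro i hi j hj h
  by_cases h1 : i + 1 < N <;> by_cases h2 : j + 1 < N
  · have := hinj _ h1 _ h2 h; omega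
  · have : j + 1 = N := by omega
    rw [this, h0] at h
    have := hinj _ h1 _ (by omega) h; omega
  · have : i + 1 = N := by omega
    rw [this, h0] at h
    have := hinj _ (by omega) _ h2 h; omega
  · omega

lemma dec_even {C : PlaneGraph S} (hC : IsSpanningCycle C) {n : ℕ} (hN : S.card = 2*n) :
    ∃ M1 M2, IsPM S M1 ∧ IsPM S M2 ∧ Disjoint M1 M2 ∧ C.edges = M1 ∪ M2 ∪ ∅ := by
  have h3 := hC.1
  obtain ⟨u, hu⟩ : S.Nonempty := Finset.card_pos.mp (by omega)
  obtain ⟨g, g0, gN, hinj, hS, hE⟩ := cyc hC hu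
  rw [← g0] at gN
  have p1 := pm_of n (fun k => g (k+1)) (shift_inj g hN.ge gN hinj)
  have p2 := pm_of n g (by rw [← hN]; exact hinj)
  have i1 : (Finset.range (2*n)).image (fun k => g (k+1)) = S := by
    rw [← hN]
    apply (Finset.eq_of_subset_of_card_le _ _)
    · intro p hp
      simp only [Finset.mem_image, Finset.mem_range] at hp
      obtain ⟨k, hk, rfl⟩ := hp
      rw [← hS]
      rcases Nat.lt_or_ge (k+1) S.card with h | h
      · exact Finset.mem_image_of_mem _ (Finset.mem_range.mpr h)
      · have : k + 1 = S.card := by omega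
        rw [this, gN]
        exact Finset.mem_image_of_mem _ (Finset.mem_range.mpr (by omega))
    · rw [Finset.card_image_of_injOn]
      · simp
      · intro i hi j hj h
        exact shift_inj g le_rfl gN hinj i (by simpa using hi) j (by simpa using hj) h
  have i2 : (Finset.range (2*n)).image g = S := by rw [← hN]; exact hS
  rw [i1] at p1
  rw [i2] at p2
  refine ⟨_, _, p1, p2, dec_disj g h3 hN.ge gN hinj, ?_⟩
  rw [hE, Finset.union_empty]
  ext e
  simp only [Finset.mem_union, Finset.mem_image, Finset.mem_range]
  constructor
  · rintro ⟨k, hk, rfl⟩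
    rcases Nat.even_or_odd' k with ⟨i, rfl | rfl⟩
    · exact Or.inr ⟨i, by omega, rfl⟩
    · exact Or.inl ⟨i, by omega, rfl⟩
  · rintro (⟨i, hi, rfl⟩ | ⟨i, hi, rfl⟩)
    · exact ⟨2*i+1, by omega, rfl⟩
    · exact ⟨2*i, by omega, rfl⟩

lemma dec_odd {C : PlaneGraph S} (hC : IsSpanningCycle C) {n : ℕ} (hN : S.card = 2*n+1) {u : Pt}
    (hu : u ∈ S) :
    ∃ v, s(u,v) ∈ C.edges ∧ ∃ M1 M2, IsPM (S.erase u) M1 ∧ IsPM (S.erase v) M2 ∧ Disjoint M1 M2 ∧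
      C.edges = M1 ∪ M2 ∪ {s(u,v)} := by
  have h3 := hC.1
  obtain ⟨g, g0, gN, hinj, hS, hE⟩ := cyc hC hu
  have gN' := gN
  rw [← g0] at gN
  have p1 := pm_of n (fun k => g (k+1)) (shift_inj g (by omega) gN hinj)
  have p2 := pm_of n g (fun i hi j hj => hinj i (by omega) j (by omega))
  have i1 : (Finset.range (2*n)).image (fun k => g (k+1)) = S.erase u := by
    ext p
    simp only [Finset.mem_image, Finset.mem_range, Finset.mem_erase]
    constructor
    · rintro ⟨k, hk, rfl⟩
      constructor
      · intro h
        have := hinj _ (by omega) 0 (by omega) (h.trans g0.symm)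
        omega
      · rw [← hS]; exact Finset.mem_image_of_mem _ (Finset.mem_range.mpr (by omega))
    · rintro ⟨hp, hpS⟩
      rw [← hS, Finset.mem_image] at hpS
      obtain ⟨k, hk, rfl⟩ := hpS
      rw [Finset.mem_range] at hk
      have : k ≠ 0 := by rintro rfl; exact hp g0
      exact ⟨k - 1, by omega, by congr 1; omega⟩
  have i2 : (Finset.range (2*n)).image g = S.erase (g (2*n)) := by
    ext p
    simp only [Finset.mem_image, Finset.mem_range, Finset.mem_erase]
    constructor
    · rintro ⟨k, hk, rfl⟩
      constructor
      · intro h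
        have := hinj _ (by omega) _ (by omega) h
        omega
      · rw [← hS]; exact Finset.mem_image_of_mem _ (Finset.mem_range.mpr (by omega))
    · rintro ⟨hp, hpS⟩
      rw [← hS, Finset.mem_image] at hpS
      obtain ⟨k, hk, rfl⟩ := hpS
      rw [Finset.mem_range] at hk
      have : k ≠ 2*n := by rintro rfl; exact hp rfl
      exact ⟨k, by omega, rfl⟩
  rw [i1] at p1
  rw [i2] at p2
  have last : s(g (2*n), g (2*n+1)) = s(u, g (2*n)) := by
    rw [← hN, gN', Sym2.eq_swap]
  refine ⟨g (2*n), ?_, _, _, p1, p2, dec_disj g h3 (by omega) gN hinj, ?_⟩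
  · rw [hE, ← last]
    exact Finset.mem_image.mpr ⟨2*n, Finset.mem_range.mpr (by omega), rfl⟩
  rw [hE, ← last]
  ext e
  simp only [Finset.mem_union, Finset.mem_image, Finset.mem_range, Finset.mem_singleton]
  constructor
  · rintro ⟨k, hk, rfl⟩
    by_cases hk2 : k = 2*n
    · right; rw [hk2]
    left
    rcases Nat.even_or_odd' k with ⟨i, rfl | rfl⟩
    · exact Or.inr ⟨i, by omega, rfl⟩
    · exact Or.inl ⟨i, by omega, rfl⟩
  · rintro ((⟨i, hi, rfl⟩ | ⟨i, hi, rfl⟩) | rfl)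
    · exact ⟨2*i+1, by omega, rfl⟩
    · exact ⟨2*i, by omega, rfl⟩
    · exact ⟨2*n, by omega, rfl⟩

lemma low_deg (hS : GenPos S) {T : PlaneGraph S} (hT : IsTriangulation T) (hne : S.Nonempty) :
    ∃ u ∈ S, (S.filter (fun v => s(u,v) ∈ T.edges)).card ≤ 6 := by
  by_contra hcon
  push Not at hcon
  have h1 := card_edges hS hT hne
  have h2 := card_DE (T := T)
  have h3 : (DE T).card = ∑ u ∈ S, (S.filter (fun v => s(u,v) ∈ T.edges)).card := by
    unfold DE
    rw [Finset.card_filter, Finset.sum_product]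
    refine Finset.sum_congr rfl fun u _ => ?_
    rw [Finset.card_filter]
    refine Finset.sum_congr rfl fun v _ => ?_
    exact if_congr Iff.rfl rfl rfl
  have h4 : ∑ u ∈ S, 7 ≤ ∑ u ∈ S, (S.filter (fun v => s(u,v) ∈ T.edges)).card :=
    Finset.sum_le_sum fun u hu => hcon u hu
  simp at h4
  omega

end Geo

namespace Geo
open PfA
variable {S : Finset Pt}

lemma supp_pos (C : PlaneGraph S) : 1 ≤ supp C := by
  obtain ⟨T, hT, hCT⟩ := extend C
  unfold supp
  haveI : Nonempty {T : PlaneGraph S // IsTriangulation T ∧ C.edges ⊆ T.edges} := ⟨⟨T, hT, hCT⟩⟩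
  exact Nat.card_pos

lemma choose_F (hS : GenPos S) {T : PlaneGraph S} (hT : IsTriangulation T) (hne : S.Nonempty)
    {u : Pt} {V : Finset Pt} (hVS : V ⊆ S) (hV : ∀ p ∈ S, p ≠ u → p ∈ V) {M : Finset (Sym2 Pt)}
    (hM : M ⊆ T.edges) (hPM : IsPM V M) :
    ∃ F ⊆ T.edges, Disjoint F M ∧ S.card ≤ F.card + M.card + 4 ∧ F.card + M.card ≤ S.card ∧
      ∀ C : PlaneGraph S, C.edges ⊆ T.edges → 2 ^ (F \ C.edges).card ≤ supp C := by
  have hMc := hPM.card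
  have hVc := Finset.card_le_card hVS
  by_cases hk : M.card + 4 ≤ S.card
  · obtain ⟨F, h1, h2, h3, h4⟩ := exists_F hS hT M hM u (by
      intro p hp hpu
      obtain ⟨n, φ, hφ, hφV, rfl⟩ := hPM
      have := hV p hp hpu
      rw [← hφV, Finset.mem_image] at this
      obtain ⟨⟨i, k⟩, -, rfl⟩ := this
      have hk : k = 0 ∨ k = 1 := by omega
      rcases hk with rfl | rfl
      · exact ⟨φ (i,1), Finset.mem_image.mpr ⟨i, Finset.mem_univ _, rfl⟩⟩
      · exact ⟨φ (i,0), Finset.mem_image.mpr ⟨i, Finset.mem_univ _, Sym2.eq_swap⟩⟩)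
      (S.card - M.card - 4) (by omega)
    exact ⟨F, h1, h2, by omega, by omega, fun C hC => supp_bound hS hne C hT hC h1 h3⟩
  · refine ⟨∅, by simp, by simp, by simp; omega, by simp; omega, fun C _ => ?_⟩
    simpa using supp_pos C

lemma root4 {x c b : ℝ} {N : ℕ} (hx : 0 ≤ x) (hc : 0 ≤ c) (hb : 0 < b)
    (h : x^4 ≤ c^4 * b^N) : x ≤ c * b ^ ((N:ℝ)/4) := by
  have h1 : (b ^ ((N:ℝ)/4))^4 = b^N := by
    rw [← Real.rpow_natCast, ← Real.rpow_mul hb.le, ← Real.rpow_natCast]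
    congr 1; push_cast; ring
  apply le_of_pow_le_pow_left₀ (n := 4) (by norm_num) (by positivity)
  rw [mul_pow, h1]; exact h

lemma exp_two : Real.exp 2 ≤ 16 := by
  have : Real.exp 2 = Real.exp 1 * Real.exp 1 := by rw [← Real.exp_add]; norm_num
  rw [this]
  have := Real.exp_one_lt_d9
  have := Real.exp_pos 1
  nlinarith

lemma outer_bound (hS : GenPos S) {T : PlaneGraph S} (hT : IsTriangulation T) (hne : S.Nonempty)
    {V : Finset Pt} (hVS : V ⊆ S) (hV : S.card ≤ V.card + 1) :
    ((T.edges.powerset.filter (IsPM V)).card : ℝ) ≤ 2 * 6 ^ ((S.card:ℝ)/4) := by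
  have h := match_bound hS T hVS (fun _ => 1) (fun _ => zero_le_one) (c := 6) (by norm_num)
  simp only [Finset.prod_const_one, Finset.sum_const, nsmul_eq_mul, mul_one, one_pow] at h
  have hE := card_edges hS hT hne
  apply root4 (by positivity) (by norm_num) (by norm_num)
  refine h.trans ?_
  have a1 : (6:ℝ)^V.card ≤ 6^S.card := pow_le_pow_right₀ (by norm_num) (Finset.card_le_card hVS)
  have a2 : Real.exp (2 * (T.edges.card:ℝ) / 6 - V.card) ≤ 16 := by
    refine (Real.exp_le_exp.mpr ?_).trans exp_two
    have b1 : (T.edges.card : ℝ) ≤ 3 * S.card := by exact_mod_cast (by omega)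
    have b2 : (S.card : ℝ) ≤ V.card + 1 := by exact_mod_cast hV
    linarith
  calc _ ≤ (6:ℝ)^S.card * 16 := mul_le_mul a1 a2 (Real.exp_pos _).le (by positivity)
    _ = _ := by norm_num; ring

lemma inner_bound (hS : GenPos S) {T : PlaneGraph S} (hT : IsTriangulation T) (hne : S.Nonempty)
    {V : Finset Pt} (hVS : V ⊆ S) (hV : S.card ≤ V.card + 1) {M F : Finset (Sym2 Pt)}
    (hM : M ⊆ T.edges) (hF : F ⊆ T.edges) (hFM : Disjoint F M) (hMc : S.card ≤ 2 * M.card + 1)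
    (hc : F.card + M.card ≤ S.card) :
    ∑ M2 ∈ T.edges.powerset.filter (IsPM V),
      ∏ e ∈ M2, (if e ∈ F then (2:ℝ) else if e ∈ M then 0 else 1) ≤ 2 * 8 ^ ((S.card:ℝ)/4) := by
  have h := match_bound hS T hVS (fun e => (if e ∈ F then (2:ℝ) else if e ∈ M then 0 else 1))
    (fun _ => by split_ifs <;> norm_num) (c := 8) (by norm_num)
  have hE := card_edges hS hT hne
  apply root4 (Finset.sum_nonneg fun _ _ => Finset.prod_nonneg fun _ _ => by split_ifs <;> norm_num)
    (by norm_num) (by norm_num)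
  refine h.trans ?_
  have a1 : (8:ℝ)^V.card ≤ 8^S.card := pow_le_pow_right₀ (by norm_num) (Finset.card_le_card hVS)
  have hsum : ∑ e ∈ T.edges, (if e ∈ F then (2:ℝ) else if e ∈ M then 0 else 1)^2 =
      T.edges.card + 3 * F.card - M.card := by
    have : ∀ e ∈ T.edges, (if e ∈ F then (2:ℝ) else if e ∈ M then 0 else 1)^2 =
        1 + 3 * (if e ∈ F then 1 else 0) - (if e ∈ M then 1 else 0) := by
      intro e _
      by_cases h1 : e ∈ F
      · have h2 : e ∉ M := Finset.disjoint_left.mp hFM h1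
        simp [h1, h2]; norm_num
      · by_cases h2 : e ∈ M <;> simp [h1, h2]
    rw [Finset.sum_congr rfl this, Finset.sum_sub_distrib, Finset.sum_add_distrib, ← Finset.mul_sum]
    simp only [Finset.sum_boole, Finset.sum_const, nsmul_eq_mul, mul_one]
    rw [Finset.filter_mem_eq_inter, Finset.filter_mem_eq_inter, Finset.inter_eq_right.mpr hF,
      Finset.inter_eq_right.mpr hM]
  have a2 : Real.exp (2 * (∑ e ∈ T.edges, (if e ∈ F then (2:ℝ) else if e ∈ M then 0 else 1)^2) / 8
      - V.card) ≤ 16 := by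
    refine (Real.exp_le_exp.mpr ?_).trans exp_two
    rw [hsum]
    have b1 : (T.edges.card : ℝ) ≤ 3 * S.card := by exact_mod_cast (by omega)
    have b2 : (S.card : ℝ) ≤ V.card + 1 := by exact_mod_cast hV
    have b3 : (S.card : ℝ) ≤ 2 * M.card + 1 := by exact_mod_cast hMc
    have b4 : (F.card : ℝ) + M.card ≤ S.card := by exact_mod_cast hc
    linarith
  calc _ ≤ (8:ℝ)^S.card * 16 := mul_le_mul a1 a2 (Real.exp_pos _).le (by positivity)
    _ = _ := by norm_num; ring

lemma per_T (hS : GenPos S) {T : PlaneGraph S} (hT : IsTriangulation T) (hne : S.Nonempty)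
    {u : Pt} {V : Finset Pt} (hVS : V ⊆ S) (hV : ∀ p ∈ S, p ≠ u → p ∈ V)
    (hVc : S.card ≤ V.card + 1)
    (J : Finset (Finset Pt × Finset (Sym2 Pt)))
    (hJ : ∀ j ∈ J, j.1 ⊆ S ∧ S.card ≤ j.1.card + 1 ∧ j.2.card ≤ 1) (hJc : J.card ≤ 6)
    (𝒞 : Finset (PlaneGraph S)) (h𝒞 : ∀ C ∈ 𝒞, C.edges ⊆ T.edges)
    (hdec : ∀ C ∈ 𝒞, ∃ j ∈ J, ∃ M1 M2, IsPM V M1 ∧ IsPM j.1 M2 ∧ Disjoint M1 M2 ∧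
      C.edges = M1 ∪ M2 ∪ j.2) :
    ∑ C ∈ 𝒞, (1:ℝ) / supp C ≤ 768 * 12 ^ ((S.card:ℝ)/4) := by
  have hF : ∀ M, ∃ F, M ∈ T.edges.powerset.filter (IsPM V) →
      (F ⊆ T.edges ∧ Disjoint F M ∧ S.card ≤ F.card + M.card + 4 ∧ F.card + M.card ≤ S.card ∧
      ∀ C : PlaneGraph S, C.edges ⊆ T.edges → 2 ^ (F \ C.edges).card ≤ supp C) := by
    intro M
    by_cases hM : M ∈ T.edges.powerset.filter (IsPM V)
    · have hM' := hM
      rw [Finset.mem_filter, Finset.mem_powerset] at hM'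
      obtain ⟨F, h⟩ := choose_F hS hT hne hVS hV hM'.1 hM'.2
      exact ⟨F, fun _ => h⟩
    · exact ⟨∅, fun h => absurd h hM⟩
  choose F hF using hF
  have hdec' : ∀ C, ∃ q : (Finset Pt × Finset (Sym2 Pt)) × Finset (Sym2 Pt) × Finset (Sym2 Pt),
      C ∈ 𝒞 → (q.1 ∈ J ∧ IsPM V q.2.1 ∧ IsPM q.1.1 q.2.2 ∧ Disjoint q.2.1 q.2.2 ∧
        C.edges = q.2.1 ∪ q.2.2 ∪ q.1.2) := by
    intro C
    by_cases hC : C ∈ 𝒞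
    · obtain ⟨j, hj, M1, M2, h⟩ := hdec C hC
      exact ⟨(j, M1, M2), fun _ => ⟨hj, h⟩⟩
    · exact ⟨((∅, ∅), ∅, ∅), fun h => absurd h hC⟩
  choose q hq using hdec'
  let ω : Finset (Sym2 Pt) → Sym2 Pt → ℝ :=
    fun M e => (if e ∈ F M then (2:ℝ) else if e ∈ M then 0 else 1)
  have hω : ∀ M e, 0 ≤ ω M e := fun M e => by simp only [ω]; split_ifs <;> norm_num
  let val : (Finset Pt × Finset (Sym2 Pt)) × Finset (Sym2 Pt) × Finset (Sym2 Pt) → ℝ :=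
    fun q => 2 * (1/2)^(F q.2.1).card * ∏ e ∈ q.2.2, ω q.2.1 e
  have hval : ∀ q, 0 ≤ val q := fun q =>
    mul_nonneg (by positivity) (Finset.prod_nonneg fun e _ => hω _ _)
  have hsub : ∀ C ∈ 𝒞, (q C).2.1 ∈ T.edges.powerset.filter (IsPM V) ∧
      (q C).2.2 ∈ T.edges.powerset.filter (IsPM (q C).1.1) := by
    intro C hC
    obtain ⟨h1, h2, h3, h4, h5⟩ := hq C hC
    have h6 := h𝒞 C hC
    rw [h5] at h6
    simp only [Finset.mem_filter, Finset.mem_powerset]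
    exact ⟨⟨fun e he => h6 (by simp [he]), h2⟩, ⟨fun e he => h6 (by simp [he]), h3⟩⟩
  -- single term
  have hterm : ∀ C ∈ 𝒞, (1:ℝ) / supp C ≤ val (q C) := by
    intro C hC
    obtain ⟨h1, h2, h3, h4, h5⟩ := hq C hC
    obtain ⟨f1, f2, f3, f4, f5⟩ := hF _ (hsub C hC).1
    have hs := f5 C (h𝒞 C hC)
    set M1 := (q C).2.1
    set M2 := (q C).2.2
    have hprod : ∏ e ∈ M2, ω M1 e = 2 ^ (M2 ∩ F M1).card := by
      rw [← Finset.prod_const, ← Finset.filter_mem_eq_inter, Finset.prod_filter]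
      refine Finset.prod_congr rfl fun e he => ?_
      have : e ∉ M1 := Finset.disjoint_right.mp h4 he
      simp [ω, this]
    have hcard : (F M1).card ≤ (F M1 \ C.edges).card + (M2 ∩ F M1).card + 1 := by
      have : F M1 ⊆ (F M1 \ C.edges) ∪ (M2 ∩ F M1) ∪ (q C).1.2 := by
        intro e he
        have : e ∉ M1 := Finset.disjoint_left.mp f2 he
        rw [h5]
        simp only [Finset.mem_union, Finset.mem_sdiff, Finset.mem_inter]
        tauto
      have a := Finset.card_le_card this
      have b := Finset.card_union_le ((F M1 \ C.edges) ∪ (M2 ∩ F M1)) (q C).1.2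
      have c := Finset.card_union_le (F M1 \ C.edges) (M2 ∩ F M1)
      have d := (hJ _ h1).2.2
      omega
    change _ ≤ 2 * (1/2)^(F M1).card * ∏ e ∈ M2, ω M1 e
    rw [hprod]
    have hs' : (2:ℝ) ^ (F M1 \ C.edges).card ≤ supp C := by exact_mod_cast hs
    have hp : (0:ℝ) < 2 ^ (F M1 \ C.edges).card := by positivity
    refine (one_div_le_one_div_of_le hp hs').trans ?_
    rw [div_le_iff₀ hp, one_div, inv_pow]
    have : (2:ℝ)^(F M1).card ≤ 2^((F M1 \ C.edges).card + (M2 ∩ F M1).card + 1) :=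
      pow_le_pow_right₀ (by norm_num) hcard
    rw [pow_add, pow_add, pow_one] at this
    have hp2 : (0:ℝ) < 2 ^ (F M1).card := by positivity
    rw [← div_eq_mul_inv, div_mul_eq_mul_div, div_mul_eq_mul_div, le_div_iff₀ hp2]
    linarith
  have hinj : Set.InjOn q (𝒞 : Set (PlaneGraph S)) := by
    intro C hC C' hC' h
    apply pg_ext
    rw [(hq C hC).2.2.2.2, (hq C' hC').2.2.2.2, h]
  have hfour : ∀ M1 ∈ T.edges.powerset.filter (IsPM V),
      (1/2:ℝ)^(F M1).card ≤ 16 * (1/4) ^ ((S.card:ℝ)/4) := by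
    intro M1 hM1
    obtain ⟨f1, f2, f3, f4, f5⟩ := hF _ hM1
    have hc := (Finset.mem_filter.mp hM1).2.card
    have hv := Finset.card_le_card hVS
    apply root4 (by positivity) (by norm_num) (by norm_num)
    have e1 : ((1/2:ℝ)^(F M1).card)^4 = 16^4 * (1/4:ℝ)^(2 * (F M1).card + 8) := by
      rw [← pow_mul, mul_comm _ 4, pow_mul, pow_add, pow_mul]; norm_num
      ring
    rw [e1]
    apply mul_le_mul_of_nonneg_left _ (by positivity)
    apply pow_le_pow_of_le_one (by norm_num) (by norm_num)
    omega
  calc ∑ C ∈ 𝒞, (1:ℝ) / supp C ≤ ∑ C ∈ 𝒞, val (q C) := Finset.sum_le_sum hterm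
    _ = ∑ x ∈ 𝒞.image q, val x := (Finset.sum_image hinj).symm
    _ ≤ ∑ x ∈ J.sigma (fun j => (T.edges.powerset.filter (IsPM V)) ×ˢ
          (T.edges.powerset.filter (IsPM j.1))), val (x.1, x.2.1, x.2.2) := by
        rw [← Finset.sum_image (s := J.sigma (fun j => (T.edges.powerset.filter (IsPM V)) ×ˢ
          (T.edges.powerset.filter (IsPM j.1)))) (f := val)
          (g := fun x => (x.1, x.2.1, x.2.2)) (by
            rintro ⟨a, b, c⟩ _ ⟨a', b', c'⟩ _ h
            simp only [Prod.mk.injEq] at h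
            obtain ⟨rfl, rfl, rfl⟩ := h; rfl)]
        apply Finset.sum_le_sum_of_subset_of_nonneg
        · intro x hx
          rw [Finset.mem_image] at hx ⊢
          obtain ⟨C, hC, rfl⟩ := hx
          exact ⟨⟨(q C).1, (q C).2.1, (q C).2.2⟩, Finset.mem_sigma.mpr ⟨(hq C hC).1,
            Finset.mem_product.mpr (hsub C hC)⟩, rfl⟩
        · intro x _ _; exact hval x
    _ = ∑ j ∈ J, ∑ M1 ∈ T.edges.powerset.filter (IsPM V), 2 * (1/2)^(F M1).card *
          ∑ M2 ∈ T.edges.powerset.filter (IsPM j.1), ∏ e ∈ M2, ω M1 e := by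
        rw [Finset.sum_sigma]
        refine Finset.sum_congr rfl fun j _ => ?_
        rw [Finset.sum_product]
        refine Finset.sum_congr rfl fun M1 _ => ?_
        rw [Finset.mul_sum]
    _ ≤ ∑ j ∈ J, ∑ M1 ∈ T.edges.powerset.filter (IsPM V),
          2 * (16 * (1/4) ^ ((S.card:ℝ)/4)) * (2 * 8 ^ ((S.card:ℝ)/4)) := by
        apply Finset.sum_le_sum
        intro j hj
        apply Finset.sum_le_sum
        intro M1 hM1
        obtain ⟨f1, f2, f3, f4, f5⟩ := hF _ hM1
        have hM1' := Finset.mem_filter.mp hM1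
        apply mul_le_mul
        · linarith [hfour M1 hM1]
        · exact inner_bound hS hT hne (hJ j hj).1 (hJ j hj).2.1 (Finset.mem_powerset.mp hM1'.1) f1 f2
            (by rw [hM1'.2.card]; exact hVc) f4
        · exact Finset.sum_nonneg fun _ _ => Finset.prod_nonneg fun _ _ => hω _ _
        · positivity
    _ = J.card * (((T.edges.powerset.filter (IsPM V)).card : ℝ) *
          (2 * (16 * (1/4) ^ ((S.card:ℝ)/4)) * (2 * 8 ^ ((S.card:ℝ)/4)))) := by
        simp only [Finset.sum_const, nsmul_eq_mul]
    _ ≤ 6 * ((2 * 6 ^ ((S.card:ℝ)/4)) *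
          (2 * (16 * (1/4) ^ ((S.card:ℝ)/4)) * (2 * 8 ^ ((S.card:ℝ)/4)))) := by
        apply mul_le_mul
        · exact_mod_cast hJc
        · apply mul_le_mul_of_nonneg_right (outer_bound hS hT hne hVS hVc) (by positivity)
        · positivity
        · norm_num
    _ = 768 * 12 ^ ((S.card:ℝ)/4) := by
        have : (12:ℝ) ^ ((S.card:ℝ)/4) = 6 ^ ((S.card:ℝ)/4) * ((1/4) ^ ((S.card:ℝ)/4) * 8 ^ ((S.card:ℝ)/4)) := by
          rw [← Real.mul_rpow (by norm_num) (by norm_num), ← Real.mul_rpow (by norm_num) (by norm_num)]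
          norm_num
        rw [this]; ring

end Geo

namespace Geo
open PfA
variable {S : Finset Pt}

lemma per_T' (hS : GenPos S) {T : PlaneGraph S} (hT : IsTriangulation T) (hne : S.Nonempty)
    (𝒞 : Finset (PlaneGraph S)) (h𝒞 : ∀ C ∈ 𝒞, C.edges ⊆ T.edges)
    (hcyc : ∀ C ∈ 𝒞, IsSpanningCycle C) :
    ∑ C ∈ 𝒞, (1:ℝ) / supp C ≤ 768 * 12 ^ ((S.card:ℝ)/4) := by
  rcases Nat.even_or_odd' S.card with ⟨n, hn | hn⟩
  · refine per_T hS hT hne (u := (0,0)) (V := S) le_rfl (fun p hp _ => hp) (by omega)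
      {(S, ∅)} ?_ (by simp) 𝒞 h𝒞 ?_
    · intro j hj
      rw [Finset.mem_singleton] at hj
      subst hj
      simp
    · intro C hC
      obtain ⟨M1, M2, h⟩ := dec_even (hcyc C hC) hn
      exact ⟨(S, ∅), by simp, M1, M2, h⟩
  · obtain ⟨u, hu, hdeg⟩ := low_deg hS hT hne
    refine per_T hS hT hne (u := u) (V := S.erase u) (Finset.erase_subset _ _)
      (fun p hp hpu => Finset.mem_erase.mpr ⟨hpu, hp⟩) (by rw [Finset.card_erase_of_mem hu]; omega)
      ((S.filter (fun v => s(u,v) ∈ T.edges)).image fun v => (S.erase v, {s(u,v)})) ?_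
      (Finset.card_image_le.trans hdeg) 𝒞 h𝒞 ?_
    · intro j hj
      rw [Finset.mem_image] at hj
      obtain ⟨v, hv, rfl⟩ := hj
      have hvS := (Finset.mem_filter.mp hv).1
      refine ⟨Finset.erase_subset _ _, ?_, by simp⟩
      simp only
      rw [Finset.card_erase_of_mem hvS]; omega
    · intro C hC
      obtain ⟨v, hv, M1, M2, h⟩ := dec_odd (hcyc C hC) hn hu
      refine ⟨(S.erase v, {s(u,v)}), ?_, M1, M2, h⟩
      rw [Finset.mem_image]
      refine ⟨v, Finset.mem_filter.mpr ⟨?_, h𝒞 C hC hv⟩, rfl⟩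
      exact C.endpoint_mem _ hv v (by simp)

lemma main_bound (hS : GenPos S) :
    (scCount S : ℝ) ≤ 768 * 12 ^ ((S.card:ℝ)/4) * triCount S := by
  by_cases hne : S.Nonempty
  swap
  · have h0 : scCount S = 0 := by
      unfold scCount
      rw [Nat.card_eq_zero]
      left
      constructor
      rintro ⟨C, hC, -⟩
      rw [Finset.not_nonempty_iff_eq_empty.mp hne] at hC
      simp at hC
    rw [h0, Nat.cast_zero]; positivity
  letI : Fintype (PlaneGraph S) := Fintype.ofFinite _
  have hsc : scCount S = (Finset.univ.filter fun C : PlaneGraph S => IsSpanningCycle C).card := by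
    unfold scCount
    rw [Nat.card_eq_fintype_card, Fintype.card_subtype]
  have htr : triCount S = (Finset.univ.filter fun T : PlaneGraph S => IsTriangulation T).card := by
    unfold triCount
    rw [Nat.card_eq_fintype_card, Fintype.card_subtype]
  have hsupp : ∀ C : PlaneGraph S, supp C = (Finset.univ.filter fun T : PlaneGraph S =>
      IsTriangulation T ∧ C.edges ⊆ T.edges).card := by
    intro C
    unfold supp
    rw [Nat.card_eq_fintype_card, Fintype.card_subtype]
  set Cy := (Finset.univ.filter fun C : PlaneGraph S => IsSpanningCycle C) with hCy
  set Tr := (Finset.univ.filter fun T : PlaneGraph S => IsTriangulation T) with hTr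
  rw [hsc, htr]
  calc (Cy.card : ℝ) = ∑ C ∈ Cy, ∑ T ∈ Tr, (if C.edges ⊆ T.edges then (1:ℝ) / supp C else 0) := by
        rw [Finset.card_eq_sum_ones, Nat.cast_sum]
        refine Finset.sum_congr rfl fun C _ => ?_
        rw [← Finset.sum_filter, Finset.sum_const, hTr, Finset.filter_filter, ← hsupp, nsmul_eq_mul]
        have : (supp C : ℝ) ≠ 0 := by
          have := supp_pos C
          exact_mod_cast (by omega)
        rw [mul_one_div, div_self this]; simp
    _ = ∑ T ∈ Tr, ∑ C ∈ Cy, (if C.edges ⊆ T.edges then (1:ℝ) / supp C else 0) := Finset.sum_comm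
    _ ≤ ∑ T ∈ Tr, 768 * 12 ^ ((S.card:ℝ)/4) := by
        apply Finset.sum_le_sum
        intro T hT
        rw [← Finset.sum_filter]
        apply per_T' hS (Finset.mem_filter.mp hT).2 hne
        · intro C hC; exact (Finset.mem_filter.mp hC).2
        · intro C hC
          exact (Finset.mem_filter.mp (Finset.mem_filter.mp hC).1).2
    _ = _ := by rw [Finset.sum_const, nsmul_eq_mul, mul_comm]

end Geo

/-- There is an absolute constant `c > 0` such that for every finite
set `S` of `N` points in general position, `sc(S) ≤ c · 12^{N/4} · tr(S)`. -/
theorem statement0 :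
    ∃ c : ℝ, 0 < c ∧ ∀ S : Finset Pt, GenPos S →
      (scCount S : ℝ) ≤ c * (12 : ℝ) ^ ((S.card : ℝ) / 4) * (triCount S : ℝ) := by
  exact ⟨768, by norm_num, fun S hS => Geo.main_bound hS⟩

end
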